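/- Let n ≥ 2, 0 < E_min ≤ E_max, and 1/2 < s ≤ 1, and let V : (0,∞) → ℝ be measurable, essentially bounded, and compactly supported. Then there exist constants C, h₀ > 0 such that for every ε > 0, every h ∈ (0, h₀], every E ∈ [E_min, E_max], and every smooth compactly supported u : ℝⁿ → ℂ, one has ‖⟨x⟩^{−s} u‖_{L²(ℝⁿ)} ≤ e^{C/h} ‖⟨x⟩^{s} (−h² Δu + V(|x|) u − (E + iε) u)‖_{L²(ℝⁿ)}. (This is the a priori-estimate form of the weighted resolvent bound ‖⟨x⟩^{−s}(−h²Δ + V(|x|) − E − iε)^{−1}⟨x⟩^{−s}‖_{L²→L²} ≤ e^{C/h}.) -/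

import Mathlib

open MeasureTheory Set

/-- The Laplacian `Δu(x) = ∑ j ∂²u/∂x_j²` of a function on `ℝⁿ`,
expressed via the second iterated Fréchet derivative. -/
noncomputable def lapl {n : ℕ} (u : EuclideanSpace ℝ (Fin n) → ℂ)
    (x : EuclideanSpace ℝ (Fin n)) : ℂ :=
  ∑ j : Fin n, iteratedFDeriv ℝ 2 u x
    ![EuclideanSpace.single j (1 : ℝ), EuclideanSpace.single j (1 : ℝ)]

/-- The Japanese-bracket weight `⟨t⟩^s = (1 + t²)^{s/2}`. -/
noncomputable def jbr (s t : ℝ) : ℝ := (1 + t ^ 2) ^ (s / 2)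

/-- First-order form, in the variable `p = h r z'`, of the radial equation
`-h²(z'' + z'/r) + (m/r²) z + V z - (E + iε) z = g` on `(0, ∞)`. -/
structure RadialODE (h m E ε Cv R T K : ℝ) (V : ℝ → ℝ) (z p g : ℝ → ℂ) : Prop where
  deriv_z : ∀ r > 0, HasDerivAt z (p r / ((h * r : ℝ) : ℂ)) r
  deriv_p : ∀ r > 0, HasDerivAt p (((m : ℂ) * z r + ((r ^ 2 : ℝ) : ℂ) *
    (((V r - E : ℝ) : ℂ) - (ε : ℂ) * Complex.I) * z r - ((r ^ 2 : ℝ) : ℂ) * g r)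
      / ((h * r : ℝ) : ℂ)) r
  meas_z : Measurable z
  meas_p : Measurable p
  meas_g : Measurable g
  norm_z : ∀ r > 0, ‖z r‖ ≤ K
  norm_p : ∀ r > 0, ‖p r‖ ^ 2 ≤ K * r
  norm_mz : ∀ r > 0, m * ‖z r‖ ^ 2 ≤ K * r
  norm_g : ∀ r > 0, ‖g r‖ ≤ K
  z_zero : ∀ r ≥ T, z r = 0
  p_zero : ∀ r ≥ T, p r = 0
  g_zero : ∀ r ≥ T, g r = 0
  norm_V : ∀ r > 0, |V r| ≤ Cv
  V_zero : ∀ r > R, V r = 0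

namespace RadialODE

variable {h m E ε Cv R T K : ℝ} {V : ℝ → ℝ} {z p g : ℝ → ℂ}

/-- The energy `ω (|p|² - m|z|² + r² E |z|²) + h χ Re (p (conj z))`. -/
noncomputable def energy (h m E : ℝ) (z p : ℝ → ℂ) (ω χ : ℝ → ℝ) (r : ℝ) : ℝ :=
  ω r * (((p r).re ^ 2 + (p r).im ^ 2) + (r ^ 2 * E - m) * ((z r).re ^ 2 + (z r).im ^ 2))
    + h * χ r * ((p r).re * (z r).re + (p r).im * (z r).im)

lemma re_deriv {f : ℝ → ℂ} {f' : ℂ} {x : ℝ} (hf : HasDerivAt f f' x) :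
    HasDerivAt (fun t => (f t).re) f'.re x :=
  (Complex.reCLM.hasFDerivAt.comp_hasDerivAt x hf)

lemma im_deriv {f : ℝ → ℂ} {f' : ℂ} {x : ℝ} (hf : HasDerivAt f f' x) :
    HasDerivAt (fun t => (f t).im) f'.im x :=
  (Complex.imCLM.hasFDerivAt.comp_hasDerivAt x hf)

lemma re_z (H : RadialODE h m E ε Cv R T K V z p g) {r : ℝ} (hr : 0 < r) :
    HasDerivAt (fun t => (z t).re) ((p r).re / (h * r)) r := by
  have := re_deriv (H.deriv_z r hr)
  rwa [Complex.div_ofReal_re] at this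

lemma im_z (H : RadialODE h m E ε Cv R T K V z p g) {r : ℝ} (hr : 0 < r) :
    HasDerivAt (fun t => (z t).im) ((p r).im / (h * r)) r := by
  have := im_deriv (H.deriv_z r hr)
  rwa [Complex.div_ofReal_im] at this

lemma re_p (H : RadialODE h m E ε Cv R T K V z p g) {r : ℝ} (hr : 0 < r) :
    HasDerivAt (fun t => (p t).re) ((m * (z r).re + r ^ 2 * ((V r - E) * (z r).re + ε * (z r).im)
      - r ^ 2 * (g r).re) / (h * r)) r := by
  have := re_deriv (H.deriv_p r hr)
  rw [Complex.div_ofReal_re] at this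
  convert this using 2
  simp [-Complex.ofReal_pow]
  ring

lemma im_p (H : RadialODE h m E ε Cv R T K V z p g) {r : ℝ} (hr : 0 < r) :
    HasDerivAt (fun t => (p t).im) ((m * (z r).im + r ^ 2 * ((V r - E) * (z r).im - ε * (z r).re)
      - r ^ 2 * (g r).im) / (h * r)) r := by
  have := im_deriv (H.deriv_p r hr)
  rw [Complex.div_ofReal_im] at this
  convert this using 2
  simp [-Complex.ofReal_pow]
  ring

lemma energy_deriv (H : RadialODE h m E ε Cv R T K V z p g) (hh : 0 < h) {ω χ : ℝ → ℝ}
    {ω' χ' r : ℝ} (hr : 0 < r) (hω : HasDerivAt ω ω' r) (hχ : HasDerivAt χ χ' r) :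
    ∃ D, HasDerivAt (energy h m E z p ω χ) D r ∧
      r * D = r * ω' * (((p r).re ^ 2 + (p r).im ^ 2)
          + (r ^ 2 * E - m) * ((z r).re ^ 2 + (z r).im ^ 2))
        + 2 * ω r * r ^ 2 * E * ((z r).re ^ 2 + (z r).im ^ 2)
        + 2 * ω r * r ^ 2 / h * (V r * ((p r).re * (z r).re + (p r).im * (z r).im)
          + ε * ((p r).re * (z r).im - (p r).im * (z r).re)
          - ((p r).re * (g r).re + (p r).im * (g r).im))
        + h * (r * χ') * ((p r).re * (z r).re + (p r).im * (z r).im)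
        + χ r * ((p r).re ^ 2 + (p r).im ^ 2)
        + χ r * (m + r ^ 2 * (V r - E)) * ((z r).re ^ 2 + (z r).im ^ 2)
        - χ r * r ^ 2 * ((g r).re * (z r).re + (g r).im * (z r).im) := by
  have h1 := H.re_z hr
  have h2 := H.im_z hr
  have h3 := H.re_p hr
  have h4 := H.im_p hr
  have hid : HasDerivAt (fun t : ℝ => t ^ 2 * E - m) (2 * r * E) r := by
    have := ((hasDerivAt_pow 2 r).mul_const E).sub_const m
    simpa using this
  have key := ((hω.mul (((h3.pow 2).add (h4.pow 2)).add (hid.mul ((h1.pow 2).add (h2.pow 2))))).add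
    ((hχ.const_mul h).mul ((h3.mul h1).add (h4.mul h2))))
  refine ⟨_, key, ?_⟩
  simp only [Pi.add_apply, Pi.mul_apply, Pi.pow_apply]
  have hr' := hr.ne'
  have hh' := hh.ne'
  field_simp
  push_cast
  ring

lemma normSq' (w : ℂ) : w.re ^ 2 + w.im ^ 2 = ‖w‖ ^ 2 := by
  rw [Complex.sq_norm, Complex.normSq_apply]; ring

lemma abs_re_mul_le (w v : ℂ) : |w.re * v.re + w.im * v.im| ≤ ‖w‖ * ‖v‖ := by
  apply abs_le_of_sq_le_sq _ (by positivity)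
  rw [mul_pow, ← normSq', ← normSq']
  nlinarith [sq_nonneg (w.re * v.im - w.im * v.re)]

lemma abs_im_mul_le (w v : ℂ) : |w.re * v.im - w.im * v.re| ≤ ‖w‖ * ‖v‖ := by
  apply abs_le_of_sq_le_sq _ (by positivity)
  rw [mul_pow, ← normSq', ← normSq']
  nlinarith [sq_nonneg (w.re * v.re + w.im * v.im)]

lemma energy_deriv_ge (H : RadialODE h m E ε Cv R T K V z p g) (hh : 0 < h) (hε : 0 ≤ ε)
    {ω χ : ℝ → ℝ}
    {ω' χ' r : ℝ} (hr : 0 < r) (hω : HasDerivAt ω ω' r) (hχ : HasDerivAt χ χ' r)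
    (hω0 : 0 ≤ ω r) (hχ0 : 0 ≤ χ r) :
    ∃ D, HasDerivAt (energy h m E z p ω χ) D r ∧
      r * ω' * (‖p r‖ ^ 2 + (r ^ 2 * E - m) * ‖z r‖ ^ 2)
        + 2 * ω r * r ^ 2 * E * ‖z r‖ ^ 2
        - 2 * ω r * r ^ 2 / h * (|V r| * (‖p r‖ * ‖z r‖) + ε * (‖p r‖ * ‖z r‖) + ‖p r‖ * ‖g r‖)
        - h * |r * χ'| * (‖p r‖ * ‖z r‖)
        + χ r * ‖p r‖ ^ 2 + χ r * (m + r ^ 2 * (V r - E)) * ‖z r‖ ^ 2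
        - χ r * r ^ 2 * (‖g r‖ * ‖z r‖) ≤ r * D := by
  obtain ⟨D, hD, hrD⟩ := H.energy_deriv hh hr hω hχ
  refine ⟨D, hD, ?_⟩
  rw [hrD]
  simp only [normSq']
  have a1 : -(|V r| * (‖p r‖ * ‖z r‖)) ≤ V r * ((p r).re * (z r).re + (p r).im * (z r).im) := by
    refine (neg_le_neg ?_).trans (neg_abs_le _)
    rw [abs_mul]
    exact mul_le_mul_of_nonneg_left (abs_re_mul_le _ _) (abs_nonneg _)
  have a2 : -(ε * (‖p r‖ * ‖z r‖)) ≤ ε * ((p r).re * (z r).im - (p r).im * (z r).re) := by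
    rw [← mul_neg]
    exact mul_le_mul_of_nonneg_left (neg_le_of_abs_le (abs_im_mul_le _ _)) hε
  have a3 : (p r).re * (g r).re + (p r).im * (g r).im ≤ ‖p r‖ * ‖g r‖ :=
    (le_abs_self _).trans (abs_re_mul_le _ _)
  have a4 : (g r).re * (z r).re + (g r).im * (z r).im ≤ ‖g r‖ * ‖z r‖ :=
    (le_abs_self _).trans (abs_re_mul_le _ _)
  have a5 : -(h * |r * χ'| * (‖p r‖ * ‖z r‖)) ≤
      h * (r * χ') * ((p r).re * (z r).re + (p r).im * (z r).im) := by
    refine (neg_le_neg ?_).trans (neg_abs_le _)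
    rw [abs_mul, abs_mul, abs_of_pos hh]
    exact mul_le_mul_of_nonneg_left (abs_re_mul_le _ _) (by positivity)
  have c1 : 0 ≤ 2 * ω r * r ^ 2 / h := by positivity
  have c2 : 0 ≤ χ r * r ^ 2 := by positivity
  have b1 := mul_le_mul_of_nonneg_left (add_le_add (add_le_add a1 a2) (neg_le_neg a3)) c1
  have b2 := mul_le_mul_of_nonneg_left a4 c2
  linarith

end RadialODE

lemma young_ineq {k : ℝ} (hk : 0 < k) (x y : ℝ) : x * y ≤ k * x ^ 2 + y ^ 2 / (4 * k) := by
  have h : k * x ^ 2 + y ^ 2 / (4 * k) - x * y = (2 * k * x - y) ^ 2 / (4 * k) := by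
    field_simp; ring
  have : 0 ≤ (2 * k * x - y) ^ 2 / (4 * k) := by positivity
  linarith

lemma rpow_two_mul_le_weight {r s : ℝ} (hr : 0 < r) (hs : 0 < s) :
    r ^ (2 * s) ≤ (1 + r ^ 2) ^ s := by
  rw [Real.rpow_mul hr.le, Real.rpow_two]
  exact Real.rpow_le_rpow (by positivity) (by linarith) hs.le

lemma one_le_weight (r : ℝ) {s : ℝ} (hs : 0 < s) : 1 ≤ (1 + r ^ 2) ^ s :=
  Real.one_le_rpow (by nlinarith [sq_nonneg r]) hs.le

lemma sq_mul_rpow_le {r a s : ℝ} (hr : 0 < r) (hra : r ≤ a) (hs : s ≤ 1) :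
    r ^ 2 * a ^ (2 * s) ≤ a ^ 2 * r ^ (2 * s) := by
  have ha : 0 < a := hr.trans_le hra
  have e1 : r ^ 2 = r ^ (2 * s) * r ^ (2 - 2 * s) := by
    rw [← Real.rpow_add hr, ← Real.rpow_two]; congr 1; ring
  have e2 : a ^ 2 = a ^ (2 * s) * a ^ (2 - 2 * s) := by
    rw [← Real.rpow_add ha, ← Real.rpow_two]; congr 1; ring
  have := Real.rpow_le_rpow hr.le hra (by linarith : 0 ≤ 2 - 2 * s)
  rw [e1, e2]
  have h1 : 0 < r ^ (2 * s) := by positivity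
  have h2 : 0 < a ^ (2 * s) := by positivity
  have := mul_le_mul_of_nonneg_left this (mul_pos h1 h2).le
  linarith

/-- Positivity of the exterior commutator, in terms of `q = a / r` and `Q = (a / r) ^ (2 s)`. -/
lemma exterior_quadratic_ge {h m E s ε a r q Q A B G : ℝ} (hh : 0 < h) (hh1 : h ≤ 1)
    (hm : 0 ≤ m) (hE : 0 < E)
    (hs1 : 1 / 2 < s) (hs2 : s ≤ 1) (hhE : 4 * h ^ 2 ≤ (2 * s - 1) ^ 2 * E) (hε : 0 ≤ ε)
    (ha : 1 ≤ a) (har : a ≤ r) (hq : q * r = a) (hQ : 0 < Q) (hQq : Q ≤ q)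
    (haq : a * q ≤ r * Q) (hA : 0 ≤ A) (hB : 0 ≤ B) (hG : 0 ≤ G) :
    (2 * s - 1) / 4 * E * Q * (r ^ 2 * B ^ 2)
        - (16 + 4 / E) / (2 * s - 1) / h ^ 2 * r ^ 2 * (a ^ 2 / Q) * G ^ 2
        - 2 * a / h * (ε * (A ^ 2 + r ^ 2 * B ^ 2)) ≤
      (-2 * q + 2 * s * Q) * (A ^ 2 + (r ^ 2 * E - m) * B ^ 2)
        + 2 * (2 * q - Q) * r ^ 2 * E * B ^ 2
        - 2 * (2 * q - Q) * r ^ 2 / h * (ε * (A * B) + A * G)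
        - h * |-2 * q + 2 * s * Q| * (A * B)
        + (2 * q - Q) * A ^ 2 + (2 * q - Q) * (m - r ^ 2 * E) * B ^ 2
        - (2 * q - Q) * r ^ 2 * (G * B) := by
  set δ := 2 * s - 1 with hδ
  have hδ0 : 0 < δ := by linarith
  have hδ1 : δ ≤ 1 := by linarith
  have hr : 0 < r := by linarith
  have hq0 : 0 < q := hQ.trans_le hQq
  have habs : |-2 * q + 2 * s * Q| ≤ 2 * q := by
    rw [abs_le]; constructor <;> nlinarith
  have t1 : h * |-2 * q + 2 * s * Q| * (A * B) ≤
      δ / 2 * Q * A ^ 2 + δ / 2 * Q * E * (r ^ 2 * B ^ 2) := by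
    have h1 : h * |-2 * q + 2 * s * Q| * (A * B) ≤ h * (2 * q) * (A * B) := by gcongr
    have h2 := young_ineq (k := δ / 2 * Q) (by positivity) A (2 * h * q * B)
    have h3 : (2 * h * q * B) ^ 2 / (4 * (δ / 2 * Q)) ≤ δ / 2 * Q * E * (r ^ 2 * B ^ 2) := by
      rw [div_le_iff₀ (by positivity)]
      have hq2 : q ≤ r * Q := by nlinarith
      have : q ^ 2 ≤ (r * Q) ^ 2 := by gcongr
      calc (2 * h * q * B) ^ 2 = (4 * h ^ 2) * q ^ 2 * B ^ 2 := by ring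
        _ ≤ (δ ^ 2 * E) * (r * Q) ^ 2 * B ^ 2 := by gcongr
        _ = _ := by ring
    linarith
  have hω : 0 ≤ 2 * q - Q := by linarith
  have hω2 : (2 * q - Q) * r ^ 2 ≤ 2 * a * r := by
    rw [← hq]; nlinarith [sq_nonneg r, mul_pos hQ (sq_pos_of_pos hr)]
  have t2 : 2 * (2 * q - Q) * r ^ 2 / h * (A * G) ≤
      δ / 4 * Q * A ^ 2 + 16 / δ / h ^ 2 * r ^ 2 * (a ^ 2 / Q) * G ^ 2 := by
    have h1 : 2 * (2 * q - Q) * r ^ 2 / h * (A * G) ≤ 2 * (2 * a * r) / h * (A * G) := by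
      rw [mul_assoc 2]; gcongr
    have h2 := young_ineq (k := δ / 4 * Q) (by positivity) A (4 * a * r / h * G)
    have h3 : (4 * a * r / h * G) ^ 2 / (4 * (δ / 4 * Q)) =
      16 / δ / h ^ 2 * r ^ 2 * (a ^ 2 / Q) * G ^ 2 := by field_simp; ring
    have h4 : 2 * (2 * a * r) / h * (A * G) = A * (4 * a * r / h * G) := by ring
    linarith
  have t3 : (2 * q - Q) * r ^ 2 * (G * B) ≤
      δ / 4 * Q * E * (r ^ 2 * B ^ 2) + 4 / E / δ / h ^ 2 * r ^ 2 * (a ^ 2 / Q) * G ^ 2 := by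
    have h1 : (2 * q - Q) * r ^ 2 * (G * B) ≤ (2 * a * r) * (G * B) := by gcongr
    have h2 := young_ineq (k := δ / 4 * Q * E) (by positivity) (r * B) (2 * a * G)
    have h3 : (2 * a * G) ^ 2 / (4 * (δ / 4 * Q * E)) = 4 / E / δ * (a ^ 2 / Q) * G ^ 2 := by
      field_simp
      ring
    have h5 : 4 / E / δ * (a ^ 2 / Q) * G ^ 2 ≤ 4 / E / δ * (a ^ 2 / Q) * G ^ 2 * (r ^ 2 / h ^ 2) := by
      apply le_mul_of_one_le_right (by positivity)
      rw [one_le_div (by positivity)]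
      nlinarith
    have h6 : 4 / E / δ * (a ^ 2 / Q) * G ^ 2 * (r ^ 2 / h ^ 2) =
      4 / E / δ / h ^ 2 * r ^ 2 * (a ^ 2 / Q) * G ^ 2 := by ring
    have h7 : (r * B) * (2 * a * G) = (2 * a * r) * (G * B) := by ring
    have h8 : δ / 4 * Q * E * (r * B) ^ 2 = δ / 4 * Q * E * (r ^ 2 * B ^ 2) := by ring
    linarith
  have t4 : 2 * (2 * q - Q) * r ^ 2 / h * (ε * (A * B)) ≤
      2 * a / h * (ε * (A ^ 2 + r ^ 2 * B ^ 2)) := by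
    have h1 : 2 * (2 * q - Q) * r ^ 2 / h * (ε * (A * B)) ≤ 2 * (2 * a * r) / h * (ε * (A * B)) := by
      rw [mul_assoc 2]; gcongr
    have h2 : 2 * (2 * a * r) / h * (ε * (A * B)) = 2 * a / h * (ε * (2 * A * (r * B))) := by ring
    have h3 : 2 * A * (r * B) ≤ A ^ 2 + r ^ 2 * B ^ 2 := by nlinarith [sq_nonneg (A - r * B)]
    rw [h2] at h1
    exact h1.trans (by gcongr)
  have t5 : 0 ≤ m * (4 * q - (1 + 2 * s) * Q) * B ^ 2 := by
    have h1 : (1 + 2 * s) * Q ≤ 3 * Q := by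
      gcongr
      linarith
    have : 0 ≤ 4 * q - (1 + 2 * s) * Q := by linarith
    positivity
  have t6 : 0 ≤ δ / 4 * Q * A ^ 2 := by positivity
  have e1 : (16 + 4 / E) / δ / h ^ 2 * r ^ 2 * (a ^ 2 / Q) * G ^ 2 =
    16 / δ / h ^ 2 * r ^ 2 * (a ^ 2 / Q) * G ^ 2 + 4 / E / δ / h ^ 2 * r ^ 2 * (a ^ 2 / Q) * G ^ 2 := by
    ring
  have hs' : s = (δ + 1) / 2 := by rw [hδ]; ring
  rw [e1]
  have e2 : (-2 * q + 2 * s * Q) * (A ^ 2 + (r ^ 2 * E - m) * B ^ 2)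
        + 2 * (2 * q - Q) * r ^ 2 * E * B ^ 2
        + (2 * q - Q) * A ^ 2 + (2 * q - Q) * (m - r ^ 2 * E) * B ^ 2
      = δ * Q * A ^ 2 + δ * Q * E * (r ^ 2 * B ^ 2) + m * (4 * q - (1 + 2 * s) * Q) * B ^ 2 := by
    rw [hs']; ring
  linarith

/-- The balance density: weighted mass minus the source and absorption terms. -/
noncomputable def balance (s ε c cg cj : ℝ) (z p g : ℝ → ℂ) (r : ℝ) : ℝ :=
  c * (r * ‖z r‖ ^ 2 / (1 + r ^ 2) ^ s) - cg * (r * (1 + r ^ 2) ^ s * ‖g r‖ ^ 2)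
    - cj * (ε * (‖p r‖ ^ 2 / r + r * ‖z r‖ ^ 2))

lemma mul_balance {s ε c cg cj : ℝ} {z p g : ℝ → ℂ} {r : ℝ} (hr : 0 < r) :
    r * balance s ε c cg cj z p g r =
      c * (r ^ 2 * ‖z r‖ ^ 2 / (1 + r ^ 2) ^ s) - cg * (r ^ 2 * (1 + r ^ 2) ^ s * ‖g r‖ ^ 2)
      - cj * (ε * (‖p r‖ ^ 2 + r ^ 2 * ‖z r‖ ^ 2)) := by
  unfold balance
  field_simp

namespace RadialODE

variable {h m E ε Cv R T K : ℝ} {V : ℝ → ℝ} {z p g : ℝ → ℂ}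

/-- The exterior weight `(2 (a/r) - (a/r)^(2s)) / a^(2s)`. -/
noncomputable def extWeight (s a r : ℝ) : ℝ := (2 * (a / r) - (a / r) ^ (2 * s)) / a ^ (2 * s)

lemma extWeight_hasDerivAt {s a r : ℝ} (ha : 0 < a) (hr : 0 < r) :
    ∃ D, HasDerivAt (extWeight s a) D r ∧
      r * D = (-2 * (a / r) + 2 * s * (a / r) ^ (2 * s)) / a ^ (2 * s) := by
  have h1 : HasDerivAt (fun t : ℝ => a / t) (-a / r ^ 2) r := by
    have := (hasDerivAt_inv hr.ne').const_mul a
    have e : -a / r ^ 2 = a * -(r ^ 2)⁻¹ := by ring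
    rw [e]
    exact this
  have hq : 0 < a / r := by positivity
  have h2 := h1.rpow_const (p := 2 * s) (Or.inl hq.ne')
  refine ⟨_, ((h1.const_mul 2).sub h2).div_const _, ?_⟩
  rw [Real.rpow_sub_one hq.ne']
  field_simp
  ring

lemma exterior_balance_le (H : RadialODE h m E ε Cv R T K V z p g) {s a r Emin c cg cj k : ℝ}
    (hh : 0 < h) (hh1 : h ≤ 1)
    (hm : 0 ≤ m) (hEm : 0 < Emin) (hE : Emin ≤ E)
    (hs1 : 1 / 2 < s) (hs2 : s ≤ 1) (hhE : 4 * h ^ 2 ≤ (2 * s - 1) ^ 2 * Emin) (hε : 0 ≤ ε)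
    (ha : 1 ≤ a) (har : a ≤ r) (hR : R < r) (hk : 0 < k) (hc : c ≤ k * ((2 * s - 1) / 4 * Emin))
    (hcg : k * ((16 + 4 / Emin) / (2 * s - 1) / h ^ 2) ≤ cg) (hcj : k * (2 / h) ≤ cj) :
    ∃ D, HasDerivAt (energy h m E z p (fun t => k * extWeight s a t)
        (fun t => k * extWeight s a t)) D r ∧
      balance s ε c cg cj z p g r ≤ D := by
  have ha0 : 0 < a := by linarith
  have hr : 0 < r := by linarith
  have hE0 : 0 < E := by linarith
  obtain ⟨w', hw', hrw⟩ := extWeight_hasDerivAt (s := s) ha0 hr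
  have hα : 0 < a ^ (2 * s) := by positivity
  have hP : 0 < r ^ (2 * s) := by positivity
  have hQ : 0 < (a / r) ^ (2 * s) := by positivity
  have hQe : (a / r) ^ (2 * s) = a ^ (2 * s) / r ^ (2 * s) := Real.div_rpow ha0.le hr.le _
  have hq1 : a / r ≤ 1 := by rw [div_le_one hr]; exact har
  have hQq : (a / r) ^ (2 * s) ≤ a / r := by
    have := Real.rpow_le_rpow_of_exponent_ge (by positivity : 0 < a / r) hq1
      (by linarith : 1 ≤ 2 * s)
    rwa [Real.rpow_one] at this
  have haq : a * (a / r) ≤ r * (a / r) ^ (2 * s) := by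
    have := sq_mul_rpow_le ha0 har hs2
    rw [hQe, mul_div_assoc', mul_div_assoc', div_le_div_iff₀ hr hP]
    nlinarith
  have hw0 : 0 ≤ k * extWeight s a r := by
    unfold extWeight
    have : 0 ≤ 2 * (a / r) - (a / r) ^ (2 * s) := by linarith [div_pos ha0 hr]
    positivity
  obtain ⟨D, hD, hle⟩ := H.energy_deriv_ge hh hε hr (hw'.const_mul k) (hw'.const_mul k) hw0 hw0
  refine ⟨D, hD, ?_⟩
  rw [← mul_le_mul_iff_right₀ hr, mul_balance hr]
  refine le_trans ?_ hle
  have key := exterior_quadratic_ge (A := ‖p r‖) (B := ‖z r‖) (G := ‖g r‖) hh hh1 hm hE0 hs1 hs2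
    (hhE.trans (by gcongr)) hε ha har (div_mul_cancel₀ a hr.ne') hQ hQq haq (norm_nonneg _)
    (norm_nonneg _) (norm_nonneg _)
  have hrw' : r * (k * w') = k / a ^ (2 * s) * (-2 * (a / r) + 2 * s * (a / r) ^ (2 * s)) := by
    rw [mul_left_comm, hrw]; ring
  have hwe : k * extWeight s a r = k / a ^ (2 * s) * (2 * (a / r) - (a / r) ^ (2 * s)) := by
    unfold extWeight; ring
  have hkα : 0 < k / a ^ (2 * s) := by positivity
  rw [hrw', hwe, H.V_zero r hR, abs_mul, abs_of_pos hkα, abs_zero]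
  have key2 := mul_le_mul_of_nonneg_left key hkα.le
  set W := (1 + r ^ 2) ^ s with hW
  have hPW : r ^ (2 * s) ≤ W := rpow_two_mul_le_weight hr (by linarith)
  have hW1 : 1 ≤ W := one_le_weight r (by linarith)
  have hW0 : 0 < W := by linarith
  have hδ : 0 < 2 * s - 1 := by linarith
  have haα : a ≤ a ^ (2 * s) := by
    have := Real.rpow_le_rpow_of_exponent_le ha (by linarith : 1 ≤ 2 * s)
    rwa [Real.rpow_one] at this
  have u1 : c * (r ^ 2 * ‖z r‖ ^ 2 / W) ≤ k / a ^ (2 * s) *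
      ((2 * s - 1) / 4 * E * (a / r) ^ (2 * s) * (r ^ 2 * ‖z r‖ ^ 2)) := by
    calc c * (r ^ 2 * ‖z r‖ ^ 2 / W)
        ≤ (k * ((2 * s - 1) / 4 * Emin)) * (r ^ 2 * ‖z r‖ ^ 2 / W) := by gcongr
      _ ≤ (k * ((2 * s - 1) / 4 * E)) * (r ^ 2 * ‖z r‖ ^ 2 / r ^ (2 * s)) := by gcongr
      _ = _ := by rw [hQe]; field_simp
  have u2 : k / a ^ (2 * s) * ((16 + 4 / E) / (2 * s - 1) / h ^ 2 * r ^ 2 *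
      (a ^ 2 / (a / r) ^ (2 * s)) * ‖g r‖ ^ 2) ≤ cg * (r ^ 2 * W * ‖g r‖ ^ 2) := by
    calc k / a ^ (2 * s) * ((16 + 4 / E) / (2 * s - 1) / h ^ 2 * r ^ 2 *
          (a ^ 2 / (a / r) ^ (2 * s)) * ‖g r‖ ^ 2)
        = (k * ((16 + 4 / E) / (2 * s - 1) / h ^ 2)) *
          (r ^ 2 * ((a / a ^ (2 * s)) ^ 2 * r ^ (2 * s)) * ‖g r‖ ^ 2) := by
            rw [hQe]; field_simp
      _ ≤ (k * ((16 + 4 / Emin) / (2 * s - 1) / h ^ 2)) *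
          (r ^ 2 * (1 ^ 2 * W) * ‖g r‖ ^ 2) := by
            gcongr
            rw [div_le_one hα]; exact haα
      _ ≤ _ := by rw [one_pow, one_mul]; gcongr
  have u3 : k / a ^ (2 * s) * (2 * a / h * (ε * (‖p r‖ ^ 2 + r ^ 2 * ‖z r‖ ^ 2))) ≤
      cj * (ε * (‖p r‖ ^ 2 + r ^ 2 * ‖z r‖ ^ 2)) := by
    calc k / a ^ (2 * s) * (2 * a / h * (ε * (‖p r‖ ^ 2 + r ^ 2 * ‖z r‖ ^ 2)))
        = (k * (2 / h)) * ((a / a ^ (2 * s)) * (ε * (‖p r‖ ^ 2 + r ^ 2 * ‖z r‖ ^ 2))) := by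
          field_simp
      _ ≤ (k * (2 / h)) * (1 * (ε * (‖p r‖ ^ 2 + r ^ 2 * ‖z r‖ ^ 2))) := by
          gcongr
          rw [div_le_one hα]; exact haα
      _ ≤ _ := by rw [one_mul]; gcongr
  refine le_trans ?_ (key2.trans (le_of_eq ?_))
  · rw [mul_sub, mul_sub]
    linarith
  · ring

end RadialODE

lemma integral_le_sub_of_deriv {F φ : ℝ → ℝ} {a b : ℝ} (hab : a ≤ b)
    (hc : ContinuousOn F (Icc a b))
    (hd : ∀ x ∈ Ioo a b, ∃ D, HasDerivAt F D x ∧ φ x ≤ D)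
    (hφ : IntervalIntegrable φ volume a b) : ∫ x in a..b, φ x ≤ F b - F a := by
  refine intervalIntegral.integral_le_sub_of_hasDeriv_right_of_le (g' := deriv F) hab hc
    (fun x hx => ?_) ((intervalIntegrable_iff_integrableOn_Icc_of_le hab).1 hφ) (fun x hx => ?_)
  · obtain ⟨D, hD, -⟩ := hd x hx
    rw [hD.deriv]
    exact hD.hasDerivWithinAt
  · obtain ⟨D, hD, h⟩ := hd x hx
    rwa [hD.deriv]

lemma integral_le_of_deriv_of_tendsto_zero {F φ : ℝ → ℝ} {b : ℝ} (hb : 0 < b)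
    (hc : ContinuousOn F (Ioi 0)) (h0 : Filter.Tendsto F (nhdsWithin 0 (Ioi 0)) (nhds 0))
    (hd : ∀ x ∈ Ioo 0 b, ∃ D, HasDerivAt F D x ∧ φ x ≤ D)
    (hφ : IntervalIntegrable φ volume 0 b) : ∫ x in (0 : ℝ)..b, φ x ≤ F b := by
  classical
  have hcl : ContinuousOn (Function.update F 0 0) (Icc 0 b) := by
    intro x hx
    rcases eq_or_lt_of_le hx.1 with rfl | hx0
    · have : ContinuousWithinAt (Function.update F 0 0) (Ici 0) 0 := by
        rw [continuousWithinAt_update_same]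
        have e : Ici (0 : ℝ) \ {0} = Ioi 0 := by
          ext y; simp [lt_iff_le_and_ne, eq_comm]
        rw [e]; exact h0
      exact this.mono Icc_subset_Ici_self
    · refine ContinuousAt.continuousWithinAt ?_
      have h1 := hc.continuousAt (Ioi_mem_nhds hx0)
      refine h1.congr ?_
      filter_upwards [Ioi_mem_nhds hx0] with y hy
      rw [Function.update_of_ne (ne_of_gt hy)]
  have := integral_le_sub_of_deriv hb.le hcl (φ := φ) (fun x hx => ?_) hφ
  · simpa [Function.update_of_ne hb.ne'] using this
  · obtain ⟨D, hD, h⟩ := hd x hx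
    refine ⟨D, hD.congr_of_eventuallyEq ?_, h⟩
    filter_upwards [Ioi_mem_nhds hx.1] with y hy
    rw [Function.update_of_ne (ne_of_gt hy)]

lemma intervalIntegrable_of_bound {f : ℝ → ℝ} (hf : Measurable f) {T C : ℝ} (hT : 0 ≤ T)
    (hC : ∀ r, 0 < r → r ≤ T → |f r| ≤ C) : IntervalIntegrable f volume 0 T := by
  rw [intervalIntegrable_iff_integrableOn_Ioc_of_le hT]
  refine Measure.integrableOn_of_bounded (M := C) (by simp) hf.aestronglyMeasurable ?_
  rw [ae_restrict_iff' measurableSet_Ioc]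
  exact Filter.Eventually.of_forall fun r hr => hC r hr.1 hr.2

namespace RadialODE

variable {h m E ε Cv R T K : ℝ} {V : ℝ → ℝ} {z p g : ℝ → ℂ}

lemma K_nonneg (H : RadialODE h m E ε Cv R T K V z p g) : 0 ≤ K :=
  (norm_nonneg _).trans (H.norm_z 1 one_pos)

lemma norm_z_sq (H : RadialODE h m E ε Cv R T K V z p g) {r : ℝ} (hr : 0 < r) :
    ‖z r‖ ^ 2 ≤ K ^ 2 := by
  have := H.norm_z r hr
  gcongr

lemma intble_mass (H : RadialODE h m E ε Cv R T K V z p g) {S : ℝ} (hS : 0 ≤ S) :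
    IntervalIntegrable (fun r => r * ‖z r‖ ^ 2) volume 0 S := by
  refine intervalIntegrable_of_bound (C := S * K ^ 2) ?_ hS fun r hr hrT => ?_
  · exact measurable_id.mul (H.meas_z.norm.pow_const 2)
  rw [abs_of_nonneg (by positivity)]
  have := H.norm_z_sq hr
  gcongr

lemma intble_weighted_mass (H : RadialODE h m E ε Cv R T K V z p g) {S s : ℝ} (hS : 0 ≤ S)
    (hs : 0 < s) :
    IntervalIntegrable (fun r => r * ‖z r‖ ^ 2 / (1 + r ^ 2) ^ s) volume 0 S := by
  refine intervalIntegrable_of_bound (C := S * K ^ 2) ?_ hS fun r hr hrT => ?_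
  · exact (measurable_id.mul (H.meas_z.norm.pow_const 2)).div (by fun_prop)
  rw [abs_of_nonneg (by positivity)]
  have := H.norm_z_sq hr
  refine (div_le_self (by positivity) (one_le_weight r hs)).trans ?_
  gcongr

lemma intble_kinetic (H : RadialODE h m E ε Cv R T K V z p g) {S : ℝ} (hS : 0 ≤ S) :
    IntervalIntegrable (fun r => ‖p r‖ ^ 2 / r) volume 0 S := by
  refine intervalIntegrable_of_bound (C := K) ?_ hS fun r hr hrT => ?_
  · exact (H.meas_p.norm.pow_const 2).div measurable_id
  rw [abs_of_nonneg (by positivity), div_le_iff₀ hr]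
  exact H.norm_p r hr

lemma intble_source (H : RadialODE h m E ε Cv R T K V z p g) {S s : ℝ} (hS : 0 ≤ S)
    (hs : 0 < s) :
    IntervalIntegrable (fun r => r * (1 + r ^ 2) ^ s * ‖g r‖ ^ 2) volume 0 S := by
  refine intervalIntegrable_of_bound (C := S * (1 + S ^ 2) ^ s * K ^ 2) ?_ hS fun r hr hrT => ?_
  · exact (measurable_id.mul (by fun_prop)).mul (H.meas_g.norm.pow_const 2)
  rw [abs_of_nonneg (by positivity)]
  have := H.norm_g r hr
  gcongr

lemma intble_balance (H : RadialODE h m E ε Cv R T K V z p g) {S s : ℝ} (hS : 0 ≤ S)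
    (hs : 0 < s) (c cg cj : ℝ) :
    IntervalIntegrable (balance s ε c cg cj z p g) volume 0 S :=
  (((H.intble_weighted_mass hS hs).const_mul c).sub ((H.intble_source hS hs).const_mul cg)).sub
    ((((H.intble_kinetic hS).add (H.intble_mass hS)).const_mul ε).const_mul cj)

lemma _root_.IntervalIntegrable.sub_interval {f : ℝ → ℝ} {S a b : ℝ}
    (hf : IntervalIntegrable f volume 0 S) (ha : 0 ≤ a) (hab : a ≤ b) (hb : b ≤ S) :
    IntervalIntegrable f volume a b := by
  refine hf.mono_set ?_
  rw [uIcc_of_le hab, uIcc_of_le (ha.trans (hab.trans hb))]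
  exact Icc_subset_Icc ha hb

lemma continuousOn_z (H : RadialODE h m E ε Cv R T K V z p g) : ContinuousOn z (Ioi 0) :=
  fun r hr => (H.deriv_z r hr).continuousAt.continuousWithinAt

lemma continuousOn_p (H : RadialODE h m E ε Cv R T K V z p g) : ContinuousOn p (Ioi 0) :=
  fun r hr => (H.deriv_p r hr).continuousAt.continuousWithinAt

lemma continuousOn_energy (H : RadialODE h m E ε Cv R T K V z p g) {ω χ : ℝ → ℝ}
    (hω : ContinuousOn ω (Ioi 0)) (hχ : ContinuousOn χ (Ioi 0)) :
    ContinuousOn (energy h m E z p ω χ) (Ioi 0) := by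
  have hz := H.continuousOn_z
  have hp := H.continuousOn_p
  have h1 := Complex.continuous_re.comp_continuousOn hz
  have h2 := Complex.continuous_im.comp_continuousOn hz
  have h3 := Complex.continuous_re.comp_continuousOn hp
  have h4 := Complex.continuous_im.comp_continuousOn hp
  simp only [Function.comp_def] at h1 h2 h3 h4
  unfold energy
  fun_prop

lemma energy_le {h m E : ℝ} {z p : ℝ → ℂ} (hh : 0 ≤ h)
    {ω χ : ℝ → ℝ} (r : ℝ) (hχ : 0 ≤ χ r) :
    |energy h m E z p ω χ r - ω r * (‖p r‖ ^ 2 + (r ^ 2 * E - m) * ‖z r‖ ^ 2)|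
      ≤ h * χ r * (‖p r‖ * ‖z r‖) := by
  unfold energy
  rw [normSq', normSq', add_sub_cancel_left, abs_mul, abs_of_nonneg (mul_nonneg hh hχ)]
  exact mul_le_mul_of_nonneg_left (abs_re_mul_le _ _) (mul_nonneg hh hχ)

lemma energy_tendsto_zero (H : RadialODE h m E ε Cv R T K V z p g) (hm : 0 ≤ m) (ω χ : ℝ) :
    Filter.Tendsto (energy h m E z p (fun _ => ω) (fun _ => χ))
      (nhdsWithin 0 (Ioi 0)) (nhds 0) := by
  have hKr : Filter.Tendsto (fun r : ℝ => K * r) (nhdsWithin 0 (Ioi 0)) (nhds 0) := by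
    have : Filter.Tendsto (fun r : ℝ => K * r) (nhds 0) (nhds (K * 0)) :=
      (continuous_const.mul continuous_id).tendsto 0
    rw [mul_zero] at this
    exact this.mono_left nhdsWithin_le_nhds
  have hr2 : Filter.Tendsto (fun r : ℝ => r ^ 2 * K ^ 2) (nhdsWithin 0 (Ioi 0)) (nhds 0) := by
    have : Filter.Tendsto (fun r : ℝ => r ^ 2 * K ^ 2) (nhds 0) (nhds (0 ^ 2 * K ^ 2)) :=
      ((continuous_pow 2).mul continuous_const).tendsto 0
    simp only [ne_eq, OfNat.ofNat_ne_zero, not_false_eq_true, zero_pow, zero_mul] at this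
    exact this.mono_left nhdsWithin_le_nhds
  have hmem : ∀ᶠ r : ℝ in nhdsWithin 0 (Ioi 0), 0 < r := self_mem_nhdsWithin
  have hp2 : Filter.Tendsto (fun r => ‖p r‖ ^ 2) (nhdsWithin 0 (Ioi 0)) (nhds 0) :=
    tendsto_of_tendsto_of_tendsto_of_le_of_le' tendsto_const_nhds hKr
      (Filter.Eventually.of_forall fun r => by positivity)
      (hmem.mono fun r hr => H.norm_p r hr)
  have hmz : Filter.Tendsto (fun r => m * ‖z r‖ ^ 2) (nhdsWithin 0 (Ioi 0)) (nhds 0) :=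
    tendsto_of_tendsto_of_tendsto_of_le_of_le' tendsto_const_nhds hKr
      (Filter.Eventually.of_forall fun r => by positivity)
      (hmem.mono fun r hr => H.norm_mz r hr)
  have hrz : Filter.Tendsto (fun r => r ^ 2 * ‖z r‖ ^ 2) (nhdsWithin 0 (Ioi 0)) (nhds 0) :=
    tendsto_of_tendsto_of_tendsto_of_le_of_le' tendsto_const_nhds hr2
      (Filter.Eventually.of_forall fun r => by positivity)
      (hmem.mono fun r hr => mul_le_mul_of_nonneg_left (H.norm_z_sq hr) (sq_nonneg r))
  have hp1 : Filter.Tendsto (fun r => ‖p r‖ * K) (nhdsWithin 0 (Ioi 0)) (nhds 0) := by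
    have := (Real.continuous_sqrt.tendsto 0).comp hp2
    rw [Real.sqrt_zero] at this
    have h2 := this.mul_const K
    simp only [Function.comp_def, zero_mul] at h2
    refine h2.congr fun r => ?_
    rw [Real.sqrt_sq (norm_nonneg _)]
  have hX : Filter.Tendsto (fun r => (p r).re * (z r).re + (p r).im * (z r).im)
      (nhdsWithin 0 (Ioi 0)) (nhds 0) := by
    refine squeeze_zero_norm' (hmem.mono fun r hr => ?_) hp1
    exact (abs_re_mul_le _ _).trans
      (mul_le_mul_of_nonneg_left (H.norm_z r hr) (norm_nonneg _))
  have hall := ((hp2.add ((hrz.const_mul E).sub hmz)).const_mul ω).add (hX.const_mul (h * χ))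
  simp only [mul_zero, sub_zero, add_zero] at hall
  refine hall.congr fun r => ?_
  unfold energy
  rw [normSq', normSq']
  ring

lemma mul_balance_le {s ε c cg cj r : ℝ} {z p g : ℝ → ℂ} (hr : 0 < r) (hs : 0 < s) (hc : 0 ≤ c)
    (hcg : 0 ≤ cg) :
    r * balance s ε c cg cj z p g r ≤ c * (r ^ 2 / r ^ (2 * s)) * ‖z r‖ ^ 2
      - cg * (r ^ 2 * max 1 (r ^ (2 * s))) * ‖g r‖ ^ 2
      - cj * (ε * (‖p r‖ ^ 2 + r ^ 2 * ‖z r‖ ^ 2)) := by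
  rw [mul_balance hr]
  have h1 := rpow_two_mul_le_weight hr hs
  have h2 := one_le_weight r hs
  have hP : 0 < r ^ (2 * s) := by positivity
  have hW : max 1 (r ^ (2 * s)) ≤ (1 + r ^ 2) ^ s := max_le h2 h1
  have a1 : c * (r ^ 2 * ‖z r‖ ^ 2 / (1 + r ^ 2) ^ s)
      ≤ c * (r ^ 2 / r ^ (2 * s)) * ‖z r‖ ^ 2 := by
    rw [mul_assoc, div_mul_eq_mul_div]
    gcongr
  have a2 : cg * (r ^ 2 * max 1 (r ^ (2 * s))) * ‖g r‖ ^ 2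
      ≤ cg * (r ^ 2 * (1 + r ^ 2) ^ s * ‖g r‖ ^ 2) := by
    rw [mul_assoc]
    gcongr
  linarith

lemma core_balance_le (H : RadialODE h m E ε Cv R T K V z p g) {s a r Emin Emax c cg cj : ℝ}
    (hh : 0 < h) (hs1 : 1 / 2 < s) (hs2 : s ≤ 1) (hEm : 0 < Emin) (hE : Emin ≤ E)
    (hE' : E ≤ Emax) (hε : 0 ≤ ε)
    (hm1 : 4 * R ^ 2 * Cv ≤ m) (hr : 0 < r) (ha : 1 ≤ a) (hra : r ≤ a)
    (hrm : 4 * (r ^ 2 * Emax) ≤ m) (ham : a ^ 2 * Emax ≤ 8 * m)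
    (hc0 : 0 ≤ c) (hc : c ≤ Emin / 32) (hcg : 1 / Emin ≤ cg) (hcj : 0 ≤ cj) :
    ∃ D, HasDerivAt (energy h m E z p (fun _ => 0) (fun _ => 2 / a ^ (2 * s))) D r ∧
      balance s ε c cg cj z p g r ≤ D := by
  have ha0 : 0 < a := by linarith
  have hα : 0 < a ^ (2 * s) := by positivity
  have hα1 : 1 ≤ a ^ (2 * s) := Real.one_le_rpow ha (by linarith)
  obtain ⟨D, hD, hle⟩ := H.energy_deriv_ge hh hε hr (hasDerivAt_const r (0 : ℝ))
    (hasDerivAt_const r (2 / a ^ (2 * s))) le_rfl (by positivity)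
  refine ⟨D, hD, ?_⟩
  rw [← mul_le_mul_iff_right₀ hr]
  have hcg0 : 0 ≤ cg := le_trans (by positivity) hcg
  refine (mul_balance_le hr (by linarith) hc0 hcg0).trans (le_trans ?_ hle)
  have hP : 0 < r ^ (2 * s) := by positivity
  have hEM : 0 < Emax := by linarith
  have hm0 : 0 < m := lt_of_lt_of_le (by positivity) hrm
  have hx := sq_mul_rpow_le hr hra hs2
  have hV : r ^ 2 * |V r| ≤ m / 4 := by
    by_cases hrR : r ≤ R
    · have : r ^ 2 * |V r| ≤ R ^ 2 * Cv := by
        gcongr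
        exact H.norm_V r hr
      linarith
    · rw [H.V_zero r (not_le.1 hrR)]; simp; positivity
  have hV' : -(m / 4) ≤ r ^ 2 * V r := by
    have := mul_le_mul_of_nonneg_left (neg_abs_le (V r)) (sq_nonneg r)
    linarith
  have hrE : r ^ 2 * E ≤ m / 4 := by
    have : r ^ 2 * E ≤ r ^ 2 * Emax := by gcongr
    linarith
  have hJ : 0 ≤ cj * (ε * (‖p r‖ ^ 2 + r ^ 2 * ‖z r‖ ^ 2)) := by positivity
  -- comparison of the weights
  have hcmp : c * (r ^ 2 / r ^ (2 * s)) ≤ m / (4 * a ^ (2 * s)) := by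
    calc c * (r ^ 2 / r ^ (2 * s)) ≤ (Emax / 32) * (a ^ 2 / a ^ (2 * s)) := by
          have : r ^ 2 / r ^ (2 * s) ≤ a ^ 2 / a ^ (2 * s) := by
            rwa [div_le_div_iff₀ hP hα]
          have h3 : c ≤ Emax / 32 := by linarith
          gcongr
      _ = (a ^ 2 * Emax) / (32 * a ^ (2 * s)) := by field_simp
      _ ≤ (8 * m) / (32 * a ^ (2 * s)) := by gcongr
      _ = m / (4 * a ^ (2 * s)) := by field_simp; norm_num
  have hg1 : r ^ 2 / m ≤ 1 / Emin / 4 := by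
    rw [div_div, div_le_div_iff₀ hm0 (by positivity)]
    have : r ^ 2 * Emin ≤ r ^ 2 * Emax := by gcongr; linarith
    linarith
  set P := r ^ (2 * s) with hPd
  set α := a ^ (2 * s) with hαd
  set A := ‖p r‖
  set B := ‖z r‖ with hB
  set G := ‖g r‖ with hG
  have hA0 : 0 ≤ A := norm_nonneg _
  have hyoung : r ^ 2 * (G * B) ≤ m / 4 * B ^ 2 + r ^ 4 / m * G ^ 2 := by
    have := young_ineq (k := m / 4) (by positivity) B (r ^ 2 * G)
    have e : (r ^ 2 * G) ^ 2 / (4 * (m / 4)) = r ^ 4 / m * G ^ 2 := by field_simp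
    rw [e] at this; linarith
  have hg2 : 2 / α * (r ^ 4 / m * G ^ 2) ≤ cg * (r ^ 2 * max 1 P) * G ^ 2 := by
    have h1 : 2 / α ≤ 2 := by rw [div_le_iff₀ hα]; linarith
    calc 2 / α * (r ^ 4 / m * G ^ 2) = 2 / α * ((r ^ 2 / m) * (r ^ 2 * G ^ 2)) := by ring
      _ ≤ 2 * ((1 / Emin / 4) * (r ^ 2 * G ^ 2)) := by gcongr
      _ ≤ 1 / Emin * (r ^ 2 * 1 * G ^ 2) := by
        have : 0 ≤ 1 / Emin * (r ^ 2 * G ^ 2) := by positivity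
        linarith
      _ ≤ cg * (r ^ 2 * max 1 P) * G ^ 2 := by
        rw [mul_assoc cg]
        gcongr
        exact le_max_left _ _
  have hz1 : c * (r ^ 2 / P) * B ^ 2 ≤ 2 / α * (m / 4 * B ^ 2) := by
    calc _ ≤ m / (4 * α) * B ^ 2 := by gcongr
      _ ≤ 2 / α * (m / 4 * B ^ 2) := by
        have : 2 / α * (m / 4 * B ^ 2) = 2 * (m / (4 * α) * B ^ 2) := by field_simp
        rw [this]
        have : 0 ≤ m / (4 * α) * B ^ 2 := by positivity
        linarith
  have hq : 0 < 2 / α := by positivity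
  have h5 : m / 4 * B ^ 2 - r ^ 4 / m * G ^ 2 ≤
      A ^ 2 + (m + r ^ 2 * (V r - E)) * B ^ 2 - r ^ 2 * (G * B) := by
    have h6 : m / 2 ≤ m + r ^ 2 * (V r - E) := by rw [mul_sub]; linarith
    have := mul_le_mul_of_nonneg_right h6 (sq_nonneg B)
    have := sq_nonneg A
    linarith
  have h7 := mul_le_mul_of_nonneg_left h5 hq.le
  simp only [mul_zero, abs_zero, zero_mul, zero_add, zero_div, sub_zero, add_zero]
  rw [mul_sub] at h7
  linarith

set_option maxHeartbeats 800000 in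
lemma barrier_balance_le (H : RadialODE h m E ε Cv R T K V z p g)
    {s a b r Emin Emax c cg cj : ℝ}
    (hh : 0 < h) (hs1 : 1 / 2 < s) (hs2 : s ≤ 1) (hEm : 0 < Emin) (hE : Emin ≤ E)
    (hE' : E ≤ Emax) (hε : 0 ≤ ε) (hb : 0 < b) (hbr : b < r) (hR : R < r)
    (ha : 1 ≤ a) (hr1 : 1 ≤ r) (hra : r ≤ a) (hab : a = b * Real.exp 2)
    (hrm : 4 * (b ^ 2 * Emax) ≤ m) (ham : a ^ 2 * Emax ≤ 8 * m)
    (hc0 : 0 ≤ c) (hc : c ≤ Emin / 32) (hcg : 4 / h ^ 2 + 32 / Emin ≤ cg) (hcj : 2 / h ≤ cj) :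
    ∃ D, HasDerivAt (energy h m E z p (fun t => Real.log (t / b) / a ^ (2 * s))
      (fun _ => 2 / a ^ (2 * s))) D r ∧
      balance s ε c cg cj z p g r ≤ D := by
  have ha0 : 0 < a := by linarith
  have hr : 0 < r := by linarith
  have hα : 0 < a ^ (2 * s) := by positivity
  have hL0 : 0 ≤ Real.log (r / b) := Real.log_nonneg (by rw [le_div_iff₀ hb]; linarith)
  have hL2 : Real.log (r / b) ≤ 2 := by
    rw [Real.log_le_iff_le_exp (by positivity), div_le_iff₀ hb]; linarith
  have hrL : r = b * Real.exp (Real.log (r / b)) := by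
    rw [Real.exp_log (by positivity)]; field_simp
  have hdlog : HasDerivAt (fun t => Real.log (t / b) / a ^ (2 * s))
      (1 / r / a ^ (2 * s)) r := by
    have h1 : HasDerivAt (fun t : ℝ => t / b) (1 / b) r := (hasDerivAt_id r).div_const b
    have h2 := (h1.log (by positivity)).div_const (a ^ (2 * s))
    have e : 1 / b / (r / b) = 1 / r := by field_simp
    rwa [e] at h2
  obtain ⟨D, hD, hle⟩ := H.energy_deriv_ge hh hε hr hdlog
    (hasDerivAt_const r (2 / a ^ (2 * s))) (by positivity) (by positivity)
  refine ⟨D, hD, ?_⟩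
  rw [← mul_le_mul_iff_right₀ hr]
  have hcg0 : 0 ≤ cg := le_trans (by positivity) hcg
  refine (mul_balance_le hr (by linarith) hc0 hcg0).trans (le_trans ?_ hle)
  have hP : 0 < r ^ (2 * s) := by positivity
  have hEM : 0 < Emax := by linarith
  have hm0 : 0 < m := lt_of_lt_of_le (by positivity) hrm
  have hx := sq_mul_rpow_le hr hra hs2
  have hrP : r ≤ r ^ (2 * s) := by
    have := Real.rpow_le_rpow_of_exponent_le hr1 (by linarith : 1 ≤ 2 * s)
    rwa [Real.rpow_one] at this
  have hPα : r ^ (2 * s) ≤ a ^ (2 * s) := Real.rpow_le_rpow hr.le hra (by linarith)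
  have hcmp : c * (r ^ 2 / r ^ (2 * s)) ≤ m / (4 * a ^ (2 * s)) := by
    calc c * (r ^ 2 / r ^ (2 * s)) ≤ (Emax / 32) * (a ^ 2 / a ^ (2 * s)) := by
          have : r ^ 2 / r ^ (2 * s) ≤ a ^ 2 / a ^ (2 * s) := by
            rwa [div_le_div_iff₀ hP hα]
          have h3 : c ≤ Emax / 32 := by linarith
          gcongr
      _ = (a ^ 2 * Emax) / (32 * a ^ (2 * s)) := by field_simp
      _ ≤ (8 * m) / (32 * a ^ (2 * s)) := by gcongr
      _ = m / (4 * a ^ (2 * s)) := by field_simp; norm_num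
  have hg1 : r ^ 2 / m ≤ 8 / Emin := by
    rw [div_le_div_iff₀ hm0 (by positivity)]
    have : r ^ 2 * Emin ≤ a ^ 2 * Emax := by gcongr; linarith
    linarith
  have hpot : m / 2 ≤ m + (2 * Real.log (r / b) - 1) * (r ^ 2 * E) := by
    set L := Real.log (r / b)
    have h1 : (1 - 2 * L) * Real.exp (2 * L) ≤ 1 := by
      have := Real.add_one_le_exp (-(2 * L))
      calc (1 - 2 * L) * Real.exp (2 * L) ≤ Real.exp (-(2 * L)) * Real.exp (2 * L) := by
            gcongr; linarith
        _ = 1 := by rw [← Real.exp_add]; simp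
    have e : r ^ 2 = b ^ 2 * Real.exp (2 * L) := by
      conv_lhs => rw [hrL]
      rw [mul_pow, ← Real.exp_nat_mul]; norm_num
    have h2 : b ^ 2 * E ≤ b ^ 2 * Emax := by gcongr
    have hE0 : 0 < E := by linarith
    have h3 := mul_le_mul_of_nonneg_left h1 (by positivity : 0 ≤ b ^ 2 * E)
    rw [e]
    have : (2 * L - 1) * (b ^ 2 * Real.exp (2 * L) * E)
        = -(b ^ 2 * E * ((1 - 2 * L) * Real.exp (2 * L))) := by ring
    rw [this]
    linarith
  rw [H.V_zero r hR]
  generalize Real.log (r / b) = L at *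
  set P := r ^ (2 * s) with hPd
  set α := a ^ (2 * s) with hαd
  set A := ‖p r‖
  set B := ‖z r‖ with hB
  set G := ‖g r‖ with hG
  have hA0 : 0 ≤ A := norm_nonneg _
  have hB0 : 0 ≤ B := norm_nonneg _
  have hG0 : 0 ≤ G := norm_nonneg _
  have hαr : r ≤ α := hrP.trans hPα
  have hα1 : 1 ≤ α := hr1.trans hαr
  have y1 : 2 * r ^ 2 * (G * B) ≤ m / 4 * B ^ 2 + 32 / Emin * r ^ 2 * G ^ 2 := by
    have := young_ineq (k := m / 4) (by positivity) B (2 * r ^ 2 * G)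
    have e : (2 * r ^ 2 * G) ^ 2 / (4 * (m / 4)) = 4 * (r ^ 2 / m) * (r ^ 2 * G ^ 2) := by
      field_simp
      ring
    rw [e] at this
    have h2 : 4 * (r ^ 2 / m) * (r ^ 2 * G ^ 2) ≤ 4 * (8 / Emin) * (r ^ 2 * G ^ 2) := by gcongr
    have e2 : 4 * (8 / Emin) * (r ^ 2 * G ^ 2) = 32 / Emin * r ^ 2 * G ^ 2 := by ring
    linarith
  have y2 : 2 * L * r ^ 2 / h * (A * G) ≤ A ^ 2 + 4 / h ^ 2 * r ^ 4 * G ^ 2 := by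
    have := young_ineq (k := 1) one_pos A (4 * r ^ 2 / h * G)
    have e : (4 * r ^ 2 / h * G) ^ 2 / (4 * 1) = 4 / h ^ 2 * r ^ 4 * G ^ 2 := by
      field_simp
    rw [e] at this
    have h3 : 2 * L * r ^ 2 / h * (A * G) ≤ 2 * 2 * r ^ 2 / h * (A * G) := by gcongr
    have e3 : A * (4 * r ^ 2 / h * G) = 2 * 2 * r ^ 2 / h * (A * G) := by ring
    linarith
  have y3 : 1 / α * (2 * L * r ^ 2 / h * (ε * (A * B)))
      ≤ cj * (ε * (A ^ 2 + r ^ 2 * B ^ 2)) := by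
    have h1 : 2 * (r * (A * B)) ≤ A ^ 2 + r ^ 2 * B ^ 2 := by
      have := sq_nonneg (A - r * B)
      have e : (A - r * B) ^ 2 = A ^ 2 - 2 * (r * (A * B)) + r ^ 2 * B ^ 2 := by ring
      linarith
    have h2 : r / α ≤ 1 := by rw [div_le_one hα]; exact hαr
    calc 1 / α * (2 * L * r ^ 2 / h * (ε * (A * B)))
        = (r / α) * (L / h) * (ε * (2 * (r * (A * B)))) := by ring
      _ ≤ 1 * (2 / h) * (ε * (A ^ 2 + r ^ 2 * B ^ 2)) := by gcongr
      _ ≤ cj * (ε * (A ^ 2 + r ^ 2 * B ^ 2)) := by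
        rw [one_mul]; gcongr
  have hz1 : c * (r ^ 2 / P) * B ^ 2 ≤ 1 / α * (m / 4 * B ^ 2) := by
    calc _ ≤ m / (4 * α) * B ^ 2 := by gcongr
      _ = 1 / α * (m / 4 * B ^ 2) := by field_simp
  have hg2 : 1 / α * (4 / h ^ 2 * r ^ 4 * G ^ 2 + 32 / Emin * r ^ 2 * G ^ 2)
      ≤ cg * (r ^ 2 * max 1 P) * G ^ 2 := by
    have h1 : r ^ 2 / α ≤ max 1 P := by
      rw [div_le_iff₀ hα]
      calc r ^ 2 = r * r := by ring
        _ ≤ P * α := by gcongr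
        _ ≤ max 1 P * α := by gcongr; exact le_max_right _ _
    have h2 : 1 / α ≤ max 1 P := by
      refine le_trans ?_ (le_max_left _ _)
      rw [div_le_one hα]; exact hα1
    calc _ = 4 / h ^ 2 * (r ^ 2 * (r ^ 2 / α) * G ^ 2) + 32 / Emin * (r ^ 2 * (1 / α) * G ^ 2) := by
          ring
      _ ≤ 4 / h ^ 2 * (r ^ 2 * max 1 P * G ^ 2) + 32 / Emin * (r ^ 2 * max 1 P * G ^ 2) := by
          gcongr
      _ = (4 / h ^ 2 + 32 / Emin) * (r ^ 2 * max 1 P * G ^ 2) := by ring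
      _ ≤ cg * (r ^ 2 * max 1 P * G ^ 2) := by gcongr
      _ = _ := by ring
  have hq : 0 < 1 / α := by positivity
  have h5 : m / 4 * B ^ 2 - (4 / h ^ 2 * r ^ 4 * G ^ 2 + 32 / Emin * r ^ 2 * G ^ 2) ≤
      A ^ 2 + (r ^ 2 * E - m) * B ^ 2 + 2 * L * r ^ 2 * E * B ^ 2
      - 2 * L * r ^ 2 / h * (A * G) + 2 * A ^ 2 + 2 * (m - r ^ 2 * E) * B ^ 2
      - 2 * r ^ 2 * (G * B) := by
    have := mul_le_mul_of_nonneg_right hpot (sq_nonneg B)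
    have := sq_nonneg A
    linarith
  have h7 := mul_le_mul_of_nonneg_left h5 hq.le
  simp only [mul_zero, abs_zero, zero_mul, zero_add, sub_zero, zero_sub]
  have e1 : r * (1 / r / α) = 1 / α := by field_simp
  rw [e1]
  have e2 : 1 / α * (A ^ 2 + (r ^ 2 * E - m) * B ^ 2) + 2 * (L / α) * r ^ 2 * E * B ^ 2 -
        2 * (L / α) * r ^ 2 / h * (ε * (A * B) + A * G) + 2 / α * A ^ 2 +
        2 / α * (m + r ^ 2 * -E) * B ^ 2 - 2 / α * r ^ 2 * (G * B)
      = 1 / α * (A ^ 2 + (r ^ 2 * E - m) * B ^ 2 + 2 * L * r ^ 2 * E * B ^ 2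
      - 2 * L * r ^ 2 / h * (A * G) + 2 * A ^ 2 + 2 * (m - r ^ 2 * E) * B ^ 2
      - 2 * r ^ 2 * (G * B)) - 1 / α * (2 * L * r ^ 2 / h * (ε * (A * B))) := by ring
  rw [e2]
  rw [mul_sub (1 / α) (m / 4 * B ^ 2)] at h7
  linarith

lemma integral_balance_eq (H : RadialODE h m E ε Cv R T K V z p g) {s S c cg cj : ℝ}
    (hT : 0 ≤ T) (hs : 0 < s) (hS : T ≤ S) :
    ∫ r in (0 : ℝ)..S, balance s ε c cg cj z p g r
      = ∫ r in (0 : ℝ)..T, balance s ε c cg cj z p g r := by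
  have hi := H.intble_balance (hT.trans hS) hs c cg cj
  rw [← intervalIntegral.integral_add_adjacent_intervals (hi.sub_interval le_rfl hT hS)
    (hi.sub_interval hT hS le_rfl)]
  have : ∫ r in T..S, balance s ε c cg cj z p g r = ∫ r in T..S, (0 : ℝ) := by
    refine intervalIntegral.integral_congr fun r hr => ?_
    rw [uIcc_of_le hS] at hr
    simp [balance, H.z_zero r hr.1, H.p_zero r hr.1, H.g_zero r hr.1]
  rw [this]; simp

lemma continuousOn_extWeight {s a : ℝ} (ha : 0 < a) : ContinuousOn (extWeight s a) (Ioi 0) :=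
  fun r hr => by
    obtain ⟨D, hD, -⟩ := extWeight_hasDerivAt (s := s) ha hr
    exact hD.continuousAt.continuousWithinAt

lemma integral_exterior_balance_le (H : RadialODE h m E ε Cv R T K V z p g)
    {s a S Emin c cg cj k : ℝ}
    (hh : 0 < h) (hh1 : h ≤ 1)
    (hm : 0 ≤ m) (hEm : 0 < Emin) (hE : Emin ≤ E)
    (hs1 : 1 / 2 < s) (hs2 : s ≤ 1) (hhE : 4 * h ^ 2 ≤ (2 * s - 1) ^ 2 * Emin) (hε : 0 ≤ ε)
    (ha : 1 ≤ a) (haS : a ≤ S) (hTS : T ≤ S) (hR : R ≤ a) (hk : 0 < k)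
    (hc : c ≤ k * ((2 * s - 1) / 4 * Emin))
    (hcg : k * ((16 + 4 / Emin) / (2 * s - 1) / h ^ 2) ≤ cg) (hcj : k * (2 / h) ≤ cj) :
    ∫ r in a..S, balance s ε c cg cj z p g r
      ≤ -energy h m E z p (fun t => k * extWeight s a t) (fun t => k * extWeight s a t) a := by
  have ha0 : 0 < a := by linarith
  have hi := H.intble_balance (ha0.le.trans haS) (by linarith : 0 < s) c cg cj
  have hcw : ContinuousOn (fun t => k * extWeight s a t) (Ioi 0) :=
    continuousOn_const.mul (continuousOn_extWeight ha0)
  have := integral_le_sub_of_deriv haS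
    ((H.continuousOn_energy hcw hcw).mono fun x hx => lt_of_lt_of_le ha0 hx.1)
    (fun r hr => H.exterior_balance_le hh hh1 hm hEm hE hs1 hs2 hhE hε ha hr.1.le
      (lt_of_le_of_lt hR hr.1) hk hc hcg hcj) (hi.sub_interval ha0.le haS le_rfl)
  refine this.trans ?_
  have e : energy h m E z p (fun t => k * extWeight s a t) (fun t => k * extWeight s a t) S = 0 := by
    simp [energy, H.z_zero S hTS, H.p_zero S hTS]
  rw [e]; simp

/-- Large angular momentum: the weighted mass is controlled without exponential loss. -/
lemma integral_balance_nonpos (H : RadialODE h m E ε Cv R T K V z p g)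
    {s Emin Emax : ℝ}
    (hh : 0 < h) (hh1 : h ≤ 1) (hT : 0 ≤ T) (hR : 1 ≤ R)
    (hEm : 0 < Emin) (hE : Emin ≤ E) (hE' : E ≤ Emax)
    (hs1 : 1 / 2 < s) (hs2 : s ≤ 1) (hhE : 4 * h ^ 2 ≤ (2 * s - 1) ^ 2 * Emin) (hε : 0 ≤ ε)
    (hm1 : 4 * R ^ 2 * Cv ≤ m) (hm2 : R ^ 2 * (Real.exp 2 * Emax) ≤ m) :
    ∫ r in (0 : ℝ)..T, balance s ε ((2 * s - 1) / 32 * Emin)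
      ((32 + 40 / Emin) / (2 * s - 1) / h ^ 2) (4 / h) z p g r ≤ 0 := by
  have hEM : 0 < Emax := by linarith
  have he2 : (4 : ℝ) ≤ Real.exp 2 := by
    have h1 := Real.add_one_le_exp (1 : ℝ)
    have : Real.exp 2 = Real.exp 1 * Real.exp 1 := by rw [← Real.exp_add]; norm_num
    rw [this]; nlinarith
  have he8 : Real.exp 2 ≤ 8 := by
    have h1 := Real.exp_one_lt_d9
    have : Real.exp 2 = Real.exp 1 * Real.exp 1 := by rw [← Real.exp_add]; norm_num
    rw [this]; nlinarith [Real.exp_pos 1]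
  have hs0 : 0 < 2 * s - 1 := by linarith
  have hm0 : 0 < m := lt_of_lt_of_le (by positivity) hm2
  obtain ⟨b, hb0, hb2⟩ : ∃ b : ℝ, 0 < b ∧ b ^ 2 * (Real.exp 2 * Emax) = m := by
    refine ⟨Real.sqrt (m / (Real.exp 2 * Emax)), by positivity, ?_⟩
    rw [Real.sq_sqrt (by positivity)]; field_simp
  have hbR : R ≤ b := by
    rw [← hb2] at hm2
    have := le_of_mul_le_mul_right hm2 (by positivity)
    exact le_of_sq_le_sq this hb0.le
  have hb1 : 1 ≤ b := hR.trans hbR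
  obtain ⟨a, hab⟩ : ∃ a : ℝ, a = b * Real.exp 2 := ⟨_, rfl⟩
  have hba : b ≤ a := by rw [hab]; nlinarith
  have ha1 : 1 ≤ a := hb1.trans hba
  have hbm : 4 * (b ^ 2 * Emax) ≤ m := by
    rw [← hb2]
    have : 0 ≤ b ^ 2 * Emax := by positivity
    nlinarith
  have ham : a ^ 2 * Emax ≤ 8 * m := by
    have : a ^ 2 * Emax = Real.exp 2 * m := by rw [← hb2, hab]; ring
    rw [this]; gcongr
  have ha0 : 0 < a := by linarith
  have hα : 0 < a ^ (2 * s) := by positivity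
  set c := (2 * s - 1) / 32 * Emin with hc
  set cg := (32 + 40 / Emin) / (2 * s - 1) / h ^ 2 with hcg
  set cj := 4 / h with hcj
  have hc0 : 0 ≤ c := by positivity
  have hc1 : c ≤ Emin / 32 := by
    rw [hc]
    have : (2 * s - 1) / 32 * Emin ≤ 1 / 32 * Emin := by gcongr; linarith
    linarith
  have hh2 : h ^ 2 ≤ 1 := pow_le_one₀ hh.le hh1
  have hcgl : 4 / h ^ 2 + 32 / Emin ≤ cg := by
    have h1 : 32 + 40 / Emin ≤ (32 + 40 / Emin) / (2 * s - 1) := by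
      rw [le_div_iff₀ hs0]
      have : 0 ≤ 32 + 40 / Emin := by positivity
      nlinarith
    have h2 : (32 + 40 / Emin) / h ^ 2 ≤ cg := by rw [hcg]; gcongr
    have h3 : 32 / Emin ≤ 40 / Emin / h ^ 2 := by
      rw [le_div_iff₀ (by positivity)]
      have : 32 / Emin * h ^ 2 ≤ 32 / Emin * 1 := by gcongr
      have h4 : 32 / Emin ≤ 40 / Emin := by gcongr; norm_num
      linarith
    have h5 : 4 / h ^ 2 ≤ 32 / h ^ 2 := by gcongr; norm_num
    rw [add_div] at h2
    linarith
  have hcg1 : 1 / Emin ≤ cg := by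
    have h1 : 1 / Emin ≤ 32 / Emin := by gcongr; norm_num
    have h2 : 0 ≤ 4 / h ^ 2 := by positivity
    linarith
  have hcj2 : 2 / h ≤ cj := by rw [hcj]; gcongr; norm_num
  have haS : a ≤ max T a := le_max_right _ _
  have hi := H.intble_balance (ha0.le.trans haS) (by linarith : 0 < s) c cg cj
  rw [← H.integral_balance_eq hT (by linarith) (le_max_left T a),
    ← intervalIntegral.integral_add_adjacent_intervals (hi.sub_interval le_rfl ha0.le haS)
    (hi.sub_interval ha0.le haS le_rfl),
    ← intervalIntegral.integral_add_adjacent_intervals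
    (hi.sub_interval le_rfl hb0.le (hba.trans haS)) (hi.sub_interval hb0.le hba haS)]
  have i1 := integral_le_of_deriv_of_tendsto_zero hb0
    (H.continuousOn_energy (continuousOn_const (c := 0)) (continuousOn_const (c := 2 / a ^ (2 * s))))
    (H.energy_tendsto_zero hm0.le _ _)
    (fun r hr => H.core_balance_le (Emax := Emax) hh hs1 hs2 hEm hE hE' hε hm1 hr.1 ha1
      (hr.2.le.trans hba)
      (le_trans (by have := pow_le_pow_left₀ hr.1.le hr.2.le 2; gcongr) hbm)
      ham hc0 hc1 hcg1 (by positivity))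
    (hi.sub_interval le_rfl hb0.le (hba.trans haS))
  have hcl : ContinuousOn (fun t => Real.log (t / b) / a ^ (2 * s)) (Ioi 0) := by
    refine ContinuousOn.div_const (ContinuousOn.log (by fun_prop) fun x hx => ?_) _
    have : 0 < x := hx
    positivity
  have i2 := integral_le_sub_of_deriv hba
    ((H.continuousOn_energy hcl (continuousOn_const (c := 2 / a ^ (2 * s)))).mono
      fun x hx => lt_of_lt_of_le hb0 hx.1)
    (fun r hr => H.barrier_balance_le hh hs1 hs2 hEm hE hE' hε hb0 hr.1
      (lt_of_le_of_lt hbR hr.1) ha1 (hb1.trans hr.1.le) hr.2.le hab hbm ham hc0 hc1 hcgl hcj2)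
    (hi.sub_interval hb0.le hba haS)
  have i3 := H.integral_exterior_balance_le (k := 2) (c := c) (cg := cg) (cj := cj)
    hh hh1 hm0.le hEm hE hs1 hs2 hhE hε ha1 haS (le_max_left _ _)
    (hbR.trans hba) two_pos (by rw [hc]; nlinarith) (by
      rw [hcg]
      have e : 2 * ((16 + 4 / Emin) / (2 * s - 1) / h ^ 2)
        = (32 + 8 / Emin) / (2 * s - 1) / h ^ 2 := by ring
      rw [e]; gcongr; norm_num) (by rw [hcj]; apply le_of_eq; ring)
  have e1 : energy h m E z p (fun _ => 0) (fun _ => 2 / a ^ (2 * s)) b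
      = energy h m E z p (fun t => Real.log (t / b) / a ^ (2 * s)) (fun _ => 2 / a ^ (2 * s)) b := by
    simp [energy, div_self hb0.ne']
  have hω : 2 * extWeight s a a = 2 / a ^ (2 * s) := by
    simp only [extWeight, div_self ha0.ne', Real.one_rpow]; ring
  have hlog : Real.log (a / b) = 2 := by
    rw [hab, mul_div_cancel_left₀ _ hb0.ne', Real.log_exp]
  have e2 : energy h m E z p (fun t => Real.log (t / b) / a ^ (2 * s)) (fun _ => 2 / a ^ (2 * s)) a
      = energy h m E z p (fun t => 2 * extWeight s a t) (fun t => 2 * extWeight s a t) a := by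
    simp only [energy, hω, hlog]
  rw [e1] at i1
  rw [e2] at i2
  linarith

lemma radial_mass_deriv_ge (H : RadialODE h m E ε Cv R T K V z p g) {Emax c₁ r : ℝ}
    (hh : 0 < h) (hm : 0 ≤ m) (hE0 : 0 ≤ E) (hE' : E ≤ Emax) (hε : 0 ≤ ε) (hε1 : ε ≤ 1)
    (hr : 0 < r) (hmr : m ≤ c₁ * r ^ 2) :
    ∃ D, HasDerivAt (fun t => ‖p t‖ ^ 2 + t ^ 2 * ‖z t‖ ^ 2) D r ∧
      -((c₁ + Cv + Emax + 3) / h * (‖p r‖ ^ 2 + r ^ 2 * ‖z r‖ ^ 2) + r ^ 2 / h * ‖g r‖ ^ 2) ≤ D := by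
  have h1 := H.re_z hr
  have h2 := H.im_z hr
  have h3 := H.re_p hr
  have h4 := H.im_p hr
  have hd := ((h3.pow 2).add (h4.pow 2)).add
    (((hasDerivAt_id r).pow 2).mul ((h1.pow 2).add (h2.pow 2)))
  have e : (fun t => ‖p t‖ ^ 2 + t ^ 2 * ‖z t‖ ^ 2) = fun t =>
      (((p t).re ^ 2 + (p t).im ^ 2) + t ^ 2 * ((z t).re ^ 2 + (z t).im ^ 2)) := by
    funext t; rw [normSq', normSq']
  rw [e]
  refine ⟨_, hd, ?_⟩
  have a0 := abs_re_mul_le (p r) (z r)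
  have a1 := abs_im_mul_le (p r) (z r)
  have a2 : (p r).re * (g r).re + (p r).im * (g r).im ≤ ‖p r‖ * ‖g r‖ :=
    (le_abs_self _).trans (abs_re_mul_le _ _)
  have hV := H.norm_V r hr
  simp only [id, Pi.pow_apply, Pi.add_apply]
  set x := (p r).re * (z r).re + (p r).im * (z r).im with hx
  set y := (p r).re * (z r).im - (p r).im * (z r).re with hy
  set w := (p r).re * (g r).re + (p r).im * (g r).im with hw
  have hB : (z r).re ^ 2 + (z r).im ^ 2 = ‖z r‖ ^ 2 := normSq' _
  set A := ‖p r‖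
  set B := ‖z r‖
  set G := ‖g r‖
  have hA0 : 0 ≤ A := norm_nonneg _
  have hB0 : 0 ≤ B := norm_nonneg _
  have hG0 : 0 ≤ G := norm_nonneg _
  have hc₁ : 0 ≤ c₁ := by
    by_contra hc
    have : c₁ * r ^ 2 < 0 := mul_neg_of_neg_of_pos (not_le.1 hc) (by positivity)
    linarith
  have hCv : 0 ≤ Cv := (abs_nonneg _).trans hV
  have hEM : 0 ≤ Emax := hE0.trans hE'
  have t1 : |(m + r ^ 2 * (V r - E + 1)) * x| ≤ r ^ 2 * (c₁ + Cv + Emax + 1) * (A * B) := by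
    rw [abs_mul]
    refine mul_le_mul ?_ a0 (abs_nonneg _) (by positivity)
    have : |V r - E + 1| ≤ Cv + Emax + 1 := by
      rw [abs_le] at hV ⊢
      constructor <;> linarith
    calc _ ≤ |m| + |r ^ 2 * (V r - E + 1)| := abs_add_le _ _
      _ = m + r ^ 2 * |V r - E + 1| := by
        rw [abs_of_nonneg hm, abs_mul, abs_of_nonneg (sq_nonneg r)]
      _ ≤ c₁ * r ^ 2 + r ^ 2 * (Cv + Emax + 1) := by gcongr
      _ = _ := by ring
  have t2 : |r ^ 2 * ε * y| ≤ r ^ 2 * 1 * (A * B) := by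
    rw [abs_mul, abs_of_nonneg (by positivity : 0 ≤ r ^ 2 * ε)]
    gcongr
  have t3 : r * (A * B) ≤ (A ^ 2 + r ^ 2 * B ^ 2) / 2 := by
    have := sq_nonneg (A - r * B)
    have e : (A - r * B) ^ 2 = A ^ 2 - 2 * (r * (A * B)) + r ^ 2 * B ^ 2 := by ring
    linarith
  have t4 : 2 * (r * (A * G)) ≤ A ^ 2 + r ^ 2 * G ^ 2 := by
    have := sq_nonneg (A - r * G)
    have e : (A - r * G) ^ 2 = A ^ 2 - 2 * (r * (A * G)) + r ^ 2 * G ^ 2 := by ring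
    linarith
  have key : 2 / (h * r) * (-(r ^ 2 * (c₁ + Cv + Emax + 1) * (A * B)) - r ^ 2 * 1 * (A * B)
      - r ^ 2 * (A * G)) ≤
      2 / (h * r) * ((m + r ^ 2 * (V r - E + 1)) * x + r ^ 2 * ε * y - r ^ 2 * w) := by
    have h5 := neg_le_of_abs_le t1
    have h6 := neg_le_of_abs_le t2
    have h7 : r ^ 2 * w ≤ r ^ 2 * (A * G) := by gcongr
    gcongr
    linarith
  have key2 : -((c₁ + Cv + Emax + 3) / h * (A ^ 2 + r ^ 2 * B ^ 2) + r ^ 2 / h * G ^ 2) ≤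
      2 / (h * r) * (-(r ^ 2 * (c₁ + Cv + Emax + 1) * (A * B)) - r ^ 2 * 1 * (A * B)
      - r ^ 2 * (A * G)) := by
    have e1 : 2 / (h * r) * (-(r ^ 2 * (c₁ + Cv + Emax + 1) * (A * B)) - r ^ 2 * 1 * (A * B)
      - r ^ 2 * (A * G)) = -(1 / h * (2 * (c₁ + Cv + Emax + 2) * (r * (A * B)) + 2 * (r * (A * G)))) := by
      field_simp; ring
    have e2 : (c₁ + Cv + Emax + 3) / h * (A ^ 2 + r ^ 2 * B ^ 2) + r ^ 2 / h * G ^ 2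
      = 1 / h * ((c₁ + Cv + Emax + 3) * (A ^ 2 + r ^ 2 * B ^ 2) + r ^ 2 * G ^ 2) := by
      ring
    rw [e1, e2]
    have h8 := mul_le_mul_of_nonneg_left t3 (by linarith : 0 ≤ 2 * (c₁ + Cv + Emax + 2))
    have h9 : 0 ≤ r ^ 2 * B ^ 2 := by positivity
    have := mul_le_mul_of_nonneg_left (by linarith :
      2 * (c₁ + Cv + Emax + 2) * (r * (A * B)) + 2 * (r * (A * G)) ≤
      (c₁ + Cv + Emax + 3) * (A ^ 2 + r ^ 2 * B ^ 2) + r ^ 2 * G ^ 2) (by positivity : 0 ≤ 1 / h)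
    linarith
  refine (key2.trans key).trans ?_
  have h10 : 0 ≤ 2 * r * B ^ 2 := by positivity
  rw [← hB] at h10
  refine (le_add_of_nonneg_right h10).trans (le_of_eq ?_)
  rw [hx, hy, hw]
  field_simp
  ring

lemma radial_mass_le (H : RadialODE h m E ε Cv R T K V z p g) {Emax c₁ r a s : ℝ}
    (hh : 0 < h) (hm : 0 ≤ m) (hE0 : 0 ≤ E) (hE' : E ≤ Emax) (hε : 0 ≤ ε) (hε1 : ε ≤ 1)
    (hs : 0 < s) (hr : 0 < r) (hra : r ≤ a) (haT : a ≤ T) (hmr : m ≤ c₁ * r ^ 2) :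
    ‖p r‖ ^ 2 + r ^ 2 * ‖z r‖ ^ 2 ≤ Real.exp ((c₁ + Cv + Emax + 3) * a / h) *
      (‖p a‖ ^ 2 + a ^ 2 * ‖z a‖ ^ 2
        + a / h * ∫ t in (0 : ℝ)..T, t * (1 + t ^ 2) ^ s * ‖g t‖ ^ 2) := by
  have ha0 : 0 < a := hr.trans_le hra
  have hc₁ : 0 ≤ c₁ := by
    by_contra hc
    have : c₁ * r ^ 2 < 0 := mul_neg_of_neg_of_pos (not_le.1 hc) (by positivity)
    linarith
  have hCv : 0 ≤ Cv := (abs_nonneg _).trans (H.norm_V 1 one_pos)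
  set C := c₁ + Cv + Emax + 3 with hC
  have hC0 : 0 ≤ C := by linarith
  set Q := fun t => ‖p t‖ ^ 2 + t ^ 2 * ‖z t‖ ^ 2 with hQ
  set S := fun t : ℝ => t * (1 + t ^ 2) ^ s * ‖g t‖ ^ 2 with hS
  have hSi : IntervalIntegrable S volume 0 T := H.intble_source (ha0.le.trans haT) hs
  have hSra := hSi.sub_interval hr.le hra haT
  have hd : ∀ t ∈ Ioo r a, ∃ D, HasDerivAt (fun t => Real.exp (C * t / h) * Q t) D t ∧
      -(Real.exp (C * a / h) * (a / h)) * S t ≤ D := by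
    intro t ht
    have ht0 : 0 < t := hr.trans ht.1
    have hmt : m ≤ c₁ * t ^ 2 := hmr.trans (by have := ht.1.le; gcongr)
    obtain ⟨D, hD, hle⟩ := H.radial_mass_deriv_ge hh hm hE0 hE' hε hε1 ht0 hmt
    have hexp : HasDerivAt (fun t => Real.exp (C * t / h)) (Real.exp (C * t / h) * (C * 1 / h)) t :=
      (((hasDerivAt_id t).const_mul C).div_const h).exp
    refine ⟨_, hexp.mul hD, ?_⟩
    have h1 : t ^ 2 / h * ‖g t‖ ^ 2 ≤ a / h * S t := by
      have : t ^ 2 / h * ‖g t‖ ^ 2 = t / h * (t * 1 * ‖g t‖ ^ 2) := by ring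
      rw [this]
      have h2 := one_le_weight t hs
      have h3 := ht.2.le
      simp only [hS]
      gcongr
    have h4 : Real.exp (C * t / h) * (t ^ 2 / h * ‖g t‖ ^ 2) ≤ Real.exp (C * a / h) * (a / h * S t) := by
      have h3 := ht.2.le
      have : 0 ≤ t ^ 2 / h * ‖g t‖ ^ 2 := by positivity
      gcongr
    have h5 := mul_le_mul_of_nonneg_left hle (Real.exp_pos (C * t / h)).le
    simp only [hQ]
    rw [mul_one]
    rw [← hC] at h5
    linarith
  have hcont : ContinuousOn (fun t => Real.exp (C * t / h) * Q t) (Icc r a) := by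
    have hz := H.continuousOn_z.mono (fun x (hx : x ∈ Icc r a) => hr.trans_le hx.1)
    have hp := H.continuousOn_p.mono (fun x (hx : x ∈ Icc r a) => hr.trans_le hx.1)
    simp only [hQ]
    fun_prop
  have := integral_le_sub_of_deriv hra hcont hd (hSra.const_mul _)
  rw [intervalIntegral.integral_const_mul] at this
  have hS0 : ∀ t, 0 < t → 0 ≤ S t := fun t ht => by simp only [hS]; positivity
  have hle : ∫ t in r..a, S t ≤ ∫ t in (0 : ℝ)..T, S t :=
    intervalIntegral.integral_mono_interval hr.le hra haT
      ((ae_restrict_iff' measurableSet_Ioc).2 (Filter.Eventually.of_forall fun t ht => hS0 t ht.1)) hSi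
  have h6 : Q r ≤ Real.exp (C * r / h) * Q r := by
    refine le_mul_of_one_le_left (by simp only [hQ]; positivity) ?_
    exact Real.one_le_exp (by positivity)
  have h7 := mul_le_mul_of_nonneg_left hle
    (by positivity : 0 ≤ Real.exp (C * a / h) * (a / h))
  have e : Real.exp (C * a / h) * (Q a + a / h * ∫ t in (0 : ℝ)..T, S t)
    = Real.exp (C * a / h) * Q a + Real.exp (C * a / h) * (a / h) * ∫ t in (0 : ℝ)..T, S t := by ring
  change Q r ≤ Real.exp (C * a / h) * (Q a + a / h * ∫ t in (0 : ℝ)..T, S t)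
  rw [e]
  linarith

lemma inner_deriv_ge (H : RadialODE h m E ε Cv R T K V z p g) {r Emin Emax c κ χ : ℝ}
    (hh : 0 < h) (hEm : 0 < Emin) (hE : Emin ≤ E) (hE' : E ≤ Emax)
    (hε : 0 ≤ ε) (hε1 : ε ≤ 1) (hκ : 0 < κ) (hm : 0 ≤ m) (hκm : κ ^ 2 = m + h ^ 2) (hχ : 0 < χ)
    (hχE : χ * (Cv + Emax) ≤ Emin / 4) (hc1 : c ^ 2 * (Cv + Emax) ≤ 1)
    (hc2 : 8 * c ^ 2 * (Cv + 1) ^ 2 ≤ χ * Emin)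
    (hr : 0 < r) (hrc : r ≤ c * κ) :
    ∃ D, HasDerivAt (energy h m E z p (fun _ => h ^ 2 / κ ^ 2) (fun _ => χ)) D r ∧
      h ^ 2 / κ ^ 2 * Emin * (r * ‖z r‖ ^ 2)
        - (4 / χ * c ^ 2 + χ ^ 2 / Emin * (κ ^ 2 / h ^ 2)) * (r * ‖g r‖ ^ 2) ≤ D := by
  obtain ⟨D, hD, hle⟩ := H.energy_deriv_ge hh hε hr (hasDerivAt_const r (h ^ 2 / κ ^ 2))
    (hasDerivAt_const r χ) (by positivity) hχ.le
  refine ⟨D, hD, ?_⟩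
  rw [← mul_le_mul_iff_right₀ hr]
  refine le_trans ?_ hle
  have hV := H.norm_V r hr
  have hCv : 0 ≤ Cv := (abs_nonneg _).trans hV
  have hω1 : h ^ 2 / κ ^ 2 ≤ 1 := by
    rw [div_le_one (by positivity), hκm]; linarith
  have hω0 : 0 < h ^ 2 / κ ^ 2 := by positivity
  have hωinv : κ ^ 2 / h ^ 2 = 1 / (h ^ 2 / κ ^ 2) := by field_simp
  have hr2 : r ^ 2 ≤ c ^ 2 * κ ^ 2 := by
    rw [← mul_pow]; gcongr
  have hrω : (h ^ 2 / κ ^ 2) * r ^ 2 / h ^ 2 ≤ c ^ 2 := by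
    have : (h ^ 2 / κ ^ 2) * r ^ 2 / h ^ 2 = r ^ 2 / κ ^ 2 := by field_simp
    rw [this, div_le_iff₀ (by positivity)]; exact hr2
  have hrm : r ^ 2 ≤ c ^ 2 * m + h ^ 2 / κ ^ 2 * r ^ 2 := by
    have h1 : r ^ 2 / κ ^ 2 ≤ c ^ 2 := by rw [div_le_iff₀ (by positivity)]; exact hr2
    have h2 : r ^ 2 = r ^ 2 / κ ^ 2 * m + h ^ 2 / κ ^ 2 * r ^ 2 := by
      have : r ^ 2 = r ^ 2 / κ ^ 2 * κ ^ 2 := by field_simp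
      conv_lhs => rw [this, hκm, mul_add, ← hκm]
      ring
    have := mul_le_mul_of_nonneg_right h1 hm
    linarith
  rw [hωinv]
  set ω := h ^ 2 / κ ^ 2
  set A := ‖p r‖
  set B := ‖z r‖
  set G := ‖g r‖
  have hA0 : 0 ≤ A := norm_nonneg _
  have hB0 : 0 ≤ B := norm_nonneg _
  have hG0 : 0 ≤ G := norm_nonneg _
  have y1 : 2 * ω * r ^ 2 / h * (|V r| * (A * B) + ε * (A * B))
      ≤ χ / 4 * A ^ 2 + ω * r ^ 2 * (Emin / 2) * B ^ 2 := by
    have h1 : |V r| * (A * B) + ε * (A * B) ≤ (Cv + 1) * (A * B) := by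
      rw [← add_mul]; gcongr
    have h2 : 2 * ω * r ^ 2 / h * (|V r| * (A * B) + ε * (A * B))
      ≤ 2 * ω * r ^ 2 / h * ((Cv + 1) * (A * B)) := by gcongr
    have h3 := young_ineq (k := χ / 4) (by positivity) A (2 * ω * r ^ 2 / h * (Cv + 1) * B)
    have e : (2 * ω * r ^ 2 / h * (Cv + 1) * B) ^ 2 / (4 * (χ / 4))
      = (ω * r ^ 2 / h ^ 2) * (4 / χ * (Cv + 1) ^ 2 * (ω * r ^ 2 * B ^ 2)) := by
      field_simp
      ring
    have h4 : (ω * r ^ 2 / h ^ 2) * (4 / χ * (Cv + 1) ^ 2 * (ω * r ^ 2 * B ^ 2))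
        ≤ c ^ 2 * (4 / χ * (Cv + 1) ^ 2 * (ω * r ^ 2 * B ^ 2)) := by gcongr
    have h5 : c ^ 2 * (4 / χ * (Cv + 1) ^ 2 * (ω * r ^ 2 * B ^ 2))
        = (8 * c ^ 2 * (Cv + 1) ^ 2) * (1 / (2 * χ) * (ω * r ^ 2 * B ^ 2)) := by
      field_simp; ring
    have h6 : (8 * c ^ 2 * (Cv + 1) ^ 2) * (1 / (2 * χ) * (ω * r ^ 2 * B ^ 2))
        ≤ (χ * Emin) * (1 / (2 * χ) * (ω * r ^ 2 * B ^ 2)) := by gcongr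
    have h7 : (χ * Emin) * (1 / (2 * χ) * (ω * r ^ 2 * B ^ 2)) = ω * r ^ 2 * (Emin / 2) * B ^ 2 := by
      field_simp
    rw [e] at h3
    linarith
  have y2 : 2 * ω * r ^ 2 / h * (A * G) ≤ χ / 4 * A ^ 2 + 4 / χ * c ^ 2 * (r ^ 2 * G ^ 2) := by
    have h3 := young_ineq (k := χ / 4) (by positivity) A (2 * ω * r ^ 2 / h * G)
    have e : (2 * ω * r ^ 2 / h * G) ^ 2 / (4 * (χ / 4))
      = (ω * r ^ 2 / h ^ 2) * (4 / χ * ω * (r ^ 2 * G ^ 2)) := by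
      field_simp
      ring
    have h4 : (ω * r ^ 2 / h ^ 2) * (4 / χ * ω * (r ^ 2 * G ^ 2))
      ≤ c ^ 2 * (4 / χ * 1 * (r ^ 2 * G ^ 2)) := by gcongr
    rw [e] at h3
    linarith
  have y3 : χ * r ^ 2 * (G * B) ≤ ω * r ^ 2 * (Emin / 4) * B ^ 2
      + χ ^ 2 / Emin * (1 / ω) * (r ^ 2 * G ^ 2) := by
    have h3 := young_ineq (k := ω * Emin / 4) (by positivity) (r * B) (χ * r * G)
    have e : (χ * r * G) ^ 2 / (4 * (ω * Emin / 4)) = χ ^ 2 / Emin * (1 / ω) * (r ^ 2 * G ^ 2) := by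
      field_simp
    rw [e] at h3
    linarith
  have y4 : -(χ * (Cv + Emax) * r ^ 2 * B ^ 2) ≤ χ * (r ^ 2 * (V r - E)) * B ^ 2 := by
    have : -(Cv + Emax) ≤ V r - E := by
      rw [abs_le] at hV; linarith
    have := mul_le_mul_of_nonneg_left this (by positivity : 0 ≤ χ * r ^ 2 * B ^ 2)
    linarith
  have hEM : 0 < Emax := by linarith
  have y5 : χ * (Cv + Emax) * r ^ 2 * B ^ 2 ≤ χ * m * B ^ 2 + Emin / 4 * (ω * r ^ 2) * B ^ 2 := by
    have h1 := mul_le_mul_of_nonneg_left hrm (by positivity : 0 ≤ χ * (Cv + Emax) * B ^ 2)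
    have h2 := mul_le_mul_of_nonneg_left hc1 (by positivity : 0 ≤ χ * m * B ^ 2)
    have h3 := mul_le_mul_of_nonneg_left hχE (by positivity : 0 ≤ ω * r ^ 2 * B ^ 2)
    linarith
  have y6 : 2 * ω * r ^ 2 * Emin * B ^ 2 ≤ 2 * ω * r ^ 2 * E * B ^ 2 := by gcongr
  have y7 : 0 ≤ χ * A ^ 2 := by positivity
  simp only [mul_zero, abs_zero, zero_mul, zero_add, sub_zero]
  rw [mul_add (2 * ω * r ^ 2 / h)]
  linarith

lemma integral_inner_le (H : RadialODE h m E ε Cv R T K V z p g) {Emin Emax c κ χ s : ℝ}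
    (hh : 0 < h) (hEm : 0 < Emin) (hE : Emin ≤ E) (hE' : E ≤ Emax) (hs : 0 < s)
    (hε : 0 ≤ ε) (hε1 : ε ≤ 1) (hκ : 0 < κ) (hm : 0 ≤ m) (hκm : κ ^ 2 = m + h ^ 2) (hχ : 0 < χ)
    (hχE : χ * (Cv + Emax) ≤ Emin / 4) (hc0 : 0 < c) (hc1 : c ^ 2 * (Cv + Emax) ≤ 1)
    (hc2 : 8 * c ^ 2 * (Cv + 1) ^ 2 ≤ χ * Emin) (hT : c * κ ≤ T) :
    h ^ 2 / κ ^ 2 * Emin * ∫ r in (0 : ℝ)..c * κ, r * ‖z r‖ ^ 2 / (1 + r ^ 2) ^ s ≤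
      (4 / χ * c ^ 2 + χ ^ 2 / Emin * (κ ^ 2 / h ^ 2)) *
        (∫ r in (0 : ℝ)..T, r * (1 + r ^ 2) ^ s * ‖g r‖ ^ 2)
      + (1 + Emax + χ / c) * (‖p (c * κ)‖ ^ 2 + (c * κ) ^ 2 * ‖z (c * κ)‖ ^ 2) := by
  set b := c * κ with hb
  have hb0 : 0 < b := by positivity
  set c₀ := h ^ 2 / κ ^ 2 * Emin
  have hc₀ : 0 < c₀ := by positivity
  set cg := 4 / χ * c ^ 2 + χ ^ 2 / Emin * (κ ^ 2 / h ^ 2)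
  have hcg : 0 < cg := by positivity
  have hZ := H.intble_weighted_mass hb0.le hs
  have hN := H.intble_source (hb0.le.trans hT) hs
  have hNb := hN.sub_interval le_rfl hb0.le hT
  have hN0 : ∀ t : ℝ, 0 < t → 0 ≤ t * (1 + t ^ 2) ^ s * ‖g t‖ ^ 2 := fun t ht => by positivity
  have hle : ∫ t in (0 : ℝ)..b, t * (1 + t ^ 2) ^ s * ‖g t‖ ^ 2 ≤
      ∫ t in (0 : ℝ)..T, t * (1 + t ^ 2) ^ s * ‖g t‖ ^ 2 :=
    intervalIntegral.integral_mono_interval le_rfl hb0.le hT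
      ((ae_restrict_iff' measurableSet_Ioc).2 (Filter.Eventually.of_forall fun t ht => hN0 t ht.1)) hN
  have i1 := integral_le_of_deriv_of_tendsto_zero (φ := fun r =>
      c₀ * (r * ‖z r‖ ^ 2 / (1 + r ^ 2) ^ s) - cg * (r * (1 + r ^ 2) ^ s * ‖g r‖ ^ 2)) hb0
    (H.continuousOn_energy (continuousOn_const (c := h ^ 2 / κ ^ 2)) (continuousOn_const (c := χ)))
    (H.energy_tendsto_zero hm _ _)
    (fun r hr => by
      obtain ⟨D, hD, h1⟩ := H.inner_deriv_ge hh hEm hE hE' hε hε1 hκ hm hκm hχ hχE hc1 hc2 hr.1 hr.2.le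
      refine ⟨D, hD, le_trans ?_ h1⟩
      have hr0 := hr.1
      have w := one_le_weight r hs
      have h2 : r * ‖z r‖ ^ 2 / (1 + r ^ 2) ^ s ≤ r * ‖z r‖ ^ 2 := div_le_self (by positivity) w
      have h3 : r * 1 * ‖g r‖ ^ 2 ≤ r * (1 + r ^ 2) ^ s * ‖g r‖ ^ 2 := by gcongr
      rw [mul_one] at h3
      have h4 := mul_le_mul_of_nonneg_left h2 hc₀.le
      have h5 := mul_le_mul_of_nonneg_left h3 hcg.le
      linarith)
    ((hZ.const_mul _).sub (hNb.const_mul _))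
  rw [intervalIntegral.integral_sub (hZ.const_mul _) (hNb.const_mul _),
    intervalIntegral.integral_const_mul, intervalIntegral.integral_const_mul] at i1
  have hen := (abs_le.1 (energy_le (m := m) (E := E) (z := z) (p := p) (ω := fun _ => h ^ 2 / κ ^ 2)
    (χ := fun _ => χ) hh.le b hχ.le)).2
  have hω1 : h ^ 2 / κ ^ 2 ≤ 1 := by
    rw [div_le_one (by positivity), hκm]; linarith
  have hω0 : 0 < h ^ 2 / κ ^ 2 := by positivity
  have hhκ : h ≤ κ := le_of_sq_le_sq (by linarith) hκ.le
  set A := ‖p b‖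
  set B := ‖z b‖
  have hA0 : 0 ≤ A := norm_nonneg _
  have hB0 : 0 ≤ B := norm_nonneg _
  have hEM : 0 < Emax := by linarith
  have e1 : h ^ 2 / κ ^ 2 * (A ^ 2 + (b ^ 2 * E - m) * B ^ 2) ≤ (1 + Emax) * (A ^ 2 + b ^ 2 * B ^ 2) := by
    calc _ ≤ h ^ 2 / κ ^ 2 * (A ^ 2 + b ^ 2 * Emax * B ^ 2) := by
          gcongr
          have : b ^ 2 * E ≤ b ^ 2 * Emax := by gcongr
          linarith
      _ ≤ 1 * (A ^ 2 + b ^ 2 * Emax * B ^ 2) := by gcongr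
      _ ≤ _ := by
          have : 0 ≤ Emax * A ^ 2 := by positivity
          have : 0 ≤ b ^ 2 * B ^ 2 := by positivity
          linarith
  have e2 : h * χ * (A * B) ≤ χ / c * (A ^ 2 + b ^ 2 * B ^ 2) := by
    calc _ ≤ κ * χ * (A * B) := by gcongr
      _ = χ / c * (b * (A * B)) := by rw [hb]; field_simp
      _ ≤ _ := by
        gcongr
        have := sq_nonneg (A - b * B)
        have e : (A - b * B) ^ 2 = A ^ 2 - 2 * (b * (A * B)) + b ^ 2 * B ^ 2 := by ring
        have : 0 ≤ b * (A * B) := by positivity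
        linarith
  have h6 := mul_le_mul_of_nonneg_left hle hcg.le
  linarith

lemma le_energy_exterior {h m E Emin M a α A B x : ℝ} (hh : 0 < h) (hh1 : h ≤ 1) (hα : 0 < α)
    (hmM : m ≤ M) (hE : Emin ≤ E) (haE : 2 * M + 2 ≤ a ^ 2 * Emin)
    (hx : |x| ≤ A * B) :
    1 / (2 * α) * (A ^ 2 + Emin * (a ^ 2 * B ^ 2)) ≤
      1 / α * (A ^ 2 + (a ^ 2 * E - m) * B ^ 2) + h * (1 / α) * x := by
  have h1 : -(A ^ 2 / 2 + B ^ 2 / 2) ≤ h * x := by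
    have := sq_nonneg (A - B)
    have h2 : |h * x| ≤ 1 * (A * B) := by
      rw [abs_mul, abs_of_pos hh]
      gcongr
    have := neg_le_of_abs_le h2
    nlinarith
  have h2 : Emin * (a ^ 2 * B ^ 2) / 2 + B ^ 2 / 2 ≤ (a ^ 2 * E - m) * B ^ 2 := by
    have h3 : a ^ 2 * Emin ≤ a ^ 2 * E := by gcongr
    have := mul_le_mul_of_nonneg_right
      (by linarith : a ^ 2 * Emin / 2 + 1 / 2 ≤ a ^ 2 * E - m) (sq_nonneg B)
    linarith
  have h4 := mul_le_mul_of_nonneg_left (by linarith :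
    (A ^ 2 + Emin * (a ^ 2 * B ^ 2)) / 2 ≤ A ^ 2 + (a ^ 2 * E - m) * B ^ 2 + h * x)
    (by positivity : 0 ≤ 1 / α)
  have e : 1 / (2 * α) * (A ^ 2 + Emin * (a ^ 2 * B ^ 2))
    = 1 / α * ((A ^ 2 + Emin * (a ^ 2 * B ^ 2)) / 2) := by field_simp
  rw [e]
  linarith

lemma source_nonneg (s : ℝ) (g : ℝ → ℂ) {t : ℝ} (ht : 0 < t) :
    0 ≤ t * (1 + t ^ 2) ^ s * ‖g t‖ ^ 2 := by positivity

lemma integral_exterior_le (H : RadialODE h m E ε Cv R T K V z p g) {s a Emin M : ℝ}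
    (hh : 0 < h) (hh1 : h ≤ 1) (hm : 0 ≤ m) (hmM : m ≤ M) (hEm : 0 < Emin) (hE : Emin ≤ E)
    (hs1 : 1 / 2 < s) (hs2 : s ≤ 1) (hhE : 4 * h ^ 2 ≤ (2 * s - 1) ^ 2 * Emin) (hε : 0 ≤ ε)
    (ha : 1 ≤ a) (haT : a ≤ T) (hR : R ≤ a) (haE : 2 * M + 2 ≤ a ^ 2 * Emin) :
    1 / (2 * a ^ (2 * s)) * (‖p a‖ ^ 2 + Emin * (a ^ 2 * ‖z a‖ ^ 2)) +
      (2 * s - 1) / 4 * Emin * ∫ r in a..T, r * ‖z r‖ ^ 2 / (1 + r ^ 2) ^ s ≤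
    ((16 + 4 / Emin) / (2 * s - 1) + 2) / h ^ 2 *
      ((∫ r in (0 : ℝ)..T, r * (1 + r ^ 2) ^ s * ‖g r‖ ^ 2) +
        ε * ∫ r in (0 : ℝ)..T, (‖p r‖ ^ 2 / r + r * ‖z r‖ ^ 2)) := by
  have ha0 : 0 < a := by linarith
  have hs : 0 < s := by linarith
  have hs0 : 0 < 2 * s - 1 := by linarith
  have hT0 := ha0.le.trans haT
  set c := (2 * s - 1) / 4 * Emin
  set cg := (16 + 4 / Emin) / (2 * s - 1) / h ^ 2 with hcg
  set cj := 2 / h with hcj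
  have i := H.integral_exterior_balance_le (k := 1) (c := c) (cg := cg) (cj := cj)
    hh hh1 hm hEm hE hs1 hs2 hhE hε ha haT le_rfl hR one_pos (by rw [one_mul])
    (by rw [one_mul]) (by rw [one_mul])
  have hZ := H.intble_weighted_mass hT0 hs
  have hN := H.intble_source hT0 hs
  have hP := (H.intble_kinetic hT0).add (H.intble_mass hT0)
  have hZa := hZ.sub_interval ha0.le haT le_rfl
  have hNa := hN.sub_interval ha0.le haT le_rfl
  have hPa := hP.sub_interval ha0.le haT le_rfl
  have i2 : ∫ r in a..T, balance s ε c cg cj z p g r =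
      c * (∫ r in a..T, r * ‖z r‖ ^ 2 / (1 + r ^ 2) ^ s)
      - cg * (∫ r in a..T, r * (1 + r ^ 2) ^ s * ‖g r‖ ^ 2)
      - cj * (ε * ∫ r in a..T, (‖p r‖ ^ 2 / r + r * ‖z r‖ ^ 2)) := by
    unfold balance
    rw [intervalIntegral.integral_sub ((hZa.const_mul _).sub (hNa.const_mul _))
      ((hPa.const_mul _).const_mul _),
      intervalIntegral.integral_sub (hZa.const_mul _) (hNa.const_mul _)]
    simp only [intervalIntegral.integral_const_mul]
  rw [i2] at i
  have hNle := intervalIntegral.integral_mono_interval ha0.le haT le_rfl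
      ((ae_restrict_iff' measurableSet_Ioc).2
        (Filter.Eventually.of_forall fun t ht => source_nonneg s g ht.1)) hN
  have hPle : ∫ r in a..T, (‖p r‖ ^ 2 / r + r * ‖z r‖ ^ 2) ≤
      ∫ r in (0 : ℝ)..T, (‖p r‖ ^ 2 / r + r * ‖z r‖ ^ 2) :=
    intervalIntegral.integral_mono_interval ha0.le haT le_rfl
      ((ae_restrict_iff' measurableSet_Ioc).2
        (Filter.Eventually.of_forall fun t ht => by
          have : 0 < t := ht.1
          simp only [Pi.zero_apply]; positivity)) hP
  have hN0 : 0 ≤ ∫ r in (0 : ℝ)..T, r * (1 + r ^ 2) ^ s * ‖g r‖ ^ 2 :=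
    intervalIntegral.integral_nonneg hT0 fun t ht => by have := ht.1; positivity
  have hP0 : 0 ≤ ∫ r in (0 : ℝ)..T, (‖p r‖ ^ 2 / r + r * ‖z r‖ ^ 2) :=
    intervalIntegral.integral_nonneg hT0 fun t ht => by have := ht.1; positivity
  have hen := le_energy_exterior (A := ‖p a‖) (B := ‖z a‖) hh hh1
    (by positivity : 0 < a ^ (2 * s)) hmM hE haE (abs_re_mul_le (p a) (z a))
  have e1 : energy h m E z p (fun t => 1 * extWeight s a t) (fun t => 1 * extWeight s a t) a =
      1 / a ^ (2 * s) * (‖p a‖ ^ 2 + (a ^ 2 * E - m) * ‖z a‖ ^ 2) + h * (1 / a ^ (2 * s)) *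
        ((p a).re * (z a).re + (p a).im * (z a).im) := by
    have hω : 1 * extWeight s a a = 1 / a ^ (2 * s) := by
      simp only [extWeight, div_self ha0.ne', Real.one_rpow]; ring
    simp only [energy, hω, normSq']
  rw [e1] at i
  set N2 := ∫ r in (0 : ℝ)..T, r * (1 + r ^ 2) ^ s * ‖g r‖ ^ 2
  set P2 := ∫ r in (0 : ℝ)..T, (‖p r‖ ^ 2 / r + r * ‖z r‖ ^ 2)
  have hcg0 : 0 ≤ cg := by positivity
  have hcj0 : 0 ≤ cj := by positivity
  have f1 := mul_le_mul_of_nonneg_left hNle hcg0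
  have f2 := mul_le_mul_of_nonneg_left (mul_le_mul_of_nonneg_left hPle hε) hcj0
  have g1 : cg * N2 ≤ ((16 + 4 / Emin) / (2 * s - 1) + 2) / h ^ 2 * N2 := by
    rw [hcg]; gcongr; linarith
  have g2 : cj * (ε * P2) ≤ ((16 + 4 / Emin) / (2 * s - 1) + 2) / h ^ 2 * (ε * P2) := by
    have : cj ≤ ((16 + 4 / Emin) / (2 * s - 1) + 2) / h ^ 2 := by
      have h1 : 2 / h ≤ 2 / h ^ 2 := by gcongr; nlinarith
      have h2 : 0 ≤ (16 + 4 / Emin) / (2 * s - 1) / h ^ 2 := by positivity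
      rw [add_div]; linarith
    have : 0 ≤ ε * P2 := by positivity
    gcongr
  rw [mul_add]
  linarith

lemma le_exp_div {x h : ℝ} (hh : 0 < h) (hh1 : h ≤ 1) (hx : 0 ≤ x) : x ≤ Real.exp (x / h) := by
  have : x ≤ x / h := by rw [le_div_iff₀ hh]; nlinarith
  have := Real.add_one_le_exp (x / h)
  linarith

set_option maxHeartbeats 1600000 in
/-- Small angular momentum: the weighted mass is controlled with an exponential loss. -/
lemma exists_weighted_mass_le_of_small {Emin Emax s Cv R M : ℝ} (hEm : 0 < Emin)
    (hEE : Emin ≤ Emax) (hs1 : 1 / 2 < s) (hs2 : s ≤ 1) (hCv : 0 ≤ Cv) (hM : 0 ≤ M) :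
    ∃ C > 0, ∃ a > 0, ∀ {h m E ε T K : ℝ} {V : ℝ → ℝ} {z p g : ℝ → ℂ},
      RadialODE h m E ε Cv R T K V z p g → 0 < h → h ≤ 1 → 0 ≤ m → m ≤ M → Emin ≤ E → E ≤ Emax →
      4 * h ^ 2 ≤ (2 * s - 1) ^ 2 * Emin → 0 ≤ ε → ε ≤ 1 → a ≤ T →
      ∫ r in (0 : ℝ)..T, r * ‖z r‖ ^ 2 / (1 + r ^ 2) ^ s ≤ Real.exp (C / h) *
        ((∫ r in (0 : ℝ)..T, r * (1 + r ^ 2) ^ s * ‖g r‖ ^ 2) +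
        ε * ∫ r in (0 : ℝ)..T, (‖p r‖ ^ 2 / r + r * ‖z r‖ ^ 2)) := by
  have hs : 0 < s := by linarith
  have hs0 : 0 < 2 * s - 1 := by linarith
  have hEM : 0 < Emax := by linarith
  obtain ⟨a, haR, ha1, haM, haE⟩ : ∃ a, R ≤ a ∧ 1 ≤ a ∧ M + 1 ≤ a ^ 2 ∧
      2 * M + 2 ≤ a ^ 2 * Emin := by
    refine ⟨1 + |R| + M + (2 * M + 2) / Emin, ?_, ?_, ?_, ?_⟩
    · have : 0 ≤ (2 * M + 2) / Emin := by positivity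
      linarith [le_abs_self R]
    · have : 0 ≤ (2 * M + 2) / Emin := by positivity
      linarith [abs_nonneg R]
    · have : 0 ≤ (2 * M + 2) / Emin := by positivity
      have h1 : M + 1 ≤ 1 + |R| + M + (2 * M + 2) / Emin := by linarith [abs_nonneg R]
      nlinarith
    · have h0 : 0 ≤ (2 * M + 2) / Emin := by positivity
      have h1 : (2 * M + 2) / Emin ≤ 1 + |R| + M + (2 * M + 2) / Emin := by linarith [abs_nonneg R]
      have h2 : 1 ≤ 1 + |R| + M + (2 * M + 2) / Emin := by linarith [abs_nonneg R]
      have h3 : (2 * M + 2) / Emin ≤ (1 + |R| + M + (2 * M + 2) / Emin) ^ 2 := by nlinarith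
      rwa [div_le_iff₀ hEm] at h3
  have ha0 : 0 < a := by linarith
  obtain ⟨χ, hχ0, hχE⟩ : ∃ χ > 0, χ * (Cv + Emax) ≤ Emin / 4 :=
    ⟨Emin / 4 / (Cv + Emax), by positivity, by field_simp; rfl⟩
  obtain ⟨c, hc0, hcle, hc1, hc2⟩ : ∃ c > 0, c ≤ 1 ∧ c ^ 2 * (Cv + Emax) ≤ 1 ∧
      8 * c ^ 2 * (Cv + 1) ^ 2 ≤ χ * Emin := by
    obtain ⟨X, hX⟩ : ∃ X, X = (Cv + Emax) + 8 * (Cv + 1) ^ 2 / (χ * Emin) := ⟨_, rfl⟩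
    have hX0 : 0 ≤ X := by rw [hX]; positivity
    have h1 : 0 < 1 / (1 + X) := by positivity
    have h2 : 1 / (1 + X) ≤ 1 := by rw [div_le_one (by positivity)]; linarith
    have h3 : 1 / (1 + X) * X ≤ 1 := by
      rw [one_div_mul_eq_div, div_le_one (by positivity)]; linarith
    have h4 : (1 / (1 + X)) ^ 2 * X ≤ 1 := by
      have : (1 / (1 + X)) ^ 2 * X = 1 / (1 + X) * (1 / (1 + X) * X) := by ring
      rw [this]; nlinarith
    have h5 : 0 ≤ 8 * (Cv + 1) ^ 2 / (χ * Emin) := by positivity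
    refine ⟨1 / (1 + X), h1, h2, ?_, ?_⟩
    · refine le_trans ?_ h4
      gcongr
      linarith
    · have h6 : (1 / (1 + X)) ^ 2 * (8 * (Cv + 1) ^ 2 / (χ * Emin)) ≤ 1 := by
        refine le_trans ?_ h4
        gcongr
        linarith
      rw [← mul_div_assoc, div_le_one (by positivity)] at h6
      linarith
  obtain ⟨K0, hK0⟩ : ∃ K0, K0 = (16 + 4 / Emin) / (2 * s - 1) + 2 := ⟨_, rfl⟩
  have hK0p : 0 < K0 := by rw [hK0]; positivity
  obtain ⟨β, hβ0, hβ1, hβE⟩ : ∃ β > 0, β ≤ 1 ∧ β ≤ Emin :=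
    ⟨min 1 Emin, by positivity, min_le_left _ _, min_le_right _ _⟩
  obtain ⟨K1, hK1⟩ : ∃ K1, K1 = 2 * a ^ (2 * s) / β * K0 + a := ⟨_, rfl⟩
  have hK1p : 0 < K1 := by rw [hK1]; positivity
  obtain ⟨C1, hC1⟩ : ∃ C1, C1 = 1 / c ^ 2 + Cv + Emax + 3 := ⟨_, rfl⟩
  have hC1p : 0 < C1 := by rw [hC1]; positivity
  obtain ⟨K2, hK2⟩ : ∃ K2, K2 = K0 / ((2 * s - 1) / 4 * Emin) + a * K1 / c + (M + 1) / Emin *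
      ((4 / χ * c ^ 2 + χ ^ 2 / Emin * (M + 1)) + (1 + Emax + χ / c) * K1) := ⟨_, rfl⟩
  have hK2p : 0 < K2 := by rw [hK2]; positivity
  refine ⟨C1 * a + 4 + K2, by positivity, a, ha0, ?_⟩
  intro h m E ε T K V z p g H hh hh1 hm hmM hE hE' hhE hε hε1 haT
  have hT0 := ha0.le.trans haT
  have iext := H.integral_exterior_le hh hh1 hm hmM hEm hE hs1 hs2 hhE hε ha1 haT haR haE
  obtain ⟨N2, hN2⟩ : ∃ N2, N2 = ∫ r in (0 : ℝ)..T, r * (1 + r ^ 2) ^ s * ‖g r‖ ^ 2 := ⟨_, rfl⟩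
  obtain ⟨P2, hP2⟩ : ∃ P2, P2 = ∫ r in (0 : ℝ)..T, (‖p r‖ ^ 2 / r + r * ‖z r‖ ^ 2) := ⟨_, rfl⟩
  have hN0 : 0 ≤ N2 := by
    rw [hN2]
    exact intervalIntegral.integral_nonneg hT0 fun t ht => by have := ht.1; positivity
  have hP0 : 0 ≤ P2 := by
    rw [hP2]
    exact intervalIntegral.integral_nonneg hT0 fun t ht => by have := ht.1; positivity
  have hZ := H.intble_weighted_mass hT0 hs
  rw [← hN2, ← hP2, ← hK0] at iext
  rw [← hN2, ← hP2]
  obtain ⟨X, hX⟩ : ∃ X, X = N2 + ε * P2 := ⟨_, rfl⟩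
  have hX0 : 0 ≤ X := by rw [hX]; positivity
  have hNX : N2 ≤ X := by rw [hX]; have : 0 ≤ ε * P2 := by positivity
                          linarith
  rw [← hX] at iext ⊢
  obtain ⟨Λ, hΛ⟩ : ∃ Λ, Λ = Real.exp (C1 * a / h) := ⟨_, rfl⟩
  have hΛ1 : 1 ≤ Λ := by rw [hΛ]; exact Real.one_le_exp (by positivity)
  -- the matching point
  obtain ⟨κ, hκ0, hκm⟩ : ∃ κ > 0, κ ^ 2 = m + h ^ 2 :=
    ⟨Real.sqrt (m + h ^ 2), by positivity, Real.sq_sqrt (by positivity)⟩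
  have hhκ : h ≤ κ := le_of_sq_le_sq (by linarith) hκ0.le
  have hκM : κ ^ 2 ≤ M + 1 := by
    have : h ^ 2 ≤ 1 := pow_le_one₀ hh.le hh1
    linarith
  obtain ⟨δ, hδ⟩ : ∃ δ, δ = c * κ := ⟨_, rfl⟩
  have hδ0 : 0 < δ := by rw [hδ]; positivity
  have hδa : δ ≤ a := by
    have h1 : κ ≤ a := le_of_sq_le_sq (hκM.trans haM) ha0.le
    rw [hδ]
    calc c * κ ≤ 1 * a := by gcongr
      _ = a := one_mul a
  have hδh : c * h ≤ δ := by rw [hδ]; gcongr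
  have hmδ : ∀ r, δ ≤ r → m ≤ 1 / c ^ 2 * r ^ 2 := by
    intro r hr
    have h1 : δ ^ 2 ≤ r ^ 2 := by gcongr
    have h2 : m ≤ κ ^ 2 := by rw [hκm]; linarith [sq_nonneg h]
    calc m ≤ κ ^ 2 := h2
      _ = 1 / c ^ 2 * δ ^ 2 := by rw [hδ]; field_simp
      _ ≤ _ := by gcongr
  -- mass at the outer point
  have hG : ‖p a‖ ^ 2 + a ^ 2 * ‖z a‖ ^ 2 ≤ 2 * a ^ (2 * s) / β * K0 / h ^ 2 * X := by
    have hα : 0 < a ^ (2 * s) := by positivity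
    have hZe : 0 ≤ ∫ r in a..T, r * ‖z r‖ ^ 2 / (1 + r ^ 2) ^ s :=
      intervalIntegral.integral_nonneg haT fun t ht => by
        have := ha0.le.trans ht.1; positivity
    have h1 : β * (‖p a‖ ^ 2 + a ^ 2 * ‖z a‖ ^ 2) ≤ ‖p a‖ ^ 2 + Emin * (a ^ 2 * ‖z a‖ ^ 2) := by
      have h2 : β * ‖p a‖ ^ 2 ≤ 1 * ‖p a‖ ^ 2 := by gcongr
      have h3 : β * (a ^ 2 * ‖z a‖ ^ 2) ≤ Emin * (a ^ 2 * ‖z a‖ ^ 2) := by gcongr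
      linarith
    have h4 : 1 / (2 * a ^ (2 * s)) * (β * (‖p a‖ ^ 2 + a ^ 2 * ‖z a‖ ^ 2)) ≤ K0 / h ^ 2 * X := by
      have h5 := mul_le_mul_of_nonneg_left h1 (by positivity : 0 ≤ 1 / (2 * a ^ (2 * s)))
      have h6 : 0 ≤ (2 * s - 1) / 4 * Emin * ∫ r in a..T, r * ‖z r‖ ^ 2 / (1 + r ^ 2) ^ s :=
        mul_nonneg (by positivity) hZe
      linarith
    have h7 := mul_le_mul_of_nonneg_left h4 (by positivity : 0 ≤ 2 * a ^ (2 * s) / β)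
    calc _ = 2 * a ^ (2 * s) / β *
          (1 / (2 * a ^ (2 * s)) * (β * (‖p a‖ ^ 2 + a ^ 2 * ‖z a‖ ^ 2))) := by field_simp
      _ ≤ _ := h7
      _ = _ := by ring
  have hQ : ∀ r, δ ≤ r → r ≤ a → ‖p r‖ ^ 2 + r ^ 2 * ‖z r‖ ^ 2 ≤ Λ * K1 / h ^ 2 * X := by
    intro r hr hra
    have := H.radial_mass_le (Emax := Emax) (s := s) hh hm (by linarith) hE' hε hε1 hs
      (hδ0.trans_le hr) hra haT (hmδ r hr)
    rw [← hN2, ← hC1, ← hΛ] at this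
    refine this.trans ?_
    have h1 : a / h * N2 ≤ a / h ^ 2 * X := by
      have : a / h ≤ a / h ^ 2 := by gcongr; nlinarith
      gcongr
    calc _ ≤ Λ * (2 * a ^ (2 * s) / β * K0 / h ^ 2 * X + a / h ^ 2 * X) := by gcongr
      _ = _ := by rw [hK1]; ring
  -- the three contributions
  have z1 : ∫ r in (0 : ℝ)..δ, r * ‖z r‖ ^ 2 / (1 + r ^ 2) ^ s ≤ (M + 1) / Emin *
      ((4 / χ * c ^ 2 + χ ^ 2 / Emin * (M + 1)) + (1 + Emax + χ / c) * K1) * (Λ / h ^ 4) * X := by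
    have i1 := H.integral_inner_le (s := s) hh hEm hE hE' hs hε hε1 hκ0 hm hκm hχ0 hχE hc0 hc1 hc2
      (by rw [← hδ]; exact hδa.trans haT)
    rw [← hδ, ← hN2] at i1
    have i2 := hQ δ le_rfl hδa
    have hh2 : 1 ≤ 1 / h ^ 2 := by
      rw [le_div_iff₀ (by positivity)]
      have : h ^ 2 ≤ 1 := pow_le_one₀ hh.le hh1
      linarith
    have f1 : (4 / χ * c ^ 2 + χ ^ 2 / Emin * (κ ^ 2 / h ^ 2)) * N2
        ≤ (4 / χ * c ^ 2 + χ ^ 2 / Emin * (M + 1)) * (Λ / h ^ 2) * X := by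
      have j1 : 4 / χ * c ^ 2 ≤ 4 / χ * c ^ 2 * (1 / h ^ 2) := le_mul_of_one_le_right (by positivity) hh2
      have j2 : χ ^ 2 / Emin * (κ ^ 2 / h ^ 2) ≤ χ ^ 2 / Emin * ((M + 1) / h ^ 2) := by gcongr
      have j3 : 4 / χ * c ^ 2 + χ ^ 2 / Emin * (κ ^ 2 / h ^ 2) ≤
          (4 / χ * c ^ 2 + χ ^ 2 / Emin * (M + 1)) * (1 / h ^ 2) := by
        have : (4 / χ * c ^ 2 + χ ^ 2 / Emin * (M + 1)) * (1 / h ^ 2)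
          = 4 / χ * c ^ 2 * (1 / h ^ 2) + χ ^ 2 / Emin * ((M + 1) / h ^ 2) := by ring
        rw [this]
        exact add_le_add j1 j2
      have j4 : 1 / h ^ 2 ≤ Λ / h ^ 2 := by gcongr
      calc _ ≤ (4 / χ * c ^ 2 + χ ^ 2 / Emin * (M + 1)) * (1 / h ^ 2) * X := by gcongr
        _ ≤ _ := by gcongr
    have f2 : (1 + Emax + χ / c) * (‖p δ‖ ^ 2 + δ ^ 2 * ‖z δ‖ ^ 2) ≤
        (1 + Emax + χ / c) * (Λ * K1 / h ^ 2 * X) := by gcongr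
    have f3 : h ^ 2 / κ ^ 2 * Emin * ∫ r in (0 : ℝ)..δ, r * ‖z r‖ ^ 2 / (1 + r ^ 2) ^ s ≤
        ((4 / χ * c ^ 2 + χ ^ 2 / Emin * (M + 1)) + (1 + Emax + χ / c) * K1) * (Λ / h ^ 2) * X := by
      have : ((4 / χ * c ^ 2 + χ ^ 2 / Emin * (M + 1)) + (1 + Emax + χ / c) * K1) * (Λ / h ^ 2) * X
        = (4 / χ * c ^ 2 + χ ^ 2 / Emin * (M + 1)) * (Λ / h ^ 2) * X
          + (1 + Emax + χ / c) * (Λ * K1 / h ^ 2 * X) := by ring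
      rw [this]
      exact i1.trans (add_le_add f1 f2)
    have f4 := mul_le_mul_of_nonneg_left f3 (by positivity : 0 ≤ κ ^ 2 / (h ^ 2 * Emin))
    have e4 : κ ^ 2 / (h ^ 2 * Emin) * (h ^ 2 / κ ^ 2 * Emin *
        ∫ r in (0 : ℝ)..δ, r * ‖z r‖ ^ 2 / (1 + r ^ 2) ^ s)
        = ∫ r in (0 : ℝ)..δ, r * ‖z r‖ ^ 2 / (1 + r ^ 2) ^ s := by field_simp
    rw [e4] at f4
    refine f4.trans ?_
    calc _ ≤ (M + 1) / (h ^ 2 * Emin) * (((4 / χ * c ^ 2 + χ ^ 2 / Emin * (M + 1))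
          + (1 + Emax + χ / c) * K1) * (Λ / h ^ 2) * X) := by gcongr
      _ = _ := by field_simp
  have z2 : ∫ r in δ..a, r * ‖z r‖ ^ 2 / (1 + r ^ 2) ^ s ≤ a * K1 / c * (Λ / h ^ 4) * X := by
    have hb : ∀ r ∈ Icc δ a, r * ‖z r‖ ^ 2 / (1 + r ^ 2) ^ s ≤ Λ * K1 / h ^ 2 * X / (c * h) := by
      intro r hr
      have hr0 := hδ0.trans_le hr.1
      calc r * ‖z r‖ ^ 2 / (1 + r ^ 2) ^ s ≤ r * ‖z r‖ ^ 2 :=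
            div_le_self (by positivity) (one_le_weight r hs)
        _ = r ^ 2 * ‖z r‖ ^ 2 / r := by field_simp
        _ ≤ (Λ * K1 / h ^ 2 * X) / (c * h) := by
            have h1 := hQ r hr.1 hr.2
            have h2 : r ^ 2 * ‖z r‖ ^ 2 ≤ Λ * K1 / h ^ 2 * X := by
              have := sq_nonneg ‖p r‖
              linarith
            have h3 : c * h ≤ r := hδh.trans hr.1
            gcongr
    have := intervalIntegral.integral_mono_on hδa (hZ.sub_interval hδ0.le hδa haT)
      intervalIntegrable_const hb
    refine this.trans ?_
    rw [intervalIntegral.integral_const, smul_eq_mul]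
    calc (a - δ) * (Λ * K1 / h ^ 2 * X / (c * h)) ≤ a * (Λ * K1 / h ^ 2 * X / (c * h)) := by
          gcongr; linarith
      _ = a * K1 / c * (Λ / h ^ 3) * X := by field_simp
      _ ≤ _ := by
          have : h ^ 4 ≤ h ^ 3 := pow_le_pow_of_le_one hh.le hh1 (by norm_num)
          gcongr
  have z3 : ∫ r in a..T, r * ‖z r‖ ^ 2 / (1 + r ^ 2) ^ s ≤
      K0 / ((2 * s - 1) / 4 * Emin) * (Λ / h ^ 4) * X := by
    have h1 : 0 ≤ 1 / (2 * a ^ (2 * s)) * (‖p a‖ ^ 2 + Emin * (a ^ 2 * ‖z a‖ ^ 2)) := by positivity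
    have h2 : (2 * s - 1) / 4 * Emin * ∫ r in a..T, r * ‖z r‖ ^ 2 / (1 + r ^ 2) ^ s
      ≤ K0 / h ^ 2 * X := by linarith only [h1, iext]
    have h3 : ∫ r in a..T, r * ‖z r‖ ^ 2 / (1 + r ^ 2) ^ s ≤
        K0 / h ^ 2 * X / ((2 * s - 1) / 4 * Emin) := by
      rw [le_div_iff₀ (by positivity)]; linarith only [h2]
    refine h3.trans ?_
    have h4 : 1 / h ^ 2 ≤ Λ / h ^ 4 := by
      have : h ^ 4 ≤ h ^ 2 := pow_le_pow_of_le_one hh.le hh1 (by norm_num)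
      gcongr
    calc K0 / h ^ 2 * X / ((2 * s - 1) / 4 * Emin)
        = K0 / ((2 * s - 1) / 4 * Emin) * (1 / h ^ 2) * X := by ring
      _ ≤ _ := by gcongr
  rw [← intervalIntegral.integral_add_adjacent_intervals (hZ.sub_interval le_rfl ha0.le haT)
    (hZ.sub_interval ha0.le haT le_rfl),
    ← intervalIntegral.integral_add_adjacent_intervals
    (hZ.sub_interval le_rfl hδ0.le (hδa.trans haT)) (hZ.sub_interval hδ0.le hδa haT)]
  have hsum : K2 * (Λ / h ^ 4) * X ≤ Real.exp ((C1 * a + 4 + K2) / h) * X := by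
    have h1 : 1 / h ≤ Real.exp (1 / h) := by
      have := Real.add_one_le_exp (1 / h)
      linarith only [this]
    have h2 : 1 / h ^ 4 ≤ Real.exp (4 / h) := by
      have : Real.exp (4 / h) = Real.exp (1 / h) ^ 4 := by
        rw [← Real.exp_nat_mul]; congr 1; push_cast; ring
      rw [this, ← one_div_pow]
      gcongr
    have h3 := le_exp_div hh hh1 hK2p.le
    have h4 : Real.exp ((C1 * a + 4 + K2) / h) = Real.exp (K2 / h) * (Λ * Real.exp (4 / h)) := by
      rw [hΛ, ← Real.exp_add, ← Real.exp_add]; congr 1; ring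
    rw [h4]
    have h5 : Λ / h ^ 4 = Λ * (1 / h ^ 4) := by ring
    rw [h5]
    gcongr
  refine le_trans ?_ hsum
  have : K2 * (Λ / h ^ 4) * X = (M + 1) / Emin *
      ((4 / χ * c ^ 2 + χ ^ 2 / Emin * (M + 1)) + (1 + Emax + χ / c) * K1) * (Λ / h ^ 4) * X
      + a * K1 / c * (Λ / h ^ 4) * X + K0 / ((2 * s - 1) / 4 * Emin) * (Λ / h ^ 4) * X := by
    rw [hK2]; ring
  rw [this]
  exact add_le_add (add_le_add z1 z2) z3

lemma tendsto_norm_mul_norm (H : RadialODE h m E ε Cv R T K V z p g) :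
    Filter.Tendsto (fun r => ‖p r‖ * ‖z r‖) (nhdsWithin 0 (Ioi 0)) (nhds 0) := by
  have hmem : ∀ᶠ r : ℝ in nhdsWithin 0 (Ioi 0), 0 < r := self_mem_nhdsWithin
  have hKr : Filter.Tendsto (fun r : ℝ => Real.sqrt (K * r) * K) (nhdsWithin 0 (Ioi 0)) (nhds 0) := by
    have : Filter.Tendsto (fun r : ℝ => Real.sqrt (K * r) * K) (nhds 0)
        (nhds (Real.sqrt (K * 0) * K)) :=
      Continuous.tendsto (by fun_prop) 0
    rw [mul_zero, Real.sqrt_zero, zero_mul] at this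
    exact this.mono_left nhdsWithin_le_nhds
  refine squeeze_zero' (Filter.Eventually.of_forall fun r => by positivity)
    (hmem.mono fun r hr => ?_) hKr
  have h1 := Real.le_sqrt_of_sq_le (H.norm_p r hr)
  have h2 := H.norm_z r hr
  gcongr

lemma intble_pairing (H : RadialODE h m E ε Cv R T K V z p g) {S : ℝ} (hS : 0 ≤ S) :
    IntervalIntegrable (fun r => r * (‖g r‖ * ‖z r‖)) volume 0 S := by
  have hK := H.K_nonneg
  refine intervalIntegrable_of_bound (C := S * (K * K)) ?_ hS fun r hr hrT => ?_
  · exact measurable_id.mul (H.meas_g.norm.mul H.meas_z.norm)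
  rw [abs_of_nonneg (by positivity)]
  have h1 := H.norm_g r hr
  have h2 := H.norm_z r hr
  gcongr

lemma flux_deriv (H : RadialODE h m E ε Cv R T K V z p g) {r : ℝ} (hh : 0 < h) (hr : 0 < r) :
    ∃ D, HasDerivAt (fun t => h * ((p t).re * (z t).im - (p t).im * (z t).re)) D r ∧
      ε * (r * ‖z r‖ ^ 2) - r * (‖g r‖ * ‖z r‖) ≤ D := by
  have h1 := H.re_z hr
  have h2 := H.im_z hr
  have h3 := H.re_p hr
  have h4 := H.im_p hr
  refine ⟨_, ((h3.mul h2).sub (h4.mul h1)).const_mul h, ?_⟩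
  have a1 := (abs_le.1 (abs_im_mul_le (g r) (z r))).2
  have := mul_le_mul_of_nonneg_left a1 hr.le
  rw [← normSq' (z r)]
  refine (sub_le_sub_left this _).trans (le_of_eq ?_)
  field_simp
  ring

lemma integral_absorption_le (H : RadialODE h m E ε Cv R T K V z p g) (hh : 0 < h) (hT : 0 < T) :
    ε * ∫ r in (0 : ℝ)..T, r * ‖z r‖ ^ 2 ≤ ∫ r in (0 : ℝ)..T, r * (‖g r‖ * ‖z r‖) := by
  have hz := H.continuousOn_z
  have hp := H.continuousOn_p
  have hc : ContinuousOn (fun t => h * ((p t).re * (z t).im - (p t).im * (z t).re)) (Ioi 0) := by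
    have h1 := Complex.continuous_re.comp_continuousOn hz
    have h2 := Complex.continuous_im.comp_continuousOn hz
    have h3 := Complex.continuous_re.comp_continuousOn hp
    have h4 := Complex.continuous_im.comp_continuousOn hp
    simp only [Function.comp_def] at h1 h2 h3 h4
    fun_prop
  have h0 : Filter.Tendsto (fun t => h * ((p t).re * (z t).im - (p t).im * (z t).re))
      (nhdsWithin 0 (Ioi 0)) (nhds 0) := by
    have : Filter.Tendsto (fun t => ((p t).re * (z t).im - (p t).im * (z t).re))
        (nhdsWithin 0 (Ioi 0)) (nhds 0) :=
      squeeze_zero_norm' (Filter.Eventually.of_forall fun r => abs_im_mul_le _ _)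
        H.tendsto_norm_mul_norm
    simpa using this.const_mul h
  have hZ := (H.intble_mass hT.le).const_mul ε
  have hY := H.intble_pairing hT.le
  have := integral_le_of_deriv_of_tendsto_zero hT hc h0
    (fun r hr => H.flux_deriv hh hr.1) (hZ.sub hY)
  rw [intervalIntegral.integral_sub hZ hY, intervalIntegral.integral_const_mul,
    H.z_zero T le_rfl] at this
  simp only [Complex.zero_re, Complex.zero_im, mul_zero, sub_zero] at this
  linarith

lemma integral_kinetic_le (H : RadialODE h m E ε Cv R T K V z p g) {Emax : ℝ} (hh : 0 < h)
    (hm : 0 ≤ m) (hE' : E ≤ Emax) (hε : 0 ≤ ε) (hT : 0 < T) :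
    ∫ r in (0 : ℝ)..T, ‖p r‖ ^ 2 / r ≤ (Cv + Emax) * (∫ r in (0 : ℝ)..T, r * ‖z r‖ ^ 2)
      + ∫ r in (0 : ℝ)..T, r * (‖g r‖ * ‖z r‖) := by
  have hZ := (H.intble_mass hT.le).const_mul (Cv + Emax)
  have hY := H.intble_pairing hT.le
  have hP := H.intble_kinetic hT.le
  have := integral_le_of_deriv_of_tendsto_zero hT
    (H.continuousOn_energy (continuousOn_const (c := 0)) (continuousOn_const (c := 1)))
    (H.energy_tendsto_zero hm _ _)
    (φ := fun r => (‖p r‖ ^ 2 / r - (Cv + Emax) * (r * ‖z r‖ ^ 2)) - r * (‖g r‖ * ‖z r‖))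
    (fun r hr => by
      obtain ⟨D, hD, hle⟩ := H.energy_deriv_ge hh hε hr.1 (hasDerivAt_const r (0 : ℝ))
        (hasDerivAt_const r (1 : ℝ)) le_rfl zero_le_one
      refine ⟨D, hD, ?_⟩
      have hr0 : 0 < r := hr.1
      rw [← mul_le_mul_iff_right₀ hr0]
      refine le_trans ?_ hle
      have hV := (abs_le.1 (H.norm_V r hr0)).1
      have h1 := mul_le_mul_of_nonneg_left (by linarith : -(Cv + Emax) ≤ V r - E)
        (by positivity : 0 ≤ r ^ 2 * ‖z r‖ ^ 2)
      have h2 : 0 ≤ m * ‖z r‖ ^ 2 := by positivity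
      have e : r * ((‖p r‖ ^ 2 / r - (Cv + Emax) * (r * ‖z r‖ ^ 2)) - r * (‖g r‖ * ‖z r‖)) =
        ‖p r‖ ^ 2 - (Cv + Emax) * (r ^ 2 * ‖z r‖ ^ 2) - r ^ 2 * (‖g r‖ * ‖z r‖) := by
        field_simp
      rw [e]
      simp only [mul_zero, abs_zero, zero_mul, zero_add, sub_zero, zero_div]
      linarith)
    ((hP.sub hZ).sub hY)
  rw [intervalIntegral.integral_sub (hP.sub hZ) hY, intervalIntegral.integral_sub hP hZ,
    intervalIntegral.integral_const_mul] at this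
  have e : energy h m E z p (fun _ => 0) (fun _ => 1) T = 0 := by
    simp [energy, H.z_zero T le_rfl]
  rw [e] at this
  linarith

lemma integral_pairing_le (H : RadialODE h m E ε Cv R T K V z p g) {s τ : ℝ} (hs : 0 < s)
    (hτ : 0 < τ) (hT : 0 ≤ T) :
    ∫ r in (0 : ℝ)..T, r * (‖g r‖ * ‖z r‖) ≤
      τ * (∫ r in (0 : ℝ)..T, r * ‖z r‖ ^ 2 / (1 + r ^ 2) ^ s)
      + 1 / (4 * τ) * ∫ r in (0 : ℝ)..T, r * (1 + r ^ 2) ^ s * ‖g r‖ ^ 2 := by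
  have hZ := (H.intble_weighted_mass hT hs).const_mul τ
  have hN := (H.intble_source hT hs).const_mul (1 / (4 * τ))
  rw [← intervalIntegral.integral_const_mul, ← intervalIntegral.integral_const_mul,
    ← intervalIntegral.integral_add hZ hN]
  refine intervalIntegral.integral_mono_on hT (H.intble_pairing hT) (hZ.add hN) fun r hr => ?_
  have hr0 := hr.1
  have hW : 0 < (1 + r ^ 2) ^ s := by positivity
  have := mul_le_mul_of_nonneg_left (young_ineq hτ (‖z r‖ / (1 + r ^ 2) ^ s) ‖g r‖)
    (mul_nonneg hr0 hW.le)
  calc r * (‖g r‖ * ‖z r‖) = r * (1 + r ^ 2) ^ s * (‖z r‖ / (1 + r ^ 2) ^ s * ‖g r‖) := by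
        field_simp
    _ ≤ _ := this
    _ = _ := by field_simp

lemma exists_weighted_mass_le_of_large {Emin Emax s Cv R : ℝ} (hEm : 0 < Emin)
    (hs1 : 1 / 2 < s) (hs2 : s ≤ 1) (hR : 1 ≤ R) :
    ∃ C > 0, ∀ {h m E ε T K : ℝ} {V : ℝ → ℝ} {z p g : ℝ → ℂ},
      RadialODE h m E ε Cv R T K V z p g → 0 < h → h ≤ 1 → 4 * R ^ 2 * Cv ≤ m →
      R ^ 2 * (Real.exp 2 * Emax) ≤ m → Emin ≤ E → E ≤ Emax →
      4 * h ^ 2 ≤ (2 * s - 1) ^ 2 * Emin → 0 ≤ ε → 0 ≤ T →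
      ∫ r in (0 : ℝ)..T, r * ‖z r‖ ^ 2 / (1 + r ^ 2) ^ s ≤ Real.exp (C / h) *
        ((∫ r in (0 : ℝ)..T, r * (1 + r ^ 2) ^ s * ‖g r‖ ^ 2) +
        ε * ∫ r in (0 : ℝ)..T, (‖p r‖ ^ 2 / r + r * ‖z r‖ ^ 2)) := by
  have hs : 0 < s := by linarith
  have hs0 : 0 < 2 * s - 1 := by linarith
  obtain ⟨c, hc⟩ : ∃ c, c = (2 * s - 1) / 32 * Emin := ⟨_, rfl⟩
  have hc0 : 0 < c := by rw [hc]; positivity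
  obtain ⟨K0, hK0⟩ : ∃ K0, K0 = (32 + 40 / Emin) / (2 * s - 1) + 4 := ⟨_, rfl⟩
  have hK0p : 0 < K0 := by rw [hK0]; positivity
  refine ⟨2 + K0 / c, by positivity, ?_⟩
  intro h m E ε T K V z p g H hh hh1 hm1 hm2 hE hE' hhE hε hT
  have i := H.integral_balance_nonpos hh hh1 hT hR hEm hE hE' hs1 hs2 hhE hε hm1 hm2
  have hZ := H.intble_weighted_mass hT hs
  have hN := H.intble_source hT hs
  have hP := (H.intble_kinetic hT).add (H.intble_mass hT)
  unfold balance at i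
  rw [intervalIntegral.integral_sub ((hZ.const_mul _).sub (hN.const_mul _))
      ((hP.const_mul _).const_mul _),
      intervalIntegral.integral_sub (hZ.const_mul _) (hN.const_mul _)] at i
  simp only [intervalIntegral.integral_const_mul] at i
  rw [← hc] at i
  have hN0 : 0 ≤ ∫ r in (0 : ℝ)..T, r * (1 + r ^ 2) ^ s * ‖g r‖ ^ 2 :=
    intervalIntegral.integral_nonneg hT fun t ht => by have := ht.1; positivity
  have hP0 : 0 ≤ ε * ∫ r in (0 : ℝ)..T, (‖p r‖ ^ 2 / r + r * ‖z r‖ ^ 2) :=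
    mul_nonneg hε (intervalIntegral.integral_nonneg hT fun t ht => by have := ht.1; positivity)
  set N2 := ∫ r in (0 : ℝ)..T, r * (1 + r ^ 2) ^ s * ‖g r‖ ^ 2
  set J := ε * ∫ r in (0 : ℝ)..T, (‖p r‖ ^ 2 / r + r * ‖z r‖ ^ 2)
  set Z2 := ∫ r in (0 : ℝ)..T, r * ‖z r‖ ^ 2 / (1 + r ^ 2) ^ s
  have h1 : (32 + 40 / Emin) / (2 * s - 1) / h ^ 2 ≤ K0 / h ^ 2 := by
    rw [hK0]; gcongr; linarith
  have h2 : 4 / h ≤ K0 / h ^ 2 := by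
    have e1 : 4 / h ≤ 4 / h ^ 2 := by gcongr; nlinarith
    have e2 : 0 ≤ (32 + 40 / Emin) / (2 * s - 1) / h ^ 2 := by positivity
    rw [hK0, add_div]; linarith
  have h3 := mul_le_mul_of_nonneg_right h1 hN0
  have h4 := mul_le_mul_of_nonneg_right h2 hP0
  have h5 : Z2 ≤ K0 / h ^ 2 * (N2 + J) / c := by
    rw [le_div_iff₀ hc0]; linarith
  refine h5.trans ?_
  have h6 : 1 / h ≤ Real.exp (1 / h) := by
    have := Real.add_one_le_exp (1 / h)
    linarith
  have h7 : 1 / h ^ 2 ≤ Real.exp (2 / h) := by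
    have : Real.exp (2 / h) = Real.exp (1 / h) ^ 2 := by
      rw [← Real.exp_nat_mul]; congr 1; push_cast; ring
    rw [this, ← one_div_pow]
    gcongr
  have h8 := le_exp_div hh hh1 (by positivity : 0 ≤ K0 / c)
  have h9 : Real.exp ((2 + K0 / c) / h) = Real.exp (2 / h) * Real.exp (K0 / c / h) := by
    rw [← Real.exp_add]; congr 1; ring
  calc K0 / h ^ 2 * (N2 + J) / c = (1 / h ^ 2) * (K0 / c) * (N2 + J) := by ring
    _ ≤ _ := by rw [h9]; gcongr

/-- The radial weighted estimate, uniform in the angular momentum `m` and the absorption `ε`. -/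
theorem exists_weighted_mass_le {Emin Emax s Cv R : ℝ} (hEm : 0 < Emin) (hEE : Emin ≤ Emax)
    (hs1 : 1 / 2 < s) (hs2 : s ≤ 1) (hCv : 0 ≤ Cv) (hR : 1 ≤ R) :
    ∃ C > 0, ∃ h₀ > 0, ∃ a > 0, ∀ {h m E ε T K : ℝ} {V : ℝ → ℝ} {z p g : ℝ → ℂ},
      RadialODE h m E ε Cv R T K V z p g → 0 < h → h ≤ h₀ → 0 ≤ m → Emin ≤ E → E ≤ Emax →
      0 < ε → a ≤ T →
      ∫ r in (0 : ℝ)..T, r * ‖z r‖ ^ 2 / (1 + r ^ 2) ^ s ≤ Real.exp (C / h) *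
        ∫ r in (0 : ℝ)..T, r * (1 + r ^ 2) ^ s * ‖g r‖ ^ 2 := by
  have hs : 0 < s := by linarith
  have hs0 : 0 < 2 * s - 1 := by linarith
  have hEM : 0 < Emax := by linarith
  obtain ⟨M, hM1, hM2⟩ : ∃ M : ℝ, 4 * R ^ 2 * Cv ≤ M ∧ R ^ 2 * (Real.exp 2 * Emax) ≤ M :=
    ⟨max _ _, le_max_left _ _, le_max_right _ _⟩
  have hM0 : 0 ≤ M := le_trans (by positivity) hM1
  obtain ⟨C₁, hC₁, large⟩ := exists_weighted_mass_le_of_large (Cv := Cv) (Emax := Emax) hEm hs1 hs2 hR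
  obtain ⟨C₂, hC₂, a, ha, small⟩ :=
    exists_weighted_mass_le_of_small (R := R) hEm hEE hs1 hs2 hCv hM0
  obtain ⟨C, hC⟩ : ∃ C, C = C₁ + C₂ := ⟨_, rfl⟩
  have hC0 : 0 < C := by rw [hC]; positivity
  obtain ⟨L, hL⟩ : ∃ L, L = Cv + Emax + 2 := ⟨_, rfl⟩
  have hL0 : 0 < L := by rw [hL]; positivity
  obtain ⟨h₀, hh₀, hh₀1, hh₀E⟩ : ∃ h₀ > 0, h₀ ≤ 1 ∧ 4 * h₀ ^ 2 ≤ (2 * s - 1) ^ 2 * Emin := by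
    refine ⟨min 1 ((2 * s - 1) * Real.sqrt Emin / 2), by positivity, min_le_left _ _, ?_⟩
    have h1 : (min 1 ((2 * s - 1) * Real.sqrt Emin / 2)) ^ 2 ≤ ((2 * s - 1) * Real.sqrt Emin / 2) ^ 2 := by
      gcongr; exact min_le_right _ _
    rw [div_pow, mul_pow, Real.sq_sqrt hEm.le] at h1
    linarith
  refine ⟨2 * C + (2 + L ^ 2), by positivity, h₀, hh₀, a, ha, ?_⟩
  intro h m E ε T K V z p g H hh hhh hm hE hE' hε haT
  have hh1 : h ≤ 1 := hhh.trans hh₀1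
  have hhE : 4 * h ^ 2 ≤ (2 * s - 1) ^ 2 * Emin := le_trans (by gcongr) hh₀E
  have hT : 0 < T := ha.trans_le haT
  have habs := H.integral_absorption_le hh hT
  have hkin := H.integral_kinetic_le hh hm hE' hε.le hT
  have hZle : ∫ r in (0 : ℝ)..T, r * ‖z r‖ ^ 2 / (1 + r ^ 2) ^ s ≤ ∫ r in (0 : ℝ)..T, r * ‖z r‖ ^ 2 :=
    intervalIntegral.integral_mono_on hT.le (H.intble_weighted_mass hT.le hs) (H.intble_mass hT.le)
      fun r hr => div_le_self (by have := hr.1; positivity) (one_le_weight r hs)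
  have hpair := fun τ hτ => H.integral_pairing_le (τ := τ) hs hτ hT.le
  have hN0 : 0 ≤ ∫ r in (0 : ℝ)..T, r * (1 + r ^ 2) ^ s * ‖g r‖ ^ 2 :=
    intervalIntegral.integral_nonneg hT.le fun t ht => by have := ht.1; positivity
  have hm0 : 0 ≤ ∫ r in (0 : ℝ)..T, r * ‖z r‖ ^ 2 :=
    intervalIntegral.integral_nonneg hT.le fun t ht => by have := ht.1; positivity
  have hmain : ε ≤ 1 → ∫ r in (0 : ℝ)..T, r * ‖z r‖ ^ 2 / (1 + r ^ 2) ^ s ≤ Real.exp (C / h) *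
        ((∫ r in (0 : ℝ)..T, r * (1 + r ^ 2) ^ s * ‖g r‖ ^ 2) +
        ε * ∫ r in (0 : ℝ)..T, (‖p r‖ ^ 2 / r + r * ‖z r‖ ^ 2)) := by
    intro hε1
    have hP0 : 0 ≤ ε * ∫ r in (0 : ℝ)..T, (‖p r‖ ^ 2 / r + r * ‖z r‖ ^ 2) :=
      mul_nonneg hε.le
        (intervalIntegral.integral_nonneg hT.le fun t ht => by have := ht.1; positivity)
    rcases le_total m M with hmM | hMm
    · refine (small H hh hh1 hm hmM hE hE' hhE hε.le hε1 haT).trans ?_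
      gcongr
      rw [hC]; linarith
    · refine (large H hh hh1 (hM1.trans hMm) (hM2.trans hMm) hE hE' hhE hε.le hT.le).trans ?_
      gcongr
      rw [hC]; linarith
  rw [intervalIntegral.integral_add (H.intble_kinetic hT.le) (H.intble_mass hT.le)] at hmain
  generalize (∫ r in (0 : ℝ)..T, r * (1 + r ^ 2) ^ s * ‖g r‖ ^ 2) = N2 at *
  generalize (∫ r in (0 : ℝ)..T, r * ‖z r‖ ^ 2 / (1 + r ^ 2) ^ s) = Z2 at *
  generalize (∫ r in (0 : ℝ)..T, r * ‖z r‖ ^ 2) = M2 at *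
  generalize (∫ r in (0 : ℝ)..T, ‖p r‖ ^ 2 / r) = P2 at *
  generalize (∫ r in (0 : ℝ)..T, r * (‖g r‖ * ‖z r‖)) = Y at *
  rcases le_total ε 1 with hε1 | hε1
  · have hZ := hmain hε1
    obtain ⟨Λ, hΛ⟩ : ∃ Λ, Λ = Real.exp (C / h) := ⟨_, rfl⟩
    have hΛ1 : 1 ≤ Λ := by rw [hΛ]; exact Real.one_le_exp (by positivity)
    have hΛ0 : 0 < Λ := by linarith
    rw [← hΛ] at hZ
    have hY0 : 0 ≤ Y := le_trans (by positivity) habs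
    have hJ : ε * (P2 + M2) ≤ L * Y := by
      have h1 := mul_le_mul_of_nonneg_left hkin hε.le
      have h2 := mul_le_mul_of_nonneg_left habs (by positivity : 0 ≤ Cv + Emax)
      have h3 : ε * Y ≤ 1 * Y := by gcongr
      rw [hL]
      linarith
    have h4 := hpair (1 / (2 * L * Λ)) (by positivity)
    have e : 1 / (4 * (1 / (2 * L * Λ))) = L * Λ / 2 := by field_simp; norm_num
    rw [e] at h4
    have h5 := mul_le_mul_of_nonneg_left h4 (by positivity : 0 ≤ Λ * L)
    have e2 : Λ * L * (1 / (2 * L * Λ) * Z2 + L * Λ / 2 * N2) =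
      Z2 / 2 + L ^ 2 * Λ ^ 2 / 2 * N2 := by field_simp
    rw [e2] at h5
    have h6 := mul_le_mul_of_nonneg_left hJ hΛ0.le
    have h7 : Z2 ≤ (2 * Λ + L ^ 2 * Λ ^ 2) * N2 := by linarith
    have h8 : 2 * Λ + L ^ 2 * Λ ^ 2 ≤ (2 + L ^ 2) * Λ ^ 2 := by nlinarith
    have h9 := le_exp_div hh hh1 (by positivity : 0 ≤ 2 + L ^ 2)
    have h10 : Real.exp ((2 * C + (2 + L ^ 2)) / h) = Real.exp ((2 + L ^ 2) / h) * Λ ^ 2 := by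
      rw [hΛ, ← Real.exp_nat_mul, ← Real.exp_add]; congr 1; push_cast; ring
    rw [h10]
    calc Z2 ≤ (2 * Λ + L ^ 2 * Λ ^ 2) * N2 := h7
      _ ≤ ((2 + L ^ 2) * Λ ^ 2) * N2 := by gcongr
      _ ≤ _ := by gcongr
  · have h4 := hpair (1 / 2) (by norm_num)
    norm_num at h4
    have h5 : M2 ≤ ε * M2 := le_mul_of_one_le_left hm0 hε1
    have h6 : Z2 ≤ N2 := by linarith
    refine h6.trans (le_mul_of_one_le_left hN0 ?_)
    exact Real.one_le_exp (by positivity)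

end RadialODE

/-- The coefficients of a smooth function along a spherical harmonic of eigenvalue `lam` solve,
after the substitution `z = r ^ k v`, `k = (n - 2) / 2`, a radial system. -/
theorem RadialODE.of_coefficient {n : ℕ} (hn : 2 ≤ n) {lam h E ε Cv R T : ℝ} (hlam : 0 ≤ lam)
    (hh : 0 < h) (hT : 1 ≤ T) {V : ℝ → ℝ} (hV : Measurable V) (hCv : ∀ r > 0, |V r| ≤ Cv)
    (hVz : ∀ r > R, V r = 0) {v v1 v2 w : ℝ → ℂ}
    (hv : ∀ r, HasDerivAt v (v1 r) r) (hv1 : ∀ r, HasDerivAt v1 (v2 r) r)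
    (hv2 : Continuous v2) (hw : Continuous w)
    (hode : ∀ r : ℝ, (r : ℂ) ^ 2 * w r = (r : ℂ) ^ 2 * v2 r + ((n : ℂ) - 1) * r * v1 r - lam * v r)
    (hvT : ∀ r ≥ T, v r = 0) (hv1T : ∀ r ≥ T, v1 r = 0) (hwT : ∀ r ≥ T, w r = 0) :
    ∃ K, RadialODE h (h ^ 2 * (lam + (((n : ℝ) - 2) / 2) ^ 2)) E ε Cv R T K V
      (fun r => ((r ^ (((n : ℝ) - 2) / 2) : ℝ) : ℂ) * v r)
      (fun r => (h : ℂ) * ((r ^ (((n : ℝ) - 2) / 2) : ℝ) : ℂ) *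
        (r * v1 r + ((((n : ℝ) - 2) / 2 : ℝ) : ℂ) * v r))
      (fun r => ((r ^ (((n : ℝ) - 2) / 2) : ℝ) : ℂ) *
        (-(h : ℂ) ^ 2 * w r + (V r : ℂ) * v r - ((E : ℂ) + ε * Complex.I) * v r)) := by
  have hcv : Continuous v := continuous_iff_continuousAt.2 fun r => (hv r).continuousAt
  have hcv1 : Continuous v1 := continuous_iff_continuousAt.2 fun r => (hv1 r).continuousAt
  obtain ⟨B, hB0, hBv, hBv1, hBv2, hBw⟩ : ∃ B : ℝ, 0 ≤ B ∧ (∀ r > 0, r < T → ‖v r‖ ≤ B) ∧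
      (∀ r > 0, r < T → ‖v1 r‖ ≤ B) ∧ (∀ r > 0, r < T → ‖v2 r‖ ≤ B) ∧
      (∀ r > 0, r < T → ‖w r‖ ≤ B) := by
    obtain ⟨B, hB⟩ := (isCompact_Icc (a := (0 : ℝ)) (b := T)).exists_bound_of_continuousOn
      (f := fun r => ‖v r‖ + ‖v1 r‖ + ‖v2 r‖ + ‖w r‖)
      (by fun_prop : Continuous fun r => ‖v r‖ + ‖v1 r‖ + ‖v2 r‖ + ‖w r‖).continuousOn
    have key : ∀ r > 0, r < T → ‖v r‖ + ‖v1 r‖ + ‖v2 r‖ + ‖w r‖ ≤ B := fun r h0 h1 =>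
      (le_abs_self _).trans (hB r ⟨h0.le, h1.le⟩)
    refine ⟨B, ?_, ?_, ?_, ?_, ?_⟩
    · exact (norm_nonneg _).trans (hB 0 ⟨le_rfl, by linarith⟩)
    all_goals
      intro r h0 h1
      have := key r h0 h1
      have := norm_nonneg (v r)
      have := norm_nonneg (v1 r)
      have := norm_nonneg (v2 r)
      have := norm_nonneg (w r)
      linarith
  have hn2 : (2 : ℝ) ≤ n := by exact_mod_cast hn
  obtain ⟨k, hk⟩ : ∃ k : ℝ, k = ((n : ℝ) - 2) / 2 := ⟨_, rfl⟩
  have hnk : (n : ℝ) = 2 * k + 2 := by rw [hk]; ring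
  have hnkc : (n : ℂ) = 2 * k + 2 := by exact_mod_cast congrArg (fun x : ℝ => (x : ℂ)) hnk
  have hk0 : 0 ≤ k := by rw [hk]; linarith
  have hk' : k = 0 ∨ 1 / 2 ≤ k := by
    rcases hn.eq_or_lt with h2 | h2
    · left; rw [hk, ← h2]; norm_num
    · right
      have : (3 : ℝ) ≤ n := by exact_mod_cast h2
      rw [hk]; linarith
  rw [← hk]
  have hT0 : 0 < T := by linarith
  have hrk : ∀ r > 0, r < T → r ^ k ≤ T ^ k := fun r h0 h1 =>
    Real.rpow_le_rpow h0.le h1.le hk0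
  have hTk : 1 ≤ T ^ k := Real.one_le_rpow hT hk0
  have hrkn : ∀ r > 0, ‖((r ^ k : ℝ) : ℂ)‖ = r ^ k := fun r h0 => by
    rw [Complex.norm_real, Real.norm_of_nonneg (Real.rpow_nonneg h0.le _)]
  have hr2k : 1 / 2 ≤ k → ∀ r > 0, r < T → (r ^ k) ^ 2 ≤ r * (T ^ k) ^ 2 := by
    intro h2 r h0 h1
    rw [← Real.rpow_mul_natCast h0.le, ← Real.rpow_mul_natCast hT0.le]
    have e : r ^ (k * (2 : ℕ)) = r * r ^ (2 * k - 1) := by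
      rw [← Real.rpow_one_add' h0.le (by linarith)]
      congr 1; push_cast; ring
    rw [e]
    apply mul_le_mul_of_nonneg_left _ h0.le
    calc r ^ (2 * k - 1) ≤ T ^ (2 * k - 1) := Real.rpow_le_rpow h0.le h1.le (by linarith)
      _ ≤ T ^ (k * (2 : ℕ)) := Real.rpow_le_rpow_of_exponent_le hT (by push_cast; linarith)
  have hCv0 : 0 ≤ Cv := (abs_nonneg _).trans (hCv 1 one_pos)
  -- the four bounds
  have bz : ∀ r > 0, ‖((r ^ k : ℝ) : ℂ) * v r‖ ≤ T ^ k * B := by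
    intro r h0
    rcases lt_or_ge r T with h1 | h1
    · rw [norm_mul, hrkn r h0]
      exact mul_le_mul (hrk r h0 h1) (hBv r h0 h1) (norm_nonneg _) (by positivity)
    · rw [hvT r h1]; simp; positivity
  have bp : ∃ K₁, 0 ≤ K₁ ∧ ∀ r > 0, ‖(h : ℂ) * ((r ^ k : ℝ) : ℂ) *
        (r * v1 r + (k : ℂ) * v r)‖ ^ 2 ≤ K₁ * r := by
    refine ⟨h ^ 2 * (T ^ k) ^ 2 * (T * B + k * B) ^ 2 * T, by positivity, fun r h0 => ?_⟩
    rcases lt_or_ge r T with h1 | h1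
    · rw [norm_mul, norm_mul, hrkn r h0, mul_pow, mul_pow, Complex.norm_real, Real.norm_of_nonneg hh.le]
      have h2 : ‖(r : ℂ) * v1 r + (k : ℂ) * v r‖ ≤ r * B + k * B := by
        refine (norm_add_le _ _).trans ?_
        rw [norm_mul, norm_mul, Complex.norm_real, Complex.norm_real, Real.norm_of_nonneg h0.le,
          Real.norm_of_nonneg hk0]
        exact add_le_add (mul_le_mul_of_nonneg_left (hBv1 r h0 h1) h0.le)
          (mul_le_mul_of_nonneg_left (hBv r h0 h1) hk0)
      rcases hk' with hz | hz
      · subst hz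
        simp only [Real.rpow_zero, zero_mul, add_zero, one_pow, mul_one] at h2 ⊢
        calc h ^ 2 * ‖(r : ℂ) * v1 r + ((0 : ℝ) : ℂ) * v r‖ ^ 2 ≤ h ^ 2 * (r * B) ^ 2 := by gcongr
          _ = h ^ 2 * (r * (r * B ^ 2)) := by ring
          _ ≤ h ^ 2 * (T ^ 3 * (r * B ^ 2)) := by
              gcongr
              nlinarith [mul_nonneg (sub_nonneg.2 hT) (sub_nonneg.2 hT), pow_le_pow_right₀ hT (show 1 ≤ 3 by norm_num)]
          _ = _ := by ring
      · calc _ ≤ h ^ 2 * (r * (T ^ k) ^ 2) * (T * B + k * B) ^ 2 := by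
              gcongr
              · exact hr2k hz r h0 h1
              · refine h2.trans ?_
                gcongr
          _ ≤ h ^ 2 * (r * (T ^ k) ^ 2) * (T * B + k * B) ^ 2 * T := by
              exact le_mul_of_one_le_right (by positivity) hT
          _ = _ := by ring
    · rw [hvT r h1, hv1T r h1]; simp; positivity
  have bm : ∃ K₂, 0 ≤ K₂ ∧ ∀ r > 0, h ^ 2 * (lam + k ^ 2) * ‖((r ^ k : ℝ) : ℂ) * v r‖ ^ 2
      ≤ K₂ * r := by
    refine ⟨h ^ 2 * (lam + k ^ 2) * (T ^ k) ^ 2 * B ^ 2 + h ^ 2 * (2 * T * B + B) * B,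
      by positivity, fun r h0 => ?_⟩
    rcases lt_or_ge r T with h1 | h1
    · rw [norm_mul, hrkn r h0, mul_pow]
      rcases hk' with hz | hz
      · subst hz
        have h3 : lam * ‖v r‖ ≤ r * (2 * T * B + B) := by
          have e : (lam : ℂ) * v r = (r : ℂ) * ((r : ℂ) * v2 r + v1 r - (r : ℂ) * w r) := by
            have := hode r
            rw [hnkc] at this
            push_cast at this
            linear_combination this
          have e2 : lam * ‖v r‖ = ‖(lam : ℂ) * v r‖ := by
            rw [norm_mul, Complex.norm_real, Real.norm_of_nonneg hlam]
          rw [e2, e, norm_mul, Complex.norm_real, Real.norm_of_nonneg h0.le]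
          apply mul_le_mul_of_nonneg_left _ h0.le
          refine (norm_sub_le _ _).trans ((add_le_add_left (norm_add_le _ _) _).trans ?_)
          rw [norm_mul, norm_mul, Complex.norm_real, Real.norm_of_nonneg h0.le]
          have a1 := mul_le_mul h1.le (hBv2 r h0 h1) (norm_nonneg _) hT0.le
          have a2 := mul_le_mul h1.le (hBw r h0 h1) (norm_nonneg _) hT0.le
          have a3 := hBv1 r h0 h1
          linarith
        simp only [Real.rpow_zero, one_pow, one_mul, mul_one, ne_eq, OfNat.ofNat_ne_zero,
          not_false_eq_true, zero_pow, add_zero]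
        calc h ^ 2 * lam * ‖v r‖ ^ 2 = h ^ 2 * ((lam * ‖v r‖) * ‖v r‖) := by ring
          _ ≤ h ^ 2 * ((r * (2 * T * B + B)) * B) := by
              gcongr
              exact hBv r h0 h1
          _ = (h ^ 2 * (2 * T * B + B) * B) * r := by ring
          _ ≤ _ := by
              gcongr
              have : 0 ≤ h ^ 2 * lam * B ^ 2 := by positivity
              linarith
      · calc _ ≤ h ^ 2 * (lam + k ^ 2) * ((r * (T ^ k) ^ 2) * B ^ 2) := by
              gcongr
              · exact hr2k hz r h0 h1
              · exact hBv r h0 h1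
          _ = (h ^ 2 * (lam + k ^ 2) * (T ^ k) ^ 2 * B ^ 2) * r := by ring
          _ ≤ _ := by
              gcongr
              have : 0 ≤ h ^ 2 * (2 * T * B + B) * B := by positivity
              linarith
    · rw [hvT r h1]; simp; positivity
  have bg : ∃ K₃, 0 ≤ K₃ ∧ ∀ r > 0, ‖((r ^ k : ℝ) : ℂ) *
        (-(h : ℂ) ^ 2 * w r + (V r : ℂ) * v r - ((E : ℂ) + ε * Complex.I) * v r)‖ ≤ K₃ := by
    refine ⟨T ^ k * (h ^ 2 * B + Cv * B + ‖(E : ℂ) + ε * Complex.I‖ * B), by positivity,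
      fun r h0 => ?_⟩
    rcases lt_or_ge r T with h1 | h1
    · rw [norm_mul, hrkn r h0]
      apply mul_le_mul (hrk r h0 h1) _ (norm_nonneg _) (by positivity)
      refine (norm_sub_le _ _).trans (add_le_add ((norm_add_le _ _).trans (add_le_add ?_ ?_)) ?_)
      · rw [norm_mul, norm_neg, norm_pow, Complex.norm_real, Real.norm_of_nonneg hh.le]
        exact mul_le_mul_of_nonneg_left (hBw r h0 h1) (by positivity)
      · rw [norm_mul, Complex.norm_real]
        exact mul_le_mul (hCv r h0) (hBv r h0 h1) (norm_nonneg _) hCv0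
      · rw [norm_mul]
        exact mul_le_mul_of_nonneg_left (hBv r h0 h1) (by positivity)
    · rw [hvT r h1, hwT r h1]; simp; positivity
  obtain ⟨K₁, hK₁, bp⟩ := bp
  obtain ⟨K₂, hK₂, bm⟩ := bm
  obtain ⟨K₃, hK₃, bg⟩ := bg
  have hK₀ : 0 ≤ T ^ k * B := by positivity
  have hmk : Measurable fun r : ℝ => ((r ^ k : ℝ) : ℂ) :=
    Complex.measurable_ofReal.comp (measurable_id.pow_const k)
  have hmV : Measurable fun r : ℝ => (V r : ℂ) := Complex.measurable_ofReal.comp hV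
  have hdk : ∀ r > 0, HasDerivAt (fun r : ℝ => ((r ^ k : ℝ) : ℂ)) ((k * r ^ k / r : ℝ) : ℂ) r := by
    intro r h0
    have := (Real.hasDerivAt_rpow_const (x := r) (p := k) (Or.inl h0.ne')).ofReal_comp
    rw [Real.rpow_sub_one h0.ne'] at this
    convert this using 2
    ring
  refine ⟨T ^ k * B + K₁ + K₂ + K₃, ?_, ?_, ?_, ?_, ?_, ?_, ?_, ?_, ?_, ?_, ?_, ?_, ?_, ?_⟩
  · intro r h0
    have hr : (r : ℂ) ≠ 0 := by exact_mod_cast h0.ne'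
    have hhc : (h : ℂ) ≠ 0 := by exact_mod_cast hh.ne'
    refine HasDerivAt.congr_deriv ((hdk r h0).mul (hv r)) ?_
    push_cast
    field_simp
    ring
  · intro r h0
    have hr : (r : ℂ) ≠ 0 := by exact_mod_cast h0.ne'
    have hhc : (h : ℂ) ≠ 0 := by exact_mod_cast hh.ne'
    have d1 : HasDerivAt (fun r : ℝ => (r : ℂ) * v1 r + (k : ℂ) * v r)
        (1 * v1 r + (r : ℂ) * v2 r + (k : ℂ) * v1 r) r :=
      ((hasDerivAt_id r).ofReal_comp.mul (hv1 r)).add ((hv r).const_mul _)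
    refine HasDerivAt.congr_deriv (((hdk r h0).const_mul (h : ℂ)).mul d1) ?_
    have := hode r
    rw [hnkc] at this
    push_cast
    field_simp
    linear_combination -(h : ℂ) ^ 2 * ((r ^ k : ℝ) : ℂ) * this
  · exact hmk.mul hcv.measurable
  · exact (measurable_const.mul hmk).mul (by fun_prop)
  · exact hmk.mul ((((by fun_prop : Measurable fun r => -(h : ℂ) ^ 2 * w r)).add
      (hmV.mul hcv.measurable)).sub (by fun_prop))
  · intro r h0
    linarith [bz r h0]
  · intro r h0
    refine (bp r h0).trans (mul_le_mul_of_nonneg_right ?_ h0.le)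
    linarith
  · intro r h0
    refine (bm r h0).trans (mul_le_mul_of_nonneg_right ?_ h0.le)
    linarith
  · intro r h0
    linarith [bg r h0]
  · intro r h1; simp [hvT r h1]
  · intro r h1; simp [hvT r h1, hv1T r h1]
  · intro r h1; simp [hvT r h1, hwT r h1]
  · exact hCv
  · exact hVz

/-- Euclidean `n`-space. -/
abbrev Euc (n : ℕ) := EuclideanSpace ℝ (Fin n)

/-- The unit sphere of Euclidean `n`-space. -/
abbrev Sph (n : ℕ) := Metric.sphere (0 : Euc n) 1

/-- The surface measure of the unit sphere. -/
noncomputable abbrev surf (n : ℕ) : Measure (Sph n) := (volume : Measure (Euc n)).toSphere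

theorem lintegral_polar {n : ℕ} (hn : n ≠ 0) {G : Euc n → ENNReal} (hG : Measurable G) :
    ∫⁻ x, G x = ∫⁻ r in Ioi (0 : ℝ), ENNReal.ofReal (r ^ (n - 1)) *
      ∫⁻ θ : Sph n, G (r • (θ : Euc n)) ∂surf n := by
  have : Nonempty (Fin n) := ⟨⟨0, Nat.pos_of_ne_zero hn⟩⟩
  have hmp := (volume : Measure (Euc n)).measurePreserving_homeomorphUnitSphereProd
  have hemb := (homeomorphUnitSphereProd (Euc n)).measurableEmbedding
  have hGm : Measurable fun q : Sph n × Ioi (0 : ℝ) => G ((q.2 : ℝ) • (q.1 : Euc n)) :=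
    hG.comp (by fun_prop)
  have e1 : ∫⁻ x, G x = ∫⁻ x : ({0}ᶜ : Set (Euc n)), G x ∂(volume.comap Subtype.val) := by
    rw [lintegral_subtype_comap (measurableSet_singleton _).compl, restrict_compl_singleton]
  have e2 := hmp.lintegral_comp_emb hemb fun q => G ((q.2 : ℝ) • (q.1 : Euc n))
  rw [e1]
  have e3 : ∀ x : ({0}ᶜ : Set (Euc n)), G x = G (((homeomorphUnitSphereProd (Euc n) x).2 : ℝ) •
      ((homeomorphUnitSphereProd (Euc n) x).1 : Euc n)) := by
    intro x
    rw [← homeomorphUnitSphereProd_symm_apply_coe, Homeomorph.symm_apply_apply]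
  rw [lintegral_congr e3, e2, lintegral_prod_symm _ hGm.aemeasurable, finrank_euclideanSpace_fin,
    Measure.volumeIoiPow, lintegral_withDensity_eq_lintegral_mul _ (by fun_prop)
      hGm.lintegral_prod_left']
  exact lintegral_subtype_comap measurableSet_Ioi
    fun r : ℝ => ENNReal.ofReal (r ^ (n - 1)) * ∫⁻ θ : Sph n, G (r • (θ : Euc n)) ∂surf n

open scoped Pointwise in
theorem integral_sphere_comp_isometry {n : ℕ} (R : Euc n ≃ₗᵢ[ℝ] Euc n) {f : Euc n → ℂ}
    (hf : Continuous f) :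
    ∫ θ : Sph n, f (R θ) ∂surf n = ∫ θ : Sph n, f θ ∂surf n := by
  let ψ : Sph n → Sph n := fun θ => ⟨R θ, by simp⟩
  have hψ : Measurable ψ := by
    apply Measurable.subtype_mk
    exact R.continuous.measurable.comp measurable_subtype_coe
  have hmap : (surf n).map ψ = surf n := by
    ext s hs
    rw [Measure.map_apply hψ hs, Measure.toSphere_apply' _ (hψ hs), Measure.toSphere_apply' _ hs,
      ← R.measurePreserving.measure_preimage_equiv (f := R.toMeasurableEquiv)
        (Ioo (0 : ℝ) 1 • (((↑) : Sph n → Euc n) '' s))]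
    congr 2
    ext x
    simp only [Set.mem_smul, mem_preimage, mem_image]
    constructor
    · rintro ⟨t, ht, _, ⟨θ, hθ, rfl⟩, rfl⟩
      exact ⟨t, ht, R θ, ⟨ψ θ, hθ, rfl⟩, by simp⟩
    · rintro ⟨t, ht, _, ⟨θ, hθ, rfl⟩, hx⟩
      refine ⟨t, ht, R.symm θ, ⟨⟨R.symm θ, by simp⟩, ?_, rfl⟩, ?_⟩
      · simpa [ψ] using hθ
      · apply R.injective
        simpa using hx
  conv_rhs => rw [← hmap]
  rw [integral_map hψ.aemeasurable (by fun_prop)]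

/-- Differentiation under the integral sign over a compact space. -/
theorem hasDerivAt_integral_of_compact {X : Type*} [TopologicalSpace X] [CompactSpace X]
    [SecondCountableTopology X] [MeasurableSpace X] [BorelSpace X] {μ : Measure X}
    [IsFiniteMeasure μ] {F F' : ℝ → X → ℂ} (hF : ∀ t, Continuous (F t))
    (hF' : Continuous fun q : ℝ × X => F' q.1 q.2) (hd : ∀ t x, HasDerivAt (F · x) (F' t x) t)
    (t : ℝ) : HasDerivAt (fun t => ∫ x, F t x ∂μ) (∫ x, F' t x ∂μ) t := by
  obtain ⟨B, hB⟩ := ((isCompact_Icc (a := t - 1) (b := t + 1)).prod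
    (isCompact_univ (X := X))).exists_bound_of_continuousOn hF'.continuousOn
  refine (hasDerivAt_integral_of_dominated_loc_of_deriv_le (bound := fun _ => B)
    (Icc_mem_nhds (by linarith : t - 1 < t) (by linarith : t < t + 1))
    (.of_forall fun s => (hF s).aestronglyMeasurable)
    ((hF t).integrable_of_hasCompactSupport (HasCompactSupport.of_compactSpace _)) ?_ ?_
    (integrable_const _) (.of_forall fun x s _ => hd s x)).2
  · exact (hF'.comp (Continuous.prodMk_right t)).aestronglyMeasurable
  · exact .of_forall fun x s hs => hB (s, x) ⟨hs, mem_univ _⟩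

/-- The generator `x_i e_j - x_j e_i` of rotations. -/
noncomputable def rotGen {n : ℕ} (i j : Fin n) : Euc n →L[ℝ] Euc n :=
  (EuclideanSpace.proj i : Euc n →L[ℝ] ℝ).smulRight (EuclideanSpace.single j (1 : ℝ)) -
    (EuclideanSpace.proj j : Euc n →L[ℝ] ℝ).smulRight (EuclideanSpace.single i (1 : ℝ))

lemma rotGen_apply {n : ℕ} (i j : Fin n) (x : Euc n) :
    rotGen i j x = x i • EuclideanSpace.single j (1 : ℝ) - x j • EuclideanSpace.single i (1 : ℝ) := by
  simp [rotGen]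

lemma rotGen_comp_of_ne {n : ℕ} {i j : Fin n} (hij : i ≠ j) (x : Euc n) :
    rotGen i j (rotGen i j x) = -(x i • EuclideanSpace.single i (1 : ℝ)) - x j • EuclideanSpace.single j (1 : ℝ) := by
  simp [rotGen_apply, hij, hij.symm]
  ring_nf
  abel

/-- Rotation by the angle `t` in the coordinate plane `i, j`. -/
noncomputable def rot {n : ℕ} (i j : Fin n) (t : ℝ) : Euc n →ₗ[ℝ] Euc n :=
  LinearMap.id + (Real.sin t • (rotGen i j).toLinearMap -
    (Real.cos t - 1) • (rotGen i j ∘L rotGen i j).toLinearMap)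

lemma norm_rot {n : ℕ} {i j : Fin n} (hij : i ≠ j) (t : ℝ) (x : Euc n) :
    ‖rot i j t x‖ = ‖x‖ := by
  have e : rot i j t x = x + (((Real.cos t - 1) * x i - Real.sin t * x j) •
      EuclideanSpace.single i (1 : ℝ) + ((Real.cos t - 1) * x j + Real.sin t * x i) •
      EuclideanSpace.single j (1 : ℝ)) := by
    simp only [rot, LinearMap.add_apply, LinearMap.id_apply, LinearMap.sub_apply,
      LinearMap.smul_apply, ContinuousLinearMap.coe_coe, ContinuousLinearMap.comp_apply,
      rotGen_comp_of_ne hij]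
    rw [rotGen_apply]
    module
  have hs := Real.sin_sq_add_cos_sq t
  have : ‖rot i j t x‖ ^ 2 = ‖x‖ ^ 2 := by
    rw [e, norm_add_sq_real, norm_add_sq_real]
    simp only [inner_add_right, inner_smul_right, inner_smul_left, norm_smul,
      EuclideanSpace.inner_single_right, PiLp.norm_single, mul_pow]
    simp [hij.symm]
    linear_combination (x i ^ 2 + x j ^ 2) * hs
  exact (sq_eq_sq₀ (norm_nonneg _) (norm_nonneg _)).1 this

/-- Derivative along a rotation field. -/
noncomputable def angDeriv {n : ℕ} (i j : Fin n) (f : Euc n → ℂ) (x : Euc n) : ℂ :=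
  fderiv ℝ f x (rotGen i j x)

theorem integral_angDeriv {n : ℕ} (i j : Fin n) {f : Euc n → ℂ} (hf : ContDiff ℝ 1 f) :
    ∫ θ : Sph n, angDeriv i j f θ ∂surf n = 0 := by
  rcases eq_or_ne i j with rfl | hij
  · simp [angDeriv, rotGen]
  have hrot : ∀ x : Euc n, ∀ t, HasDerivAt (fun t => rot i j t x)
      (Real.cos t • rotGen i j x + Real.sin t • rotGen i j (rotGen i j x)) t := by
    intro x t
    refine (((Real.hasDerivAt_sin t).smul_const (rotGen i j x)).sub
      (((Real.hasDerivAt_cos t).sub_const 1).smul_const (rotGen i j (rotGen i j x)))).const_add x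
      |>.congr_deriv ?_
    module
  have hc : Continuous fun q : ℝ × Euc n => rot i j q.1 q.2 := by
    have : (fun q : ℝ × Euc n => rot i j q.1 q.2) = fun q => q.2 + (Real.sin q.1 •
      rotGen i j q.2 - (Real.cos q.1 - 1) • rotGen i j (rotGen i j q.2)) := rfl
    rw [this]
    fun_prop
  have hD : HasDerivAt (fun t => ∫ θ : Sph n, f (rot i j t θ) ∂surf n)
      (∫ θ : Sph n, fderiv ℝ f (rot i j 0 θ)
        (Real.cos 0 • rotGen i j θ + Real.sin 0 • rotGen i j (rotGen i j θ)) ∂surf n) 0 := by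
    have hc0 : Continuous fun q : ℝ × Sph n => rot i j q.1 q.2 := by
      have h2 : Continuous fun q : ℝ × Sph n => (q.1, (q.2 : Euc n)) := by fun_prop
      have h3 := hc.comp h2
      exact h3
    have hF : ∀ t, Continuous fun θ : Sph n => f (rot i j t θ) := fun t => by
      have h3 := hc0.comp (Continuous.prodMk_right t)
      have h4 := hf.continuous.comp h3
      exact h4
    have hc1 : Continuous fun q : ℝ × Sph n => fderiv ℝ f (rot i j q.1 q.2) := by
      have h4 := (hf.continuous_fderiv one_ne_zero).comp hc0
      exact h4
    have hc2 : Continuous fun q : ℝ × Sph n => Real.cos q.1 • rotGen i j q.2 +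
        Real.sin q.1 • rotGen i j (rotGen i j q.2) := by fun_prop
    exact hasDerivAt_integral_of_compact hF (F' := fun t (θ : Sph n) => fderiv ℝ f (rot i j t θ)
        (Real.cos t • rotGen i j θ + Real.sin t • rotGen i j (rotGen i j θ)))
      (hc1.clm_apply hc2) (fun t θ => ((hf.differentiable one_ne_zero _).hasFDerivAt).comp_hasDerivAt t (hrot θ t)) 0
  have hconst : (fun t => ∫ θ : Sph n, f (rot i j t θ) ∂surf n) =
      fun _ => ∫ θ : Sph n, f θ ∂surf n := by
    funext t
    exact integral_sphere_comp_isometry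
      (LinearIsometry.toLinearIsometryEquiv ⟨rot i j t, norm_rot hij t⟩ rfl) hf.continuous
  rw [hconst] at hD
  have := hD.unique (hasDerivAt_const _ _)
  simpa [angDeriv, rot] using this

theorem angDeriv_mul {n : ℕ} (i j : Fin n) {f g : Euc n → ℂ} (hf : Differentiable ℝ f)
    (hg : Differentiable ℝ g) :
    angDeriv i j (f * g) = angDeriv i j f * g + f * angDeriv i j g := by
  funext x
  simp only [angDeriv, fderiv_mul (hf x) (hg x), Pi.add_apply, Pi.mul_apply,
    add_apply, smul_apply, smul_eq_mul]
  ring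

theorem ContDiff.angDeriv {n : ℕ} (i j : Fin n) {f : Euc n → ℂ} {m k : ℕ∞} (hf : ContDiff ℝ m f)
    (hk : k + 1 ≤ m) : ContDiff ℝ k (angDeriv i j f) :=
  (hf.fderiv_right (by exact_mod_cast hk)).clm_apply (rotGen i j).contDiff

/-- Rotation fields are skew-symmetric on the sphere. -/
theorem integral_angDeriv_mul {n : ℕ} (i j : Fin n) {f g : Euc n → ℂ} (hf : ContDiff ℝ 1 f)
    (hg : ContDiff ℝ 1 g) : ∫ θ : Sph n, angDeriv i j f θ * g θ ∂surf n =
      -∫ θ : Sph n, f θ * angDeriv i j g θ ∂surf n := by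
  have h := integral_angDeriv i j (hf.mul hg)
  have e : angDeriv i j (fun x => f x * g x) = angDeriv i j f * g + f * angDeriv i j g :=
    angDeriv_mul i j (hf.differentiable one_ne_zero) (hg.differentiable one_ne_zero)
  have c1 := (hf.angDeriv (m := 1) (k := 0) i j (by simp)).continuous
  have c2 := (hg.angDeriv (m := 1) (k := 0) i j (by simp)).continuous
  have c3 := hf.continuous
  have c4 := hg.continuous
  rw [e] at h
  simp only [Pi.add_apply, Pi.mul_apply] at h
  rw [integral_add ((by fun_prop : Continuous fun θ : Sph n => _).integrable_of_hasCompactSupport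
      (HasCompactSupport.of_compactSpace _))
    ((by fun_prop : Continuous fun θ : Sph n => _).integrable_of_hasCompactSupport
      (HasCompactSupport.of_compactSpace _))] at h
  exact eq_neg_of_add_eq_zero_left h

/-- The spherical Laplacian, as the Casimir operator of the rotation fields. -/
noncomputable def sphLapl {n : ℕ} (f : Euc n → ℂ) (x : Euc n) : ℂ :=
  (1 / 2) * ∑ i, ∑ j, angDeriv i j (angDeriv i j f) x

lemma angDeriv_eq {n : ℕ} (i j : Fin n) (u : Euc n → ℂ) (x : Euc n) :
    angDeriv i j u x = x i * fderiv ℝ u x (EuclideanSpace.single j (1 : ℝ)) -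
      x j * fderiv ℝ u x (EuclideanSpace.single i (1 : ℝ)) := by
  simp [angDeriv, rotGen_apply]

lemma angDeriv_angDeriv {n : ℕ} (i j : Fin n) {u : Euc n → ℂ} (hu : ContDiff ℝ 2 u) (x : Euc n) :
    angDeriv i j (angDeriv i j u) x = 
      (x i * (if i = j then 1 else 0) - x j) * fderiv ℝ u x (EuclideanSpace.single j (1 : ℝ))
      - (x i - x j * (if i = j then 1 else 0)) * fderiv ℝ u x (EuclideanSpace.single i (1 : ℝ))
      + x i ^ 2 * fderiv ℝ (fderiv ℝ u) x (EuclideanSpace.single j (1 : ℝ)) (EuclideanSpace.single j (1 : ℝ))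
      + x j ^ 2 * fderiv ℝ (fderiv ℝ u) x (EuclideanSpace.single i (1 : ℝ)) (EuclideanSpace.single i (1 : ℝ))
      - x i * x j * fderiv ℝ (fderiv ℝ u) x (EuclideanSpace.single i (1 : ℝ)) (EuclideanSpace.single j (1 : ℝ))
      - x j * x i * fderiv ℝ (fderiv ℝ u) x (EuclideanSpace.single j (1 : ℝ)) (EuclideanSpace.single i (1 : ℝ)) := by
  have hd : HasFDerivAt (fderiv ℝ u) (fderiv ℝ (fderiv ℝ u) x) x :=
    ((hu.fderiv_right (m := 1) (by norm_num)).differentiable one_ne_zero x).hasFDerivAt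
  have hp : ∀ k : Fin n, HasFDerivAt (fun y : Euc n => ((y k : ℝ) : ℂ))
      (Complex.ofRealCLM ∘L (EuclideanSpace.proj k : Euc n →L[ℝ] ℝ)) x := fun k =>
    (Complex.ofRealCLM ∘L (EuclideanSpace.proj k : Euc n →L[ℝ] ℝ)).hasFDerivAt
  have hq : ∀ k : Fin n, HasFDerivAt (fun y => fderiv ℝ u y (EuclideanSpace.single k (1 : ℝ)))
      ((fderiv ℝ (fderiv ℝ u) x).flip (EuclideanSpace.single k (1 : ℝ))) x := fun k => by
    have := hd.clm_apply (hasFDerivAt_const (EuclideanSpace.single k (1 : ℝ)) x)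
    simpa using this
  have h := ((hp i).mul (hq j)).sub ((hp j).mul (hq i))
  have e : angDeriv i j u = (fun y : Euc n => ((y i : ℝ) : ℂ)) *
      (fun y => fderiv ℝ u y (EuclideanSpace.single j (1 : ℝ))) - (fun y : Euc n => ((y j : ℝ) : ℂ)) *
      (fun y => fderiv ℝ u y (EuclideanSpace.single i (1 : ℝ))) := funext (angDeriv_eq i j u)
  rw [e, angDeriv, h.fderiv]
  simp only [rotGen_apply, map_sub, map_smul]
  rcases eq_or_ne i j with hij | hij
  · subst hij
    simp
    ring
  · simp [hij, hij.symm]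
    ring

lemma sum_casimir {n : ℕ} (x P : Fin n → ℂ) (H : Fin n → Fin n → ℂ) :
    (1 / 2) * ∑ i, ∑ j, ((x i * (if i = j then 1 else 0) - x j) * P j
      - (x i - x j * (if i = j then 1 else 0)) * P i + x i ^ 2 * H j j + x j ^ 2 * H i i
      - x i * x j * H i j - x j * x i * H j i) =
    (∑ i, x i ^ 2) * (∑ j, H j j) - (∑ i, ∑ j, x i * x j * H i j) - ((n : ℂ) - 1) * ∑ i, x i * P i := by
  have c : ∑ i, ∑ j, x j * x i * H j i = ∑ i, ∑ j, x i * x j * H i j := Finset.sum_comm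
  have d : ∑ i, ∑ j, x j ^ 2 * H i i = ∑ i, ∑ j, x i ^ 2 * H j j := Finset.sum_comm
  have e : ∑ i, ∑ j, (x i * (if i = j then 1 else 0) * P j) = ∑ i, x i * P i := by simp
  have f : ∑ i, ∑ j, (x j * (if i = j then 1 else 0) * P i) = ∑ i, x i * P i := by simp
  simp only [sub_mul, Finset.sum_add_distrib, Finset.sum_sub_distrib, c, d, e, f,
    Finset.sum_mul_sum]
  simp only [Finset.sum_const, Finset.card_univ, Fintype.card_fin, nsmul_eq_mul, ← Finset.mul_sum]
  ring

theorem sphLapl_eq {n : ℕ} {u : Euc n → ℂ} (hu : ContDiff ℝ 2 u) (x : Euc n) :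
    sphLapl u x = (‖x‖ : ℂ) ^ 2 * lapl u x - fderiv ℝ (fderiv ℝ u) x x x -
      ((n : ℂ) - 1) * fderiv ℝ u x x := by
  have hx : ∑ i, x i • EuclideanSpace.single i (1 : ℝ) = x := by
    simpa using (EuclideanSpace.basisFun (Fin n) ℝ).sum_repr x
  have hn : (‖x‖ : ℂ) ^ 2 = ∑ i, (x i : ℂ) ^ 2 := by
    rw [← Complex.ofReal_pow, EuclideanSpace.norm_sq_eq]
    push_cast
    simp [← Complex.ofReal_pow]
  have hL : ∀ L : Euc n →L[ℝ] ℂ, L x = ∑ i, (x i : ℂ) * L (EuclideanSpace.single i (1 : ℝ)) := by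
    intro L
    conv_lhs => rw [← hx]
    rw [map_sum]
    exact Finset.sum_congr rfl fun i _ => by rw [map_smul, Complex.real_smul]
  have h1 := hL (fderiv ℝ u x)
  have h2 : fderiv ℝ (fderiv ℝ u) x x x = ∑ i, ∑ j, (x i : ℂ) * x j * fderiv ℝ (fderiv ℝ u) x
      (EuclideanSpace.single i (1 : ℝ)) (EuclideanSpace.single j (1 : ℝ)) := by
    have h0 := hL ((fderiv ℝ (fderiv ℝ u) x).flip x)
    simp only [ContinuousLinearMap.flip_apply] at h0
    rw [h0]
    refine Finset.sum_congr rfl fun i _ => ?_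
    rw [hL, Finset.mul_sum]
    exact Finset.sum_congr rfl fun j _ => by ring
  have h3 : lapl u x = ∑ j, fderiv ℝ (fderiv ℝ u) x
      (EuclideanSpace.single j (1 : ℝ)) (EuclideanSpace.single j (1 : ℝ)) := by
    simp [lapl, iteratedFDeriv_two_apply]
  rw [sphLapl, h1, h2, h3, hn]
  simp only [angDeriv_angDeriv _ _ hu]
  exact sum_casimir (fun i => (x i : ℂ)) (fun i => fderiv ℝ u x (EuclideanSpace.single i (1 : ℝ)))
    fun i j => fderiv ℝ (fderiv ℝ u) x (EuclideanSpace.single i (1 : ℝ))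
      (EuclideanSpace.single j (1 : ℝ))

theorem angDeriv_dilate {n : ℕ} (i j : Fin n) (u : Euc n → ℂ) (r : ℝ) :
    angDeriv i j (fun x => u (r • x)) = fun x => angDeriv i j u (r • x) := by
  funext x
  simp only [angDeriv, fderiv_comp_smul, map_smul, smul_apply]

theorem sphLapl_dilate {n : ℕ} (u : Euc n → ℂ) (r : ℝ) (x : Euc n) :
    sphLapl (fun x => u (r • x)) x = sphLapl u (r • x) := by
  simp only [sphLapl, angDeriv_dilate]

lemma integrable_sphere {n : ℕ} {f : Euc n → ℂ} (hf : Continuous f) :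
    Integrable (fun θ : Sph n => f θ) (surf n) :=
  (hf.comp continuous_subtype_val).integrable_of_hasCompactSupport
    (HasCompactSupport.of_compactSpace _)

theorem integral_sphLapl_mul {n : ℕ} {f g : Euc n → ℂ} (hf : ContDiff ℝ 2 f)
    (hg : ContDiff ℝ 1 g) : ∫ θ : Sph n, sphLapl f θ * g θ ∂surf n =
      -((1 / 2) * ∑ i, ∑ j, ∫ θ : Sph n, angDeriv i j f θ * angDeriv i j g θ ∂surf n) := by
  have c2 : ∀ i j, ContDiff ℝ 1 (angDeriv i j f) := fun i j =>
    hf.angDeriv (m := 2) (k := 1) i j (by norm_num)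
  have c1 : ∀ i j, Continuous (angDeriv i j (angDeriv i j f)) := fun i j =>
    ((c2 i j).angDeriv (m := 1) (k := 0) i j (by simp)).continuous
  have e : ∀ θ : Sph n, sphLapl f θ * g θ =
      (1 / 2) * ∑ i, ∑ j, angDeriv i j (angDeriv i j f) θ * g θ := fun θ => by
    simp only [sphLapl, Finset.sum_mul, mul_assoc]
  have hi : ∀ i j, Integrable (fun θ : Sph n => angDeriv i j (angDeriv i j f) θ * g θ) (surf n) :=
    fun i j => integrable_sphere ((c1 i j).mul hg.continuous)
  simp_rw [e]
  rw [integral_const_mul, integral_finsetSum _ fun i _ => integrable_finsetSum _ fun j _ => hi i j]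
  simp_rw [integral_finsetSum _ fun j _ => hi _ j, integral_angDeriv_mul _ _ (c2 _ _) hg,
    Finset.sum_neg_distrib, mul_neg]

theorem integral_sphLapl_mul_comm {n : ℕ} {f g : Euc n → ℂ} (hf : ContDiff ℝ 2 f)
    (hg : ContDiff ℝ 2 g) : ∫ θ : Sph n, sphLapl f θ * g θ ∂surf n =
      ∫ θ : Sph n, f θ * sphLapl g θ ∂surf n := by
  have := integral_sphLapl_mul hg (hf.of_le one_le_two)
  simp_rw [mul_comm (f _), this, integral_sphLapl_mul hf (hg.of_le one_le_two), mul_comm]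

/-- The radial coefficient `r ↦ ∫ Y(θ) u(rθ) dθ`. -/
noncomputable def coeff {n : ℕ} (Y u : Euc n → ℂ) (r : ℝ) : ℂ :=
  ∫ θ : Sph n, Y θ * u (r • (θ : Euc n)) ∂surf n

lemma coeff_continuous_of {n : ℕ} {Y : Euc n → ℂ} (hY : Continuous Y) {Φ : Euc n → Euc n → ℂ}
    (hΦ : Continuous fun q : Euc n × Euc n => Φ q.1 q.2) :
    Continuous fun r : ℝ => ∫ θ : Sph n, Y θ * Φ (r • (θ : Euc n)) θ ∂surf n := by
  have h1 : Continuous fun q : ℝ × Sph n => (q.1 • (q.2 : Euc n), (q.2 : Euc n)) := by fun_prop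
  have h2 := hΦ.comp h1
  have h3 : Continuous fun q : ℝ × Sph n => Y q.2 * Φ (q.1 • (q.2 : Euc n)) q.2 :=
    (hY.comp (by fun_prop)).mul h2
  have := continuous_parametric_integral_of_continuous (μ := surf n) (s := univ)
    (f := fun (r : ℝ) (θ : Sph n) => Y θ * Φ (r • (θ : Euc n)) θ) h3 isCompact_univ
  simpa using this

lemma lapl_eq_sum {n : ℕ} (u : Euc n → ℂ) (x : Euc n) :
    lapl u x = ∑ j, fderiv ℝ (fderiv ℝ u) x
      (EuclideanSpace.single j (1 : ℝ)) (EuclideanSpace.single j (1 : ℝ)) := by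
  simp [lapl, iteratedFDeriv_two_apply]

lemma continuous_lapl {n : ℕ} {u : Euc n → ℂ} (hu : ContDiff ℝ 2 u) : Continuous (lapl u) := by
  have h2 : Continuous (fderiv ℝ (fderiv ℝ u)) :=
    (hu.fderiv_right (m := 1) (by norm_num)).continuous_fderiv one_ne_zero
  have : lapl u = fun x => ∑ j, fderiv ℝ (fderiv ℝ u) x
      (EuclideanSpace.single j (1 : ℝ)) (EuclideanSpace.single j (1 : ℝ)) := funext (lapl_eq_sum u)
  rw [this]
  exact continuous_finsetSum _ fun j _ =>
    (h2.clm_apply continuous_const).clm_apply continuous_const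

lemma lapl_eq_zero {n : ℕ} {u : Euc n → ℂ} {x : Euc n} (hx : x ∉ tsupport u) : lapl u x = 0 := by
  have h2 : fderiv ℝ (fderiv ℝ u) x = 0 := by
    apply image_eq_zero_of_notMem_tsupport
    exact fun h => hx (tsupport_fderiv_subset ℝ (tsupport_fderiv_subset ℝ h))
  rw [lapl_eq_sum]
  simp [h2]

/-- The coefficients of `u` and `Δu` along an eigenfunction of the spherical Laplacian are related
by Euler's equation. -/
theorem coeff_system {n : ℕ} {Y u : Euc n → ℂ} {lam T : ℝ} (hY : ContDiff ℝ 2 Y)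
    (hYe : ∀ᵐ θ : Sph n ∂surf n, sphLapl Y θ = -(lam : ℂ) * Y θ) (hu : ContDiff ℝ 2 u)
    (hT : ∀ x : Euc n, T ≤ ‖x‖ → x ∉ tsupport u) :
    ∃ v1 v2 : ℝ → ℂ, (∀ r, HasDerivAt (coeff Y u) (v1 r) r) ∧ (∀ r, HasDerivAt v1 (v2 r) r) ∧
      Continuous v2 ∧ Continuous (coeff Y (lapl u)) ∧
      (∀ r : ℝ, (r : ℂ) ^ 2 * coeff Y (lapl u) r =
        (r : ℂ) ^ 2 * v2 r + ((n : ℂ) - 1) * r * v1 r - lam * coeff Y u r) ∧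
      (∀ r ≥ T, coeff Y u r = 0) ∧ (∀ r ≥ T, v1 r = 0) ∧ (∀ r ≥ T, coeff Y (lapl u) r = 0) := by
  have hu1 : ContDiff ℝ 1 (fderiv ℝ u) := hu.fderiv_right (m := 1) (by norm_num)
  have c0 := hu.continuous
  have c1 := hu1.continuous
  have c2 : Continuous (fderiv ℝ (fderiv ℝ u)) := hu1.continuous_fderiv one_ne_zero
  have cY := hY.continuous
  have hφ1 : Continuous fun q : Euc n × Euc n => fderiv ℝ u q.1 q.2 := by fun_prop
  have hφ2 : Continuous fun q : Euc n × Euc n => fderiv ℝ (fderiv ℝ u) q.1 q.2 q.2 := by fun_prop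
  have hm : Continuous fun q : ℝ × Sph n => (q.1 • (q.2 : Euc n), (q.2 : Euc n)) := by fun_prop
  have hYm : Continuous fun q : ℝ × Sph n => Y q.2 := cY.comp (by fun_prop)
  have ht : ∀ t : ℝ, Continuous fun θ : Sph n => (t, θ) := fun t => Continuous.prodMk_right t
  have k0 : Continuous fun q : ℝ × Sph n => Y q.2 * u (q.1 • (q.2 : Euc n)) :=
    hYm.mul (c0.comp (by fun_prop))
  have k1 : Continuous fun q : ℝ × Sph n => Y q.2 * fderiv ℝ u (q.1 • (q.2 : Euc n)) q.2 :=
    hYm.mul (hφ1.comp hm)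
  have k2 : Continuous fun q : ℝ × Sph n =>
      Y q.2 * fderiv ℝ (fderiv ℝ u) (q.1 • (q.2 : Euc n)) q.2 q.2 :=
    hYm.mul (hφ2.comp hm)
  have hline : ∀ (r : ℝ) (θ : Euc n), HasDerivAt (fun r : ℝ => r • θ) θ r := fun r θ => by
    simpa using (hasDerivAt_id r).smul_const θ
  have d1 : ∀ r, HasDerivAt (coeff Y u)
      (∫ θ : Sph n, Y θ * fderiv ℝ u (r • (θ : Euc n)) θ ∂surf n) r := by
    refine hasDerivAt_integral_of_compact (fun t => k0.comp (ht t)) k1 fun t θ => ?_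
    exact ((hu.differentiable two_ne_zero _).hasFDerivAt.comp_hasDerivAt t (hline t θ)).const_mul _
  have d2 : ∀ r, HasDerivAt (fun r : ℝ => ∫ θ : Sph n, Y θ * fderiv ℝ u (r • (θ : Euc n)) θ ∂surf n)
      (∫ θ : Sph n, Y θ * fderiv ℝ (fderiv ℝ u) (r • (θ : Euc n)) θ θ ∂surf n) r := by
    refine hasDerivAt_integral_of_compact (fun t => k1.comp (ht t)) k2 fun t θ => ?_
    have := ((hu1.differentiable one_ne_zero _).hasFDerivAt.comp_hasDerivAt t
      (hline t θ)).clm_apply (hasDerivAt_const t (θ : Euc n))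
    simpa using this.const_mul (Y θ)
  have hz : ∀ r ≥ T, ∀ θ : Sph n, r • (θ : Euc n) ∉ tsupport u := by
    intro r hr θ
    apply hT
    rw [norm_smul, norm_eq_of_mem_sphere, mul_one]
    exact hr.trans (le_abs_self r)
  have clap := continuous_lapl hu
  refine ⟨_, _, d1, d2, coeff_continuous_of (Φ := fun x y => fderiv ℝ (fderiv ℝ u) x y y) cY hφ2,
    coeff_continuous_of (Φ := fun x _ => lapl u x) cY (by fun_prop), ?_, ?_, ?_, ?_⟩
  · intro r
    have hs : ContDiff ℝ 2 fun x => u (r • x) := hu.comp (contDiff_const_smul r)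
    have e1 : ∫ θ : Sph n, Y θ * sphLapl (fun x => u (r • x)) θ ∂surf n =
        -(lam : ℂ) * coeff Y u r := by
      rw [← integral_sphLapl_mul_comm hY hs, coeff, ← integral_const_mul]
      refine integral_congr_ae (hYe.mono fun θ hθ => ?_)
      simp only [hθ, mul_assoc]
    have e2 : ∀ θ : Sph n, Y θ * sphLapl (fun x => u (r • x)) θ =
        (r : ℂ) ^ 2 * (Y θ * lapl u (r • (θ : Euc n))) -
        (r : ℂ) ^ 2 * (Y θ * fderiv ℝ (fderiv ℝ u) (r • (θ : Euc n)) θ θ) -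
        ((n : ℂ) - 1) * r * (Y θ * fderiv ℝ u (r • (θ : Euc n)) θ) := by
      intro θ
      rw [sphLapl_dilate, sphLapl_eq hu, norm_smul, norm_eq_of_mem_sphere, mul_one,
        ← Complex.ofReal_pow, Real.norm_eq_abs, sq_abs]
      simp only [map_smul, smul_apply, Complex.real_smul]
      push_cast
      ring
    have i1 : Integrable (fun θ : Sph n => Y θ * lapl u (r • (θ : Euc n))) (surf n) :=
      integrable_sphere (f := fun x => Y x * lapl u (r • x)) (by fun_prop)
    have i2 : Integrable (fun θ : Sph n => Y θ * fderiv ℝ (fderiv ℝ u) (r • (θ : Euc n)) θ θ)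
        (surf n) :=
      integrable_sphere (f := fun x => Y x * fderiv ℝ (fderiv ℝ u) (r • x) x x) (by fun_prop)
    have i3 : Integrable (fun θ : Sph n => Y θ * fderiv ℝ u (r • (θ : Euc n)) θ) (surf n) :=
      integrable_sphere (f := fun x => Y x * fderiv ℝ u (r • x) x) (by fun_prop)
    have i12 : Integrable (fun θ : Sph n => (r : ℂ) ^ 2 * (Y θ * lapl u (r • (θ : Euc n))) -
        (r : ℂ) ^ 2 * (Y θ * fderiv ℝ (fderiv ℝ u) (r • (θ : Euc n)) θ θ)) (surf n) :=
      (i1.const_mul _).sub (i2.const_mul _)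
    simp_rw [e2] at e1
    rw [integral_sub i12 (i3.const_mul _),
      integral_sub (i1.const_mul _) (i2.const_mul _), integral_const_mul, integral_const_mul,
      integral_const_mul] at e1
    rw [coeff]
    linear_combination e1
  · intro r hr
    simp [coeff, image_eq_zero_of_notMem_tsupport (hz r hr _)]
  · intro r hr
    have : ∀ θ : Sph n, fderiv ℝ u (r • (θ : Euc n)) = 0 := fun θ =>
      image_eq_zero_of_notMem_tsupport fun h => hz r hr θ (tsupport_fderiv_subset ℝ h)
    simp [this]
  · intro r hr
    simp [coeff, lapl_eq_zero (hz r hr _)]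

open scoped InnerProductSpace in
/-- Diagonalization of a symmetric nonpositive operator given on representatives. -/
theorem exists_eigenvectors_of_representatives {P H : Type*} [AddCommGroup P] [Module ℂ P]
    [FiniteDimensional ℂ P] [NormedAddCommGroup H] [InnerProductSpace ℂ H] (L : P →ₗ[ℂ] H)
    (D : P →ₗ[ℂ] P) (hsymm : ∀ f g, ⟪L (D f), L g⟫_ℂ = ⟪L f, L (D g)⟫_ℂ)
    (hneg : ∀ f, (⟪L (D f), L f⟫_ℂ).re ≤ 0) :
    ∃ (d : ℕ) (Y : Fin d → P) (lam : Fin d → ℝ), (∀ i, 0 ≤ lam i) ∧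
      (∀ i, L (D (Y i)) = (-(lam i : ℂ)) • L (Y i)) ∧
      ∀ φ : H, ∑ i, ‖⟪L (Y i), φ⟫_ℂ‖ ^ 2 = ‖(LinearMap.range L).starProjection φ‖ ^ 2 := by
  obtain ⟨S, hS⟩ := L.rangeRestrict.exists_rightInverse_of_surjective L.range_rangeRestrict
  have hS' : ∀ w : LinearMap.range L, L (S w) = w := fun w =>
    congrArg Subtype.val (LinearMap.congr_fun hS w)
  let T : LinearMap.range L →ₗ[ℂ] LinearMap.range L := L.rangeRestrict ∘ₗ D ∘ₗ S
  have hTc : ∀ w, ((T w : LinearMap.range L) : H) = L (D (S w)) := fun w => rfl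
  have hT : T.IsSymmetric := fun x y => by
    rw [Submodule.coe_inner, Submodule.coe_inner, hTc, hTc]
    conv_lhs => rw [← hS' y]
    conv_rhs => rw [← hS' x]
    exact hsymm _ _
  let b := hT.eigenvectorBasis rfl
  have hb : ∀ i, L (D (S (b i))) = ((hT.eigenvalues rfl i : ℝ) : ℂ) • L (S (b i)) := fun i => by
    have := congrArg Subtype.val (hT.apply_eigenvectorBasis rfl i)
    rw [hS']
    exact this
  refine ⟨_, fun i => S (b i), fun i => -hT.eigenvalues rfl i, fun i => ?_, fun i => ?_,
    fun φ => ?_⟩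
  · have h1 := hneg (S (b i))
    have h2 : ⟪L (S (b i)), L (S (b i))⟫_ℂ = 1 := by
      rw [hS', ← Submodule.coe_inner, inner_self_eq_norm_sq_to_K, b.norm_eq_one]
      simp
    rw [hb, inner_smul_left, h2] at h1
    simpa using h1
  · rw [hb]
    push_cast
    rw [neg_neg]
  · have h3 : ∀ i, ⟪L (S (b i)), φ⟫_ℂ =
        ⟪b i, (LinearMap.range L).orthogonalProjectionOnto φ⟫_ℂ := fun i => by
      rw [hS', Submodule.inner_orthogonalProjectionOnto_eq_of_mem_left]
    simp_rw [h3, b.sum_sq_norm_inner_right]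
    rfl

/-- The coordinate functions and constants. -/
def affineFun (n : ℕ) : Submodule ℂ (Euc n → ℂ) :=
  Submodule.span ℂ (insert 1 (range fun (i : Fin n) (x : Euc n) => ((x i : ℝ) : ℂ)))

lemma one_mem_affineFun (n : ℕ) : (1 : Euc n → ℂ) ∈ affineFun n :=
  Submodule.subset_span (mem_insert _ _)

lemma coord_mem_affineFun {n : ℕ} (i : Fin n) :
    (fun x : Euc n => ((x i : ℝ) : ℂ)) ∈ affineFun n :=
  Submodule.subset_span (mem_insert_of_mem _ ⟨i, rfl⟩)

lemma angDeriv_const {n : ℕ} (i j : Fin n) (c : ℂ) :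
    angDeriv i j (fun _ : Euc n => c) = 0 := by
  funext x
  simp [angDeriv]

lemma angDeriv_add {n : ℕ} (i j : Fin n) {f g : Euc n → ℂ} (hf : Differentiable ℝ f)
    (hg : Differentiable ℝ g) : angDeriv i j (f + g) = angDeriv i j f + angDeriv i j g := by
  funext x
  simp [angDeriv, fderiv_add (hf x) (hg x)]

lemma angDeriv_smul {n : ℕ} (i j : Fin n) (c : ℂ) {f : Euc n → ℂ} (hf : Differentiable ℝ f) :
    angDeriv i j (c • f) = c • angDeriv i j f := by
  funext x
  simp [angDeriv, fderiv_const_smul (hf x)]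

lemma angDeriv_star {n : ℕ} (i j : Fin n) (f : Euc n → ℂ) :
    angDeriv i j (star f) = star (angDeriv i j f) := by
  funext x
  have : fderiv ℝ (star f) x = (Complex.conjCLE : ℂ →L[ℝ] ℂ) ∘L fderiv ℝ f x :=
    Complex.conjCLE.comp_fderiv
  simp [angDeriv, this]

lemma sphLapl_star {n : ℕ} (f : Euc n → ℂ) : sphLapl (star f) = star (sphLapl f) := by
  funext x
  simp [sphLapl, angDeriv_star]

lemma affineFun_props {n : ℕ} {f : Euc n → ℂ} (hf : f ∈ affineFun n) :
    ContDiff ℝ (⊤ : ℕ∞) f ∧ ∀ i j, angDeriv i j f ∈ affineFun n := by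
  induction hf using Submodule.span_induction with
  | mem f hf =>
    rcases hf with rfl | ⟨l, rfl⟩
    · refine ⟨contDiff_const, fun i j => ?_⟩
      rw [show (1 : Euc n → ℂ) = fun _ => 1 from rfl, angDeriv_const]
      exact Submodule.zero_mem _
    · refine ⟨(Complex.ofRealCLM ∘L (EuclideanSpace.proj l : Euc n →L[ℝ] ℝ)).contDiff,
        fun i j => ?_⟩
      have h : ∀ x : Euc n, fderiv ℝ (fun x : Euc n => ((x l : ℝ) : ℂ)) x =
          Complex.ofRealCLM ∘L (EuclideanSpace.proj l : Euc n →L[ℝ] ℝ) := fun x =>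
        (Complex.ofRealCLM ∘L (EuclideanSpace.proj l : Euc n →L[ℝ] ℝ)).fderiv
      have : angDeriv i j (fun x : Euc n => ((x l : ℝ) : ℂ)) =
          (if l = j then (1 : ℂ) else 0) • (fun x : Euc n => ((x i : ℝ) : ℂ)) -
          (if l = i then (1 : ℂ) else 0) • (fun x : Euc n => ((x j : ℝ) : ℂ)) := by
        funext x
        simp only [angDeriv, h, rotGen_apply]
        simp
        split_ifs <;> simp
      rw [this]
      exact Submodule.sub_mem _ (Submodule.smul_mem _ _ (coord_mem_affineFun i))
        (Submodule.smul_mem _ _ (coord_mem_affineFun j))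
  | zero =>
    refine ⟨contDiff_const, fun i j => ?_⟩
    rw [show (0 : Euc n → ℂ) = fun _ => 0 from rfl, angDeriv_const]
    exact Submodule.zero_mem _
  | add f g _ _ hf hg =>
    refine ⟨hf.1.add hg.1, fun i j => ?_⟩
    rw [angDeriv_add i j (hf.1.differentiable (by simp)) (hg.1.differentiable (by simp))]
    exact Submodule.add_mem _ (hf.2 i j) (hg.2 i j)
  | smul c f _ hf =>
    refine ⟨hf.1.const_smul c, fun i j => ?_⟩
    rw [angDeriv_smul i j c (hf.1.differentiable (by simp))]
    exact Submodule.smul_mem _ _ (hf.2 i j)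

theorem polyFun_props {n k : ℕ} {f : Euc n → ℂ} (hf : f ∈ affineFun n ^ k) :
    ContDiff ℝ (⊤ : ℕ∞) f ∧ ∀ i j, angDeriv i j f ∈ affineFun n ^ k := by
  induction hf using Submodule.pow_induction_on_left' with
  | algebraMap r =>
    refine ⟨contDiff_const, fun i j => ?_⟩
    rw [show algebraMap ℂ (Euc n → ℂ) r = fun _ => r from rfl, angDeriv_const]
    exact Submodule.zero_mem _
  | add f g k _ _ hf hg =>
    refine ⟨hf.1.add hg.1, fun i j => ?_⟩
    rw [angDeriv_add i j (hf.1.differentiable (by simp)) (hg.1.differentiable (by simp))]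
    exact Submodule.add_mem _ (hf.2 i j) (hg.2 i j)
  | mem_mul m hm k f hfm hf =>
    have hm' := affineFun_props hm
    refine ⟨hm'.1.mul hf.1, fun i j => ?_⟩
    rw [angDeriv_mul i j (hm'.1.differentiable (by simp)) (hf.1.differentiable (by simp)),
      Nat.succ_eq_add_one, pow_succ']
    exact Submodule.add_mem _ (Submodule.mul_mem_mul (hm'.2 i j) hfm)
      (Submodule.mul_mem_mul hm (hf.2 i j))

instance affineFun_pow_finite (n k : ℕ) : FiniteDimensional ℂ (affineFun n ^ k : Submodule ℂ (Euc n → ℂ)) :=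
  Module.Finite.iff_fg.2 (Submodule.FG.pow
    (Submodule.fg_span ((finite_range _).insert _)) k)

lemma polyFun_contDiff {n k : ℕ} (f : (affineFun n ^ k : Submodule ℂ (Euc n → ℂ))) {m : ℕ∞} :
    ContDiff ℝ m (f : Euc n → ℂ) :=
  (polyFun_props f.2).1.of_le (by exact_mod_cast le_top)

/-- Restriction to the sphere. -/
noncomputable def restrictSphere (n k : ℕ) :
    (affineFun n ^ k : Submodule ℂ (Euc n → ℂ)) →ₗ[ℂ] C(Sph n, ℂ) where
  toFun f := ⟨fun θ => (f : Euc n → ℂ) θ,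
    (polyFun_contDiff f (m := 0)).continuous.comp continuous_subtype_val⟩
  map_add' _ _ := rfl
  map_smul' _ _ := rfl

/-- Restriction to the sphere, as a map to `L²`. -/
noncomputable def restrictL2 (n k : ℕ) :
    (affineFun n ^ k : Submodule ℂ (Euc n → ℂ)) →ₗ[ℂ] Lp ℂ 2 (surf n) :=
  (ContinuousMap.toLp 2 (surf n) ℂ).toLinearMap ∘ₗ restrictSphere n k

/-- The spherical Laplacian on polynomial functions. -/
noncomputable def polyLapl (n k : ℕ) :
    (affineFun n ^ k : Submodule ℂ (Euc n → ℂ)) →ₗ[ℂ] (affineFun n ^ k : Submodule ℂ (Euc n → ℂ)) where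
  toFun f := ⟨sphLapl f, by
    have : sphLapl (f : Euc n → ℂ) = (1 / 2 : ℂ) • ∑ i, ∑ j, angDeriv i j (angDeriv i j f) := by
      funext x
      simp [sphLapl]
    rw [this]
    exact Submodule.smul_mem _ _ (Submodule.sum_mem _ fun i _ => Submodule.sum_mem _ fun j _ =>
      (polyFun_props ((polyFun_props f.2).2 i j)).2 i j)⟩
  map_add' f g := by
    have hd : ∀ h ∈ (affineFun n ^ k : Submodule ℂ (Euc n → ℂ)), Differentiable ℝ h := fun h hh =>
      (polyFun_props hh).1.differentiable (by simp)
    ext x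
    simp only [sphLapl, Submodule.coe_add, angDeriv_add _ _ (hd _ f.2) (hd _ g.2),
      angDeriv_add _ _ (hd _ ((polyFun_props f.2).2 _ _)) (hd _ ((polyFun_props g.2).2 _ _)),
      Pi.add_apply, Finset.sum_add_distrib, mul_add]
  map_smul' c f := by
    have hd : ∀ h ∈ (affineFun n ^ k : Submodule ℂ (Euc n → ℂ)), Differentiable ℝ h := fun h hh =>
      (polyFun_props hh).1.differentiable (by simp)
    ext x
    simp only [sphLapl, Submodule.coe_smul, angDeriv_smul _ _ _ (hd _ f.2),
      angDeriv_smul _ _ _ (hd _ ((polyFun_props f.2).2 _ _)), Pi.smul_apply,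
      smul_eq_mul, RingHom.id_apply, ← Finset.mul_sum]
    ring


lemma contDiff_star {n : ℕ} {f : Euc n → ℂ} {m : ℕ∞} (hf : ContDiff ℝ m f) :
    ContDiff ℝ m (star f) :=
  Complex.conjCLE.contDiff.comp hf

open scoped InnerProductSpace in
lemma inner_restrictL2 {n k : ℕ} (f g : (affineFun n ^ k : Submodule ℂ (Euc n → ℂ))) :
    ⟪restrictL2 n k f, restrictL2 n k g⟫_ℂ =
      ∫ θ : Sph n, star (f : Euc n → ℂ) θ * (g : Euc n → ℂ) θ ∂surf n := by
  refine (ContinuousMap.inner_toLp (surf n) _ _).trans ?_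
  refine integral_congr_ae (.of_forall fun θ => ?_)
  exact mul_comm _ _

open scoped InnerProductSpace in
lemma restrictL2_symm {n k : ℕ} (f g : (affineFun n ^ k : Submodule ℂ (Euc n → ℂ))) :
    ⟪restrictL2 n k (polyLapl n k f), restrictL2 n k g⟫_ℂ =
      ⟪restrictL2 n k f, restrictL2 n k (polyLapl n k g)⟫_ℂ := by
  rw [inner_restrictL2, inner_restrictL2]
  have := integral_sphLapl_mul_comm (contDiff_star (polyFun_contDiff f (m := 2)))
    (polyFun_contDiff g (m := 2))
  rw [sphLapl_star] at this
  exact this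

open scoped InnerProductSpace in
lemma restrictL2_nonpos {n k : ℕ} (f : (affineFun n ^ k : Submodule ℂ (Euc n → ℂ))) :
    (⟪restrictL2 n k (polyLapl n k f), restrictL2 n k f⟫_ℂ).re ≤ 0 := by
  rw [inner_restrictL2]
  have := integral_sphLapl_mul (contDiff_star (polyFun_contDiff f (m := 2)))
    (polyFun_contDiff f (m := 1))
  rw [sphLapl_star] at this
  have e : ∀ i j : Fin n, ∫ θ : Sph n, angDeriv i j (star (f : Euc n → ℂ)) θ * angDeriv i j f θ ∂surf n
      = ((∫ θ : Sph n, ‖angDeriv i j f θ‖ ^ 2 ∂surf n : ℝ) : ℂ) := by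
    intro i j
    refine Eq.trans ?_ integral_ofReal
    refine integral_congr_ae (.of_forall fun θ => ?_)
    simp only [angDeriv_star, Pi.star_apply, RCLike.star_def]
    rw [RCLike.conj_mul]
    simp
  simp_rw [e] at this
  have h0 : 0 ≤ (1 / 2 : ℝ) * ∑ i : Fin n, ∑ j : Fin n, ∫ θ : Sph n, ‖angDeriv i j f θ‖ ^ 2 ∂surf n :=
    mul_nonneg (by norm_num) (Finset.sum_nonneg fun i _ => Finset.sum_nonneg fun j _ =>
      integral_nonneg fun θ => by positivity)
  have e2 : ∫ θ : Sph n, star ((polyLapl n k f : Euc n → ℂ)) θ * (f : Euc n → ℂ) θ ∂surf n =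
      ((-((1 / 2 : ℝ) * ∑ i : Fin n, ∑ j : Fin n, ∫ θ : Sph n, ‖angDeriv i j f θ‖ ^ 2 ∂surf n) : ℝ) : ℂ) := by
    push_cast
    exact this
  rw [e2, Complex.ofReal_re]
  linarith

lemma one_le_affineFun (n : ℕ) : 1 ≤ affineFun n := Submodule.one_le.2 (one_mem_affineFun n)

lemma monotone_range_restrictL2 (n : ℕ) : Monotone fun k => LinearMap.range (restrictL2 n k) := by
  rintro k l hkl _ ⟨f, rfl⟩
  exact ⟨⟨f, pow_le_pow_right₀ (one_le_affineFun n) hkl f.2⟩, rfl⟩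

lemma exists_polyFun_of_mem_adjoin {n : ℕ} (coord : Fin n → C(Sph n, ℂ))
    (hc : ∀ i θ, coord i θ = ((θ : Euc n) i : ℂ)) {φ : C(Sph n, ℂ)}
    (hφ : φ ∈ Algebra.adjoin ℂ (range coord)) :
    ∃ k, φ ∈ LinearMap.range (restrictSphere n k) := by
  have mono : ∀ {k l : ℕ}, k ≤ l → LinearMap.range (restrictSphere n k) ≤
      LinearMap.range (restrictSphere n l) := by
    rintro k l hkl _ ⟨f, rfl⟩
    exact ⟨⟨f, pow_le_pow_right₀ (one_le_affineFun n) hkl f.2⟩, rfl⟩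
  induction hφ using Algebra.adjoin_induction with
  | mem φ h =>
    obtain ⟨i, rfl⟩ := h
    refine ⟨1, ⟨⟨_, by rw [pow_one]; exact coord_mem_affineFun i⟩, ?_⟩⟩
    ext θ
    exact (hc i θ).symm
  | algebraMap r =>
    refine ⟨0, ⟨⟨algebraMap ℂ _ r, ?_⟩, ?_⟩⟩
    · rw [pow_zero]
      exact Submodule.algebraMap_mem r
    · ext θ
      rfl
  | add f g _ _ hf hg =>
    obtain ⟨k, hk⟩ := hf
    obtain ⟨l, hl⟩ := hg
    exact ⟨max k l, Submodule.add_mem _ (mono (le_max_left _ _) hk) (mono (le_max_right _ _) hl)⟩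
  | mul f g _ _ hf hg =>
    obtain ⟨k, f, rfl⟩ := hf
    obtain ⟨l, g, rfl⟩ := hg
    refine ⟨k + l, ⟨⟨(f : Euc n → ℂ) * g, ?_⟩, ?_⟩⟩
    · rw [pow_add]
      exact Submodule.mul_mem_mul f.2 g.2
    · ext θ
      rfl

theorem topologicalClosure_iSup_range_restrictL2 (n : ℕ) :
    ⊤ ≤ (⨆ k, LinearMap.range (restrictL2 n k)).topologicalClosure := by
  let coord : Fin n → C(Sph n, ℂ) := fun i => ⟨fun θ => ((θ : Euc n) i : ℂ), by fun_prop⟩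
  let A : StarSubalgebra ℂ C(Sph n, ℂ) :=
    { Algebra.adjoin ℂ (range coord) with
      star_mem' := by
        intro f hf
        change star f ∈ Algebra.adjoin ℂ (range coord)
        change f ∈ Algebra.adjoin ℂ (range coord) at hf
        induction hf using Algebra.adjoin_induction with
        | mem φ h =>
          obtain ⟨i, rfl⟩ := h
          have : star (coord i) = coord i := by
            ext θ
            simp [coord]
          rw [this]
          exact Algebra.subset_adjoin ⟨i, rfl⟩
        | algebraMap r =>
          rw [← algebraMap_star_comm]
          exact Subalgebra.algebraMap_mem _ _
        | add f g _ _ hf hg =>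
          rw [star_add]
          exact Subalgebra.add_mem _ hf hg
        | mul f g _ _ hf hg =>
          rw [star_mul]
          exact Subalgebra.mul_mem _ hg hf }
  have hsep : A.SeparatesPoints := by
    intro x y hxy
    have : ∃ i, (x : Euc n) i ≠ (y : Euc n) i := by
      by_contra! h
      exact hxy (Subtype.ext (PiLp.ext h))
    obtain ⟨i, hi⟩ := this
    refine ⟨coord i, ⟨coord i, Algebra.subset_adjoin ⟨i, rfl⟩, rfl⟩, ?_⟩
    simpa [coord] using hi
  have hA := ContinuousMap.starSubalgebra_topologicalClosure_eq_top_of_separatesPoints A hsep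
  have hsub : ∀ φ ∈ A, ContinuousMap.toLp 2 (surf n) ℂ φ ∈ ⨆ k, LinearMap.range (restrictL2 n k) := by
    intro φ hφ
    obtain ⟨k, f, rfl⟩ := exists_polyFun_of_mem_adjoin coord (fun _ _ => rfl) hφ
    exact Submodule.mem_iSup_of_mem k ⟨f, rfl⟩
  have hall : ∀ φ, ContinuousMap.toLp 2 (surf n) ℂ φ ∈
      (⨆ k, LinearMap.range (restrictL2 n k)).topologicalClosure := by
    intro φ
    have hφ : φ ∈ closure (A : Set C(Sph n, ℂ)) := by
      rw [← StarSubalgebra.topologicalClosure_coe, hA]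
      trivial
    exact map_mem_closure (ContinuousMap.toLp 2 (surf n) ℂ).continuous hφ hsub
  intro w _
  have hw := ContinuousMap.toLp_denseRange ℂ (surf n) ℂ ENNReal.ofNat_ne_top w
  have := closure_mono (range_subset_iff.2 hall) hw
  rwa [(Submodule.isClosed_topologicalClosure _).closure_eq] at this

open Filter Topology InnerProductSpace in
/-- Approximation of the square norm on the sphere by eigenfunctions of the spherical Laplacian. -/
theorem exists_spherical_harmonics (n : ℕ) : ∃ (d : ℕ → ℕ) (Y : ∀ k, Fin (d k) → Euc n → ℂ)
    (lam : ∀ k, Fin (d k) → ℝ), (∀ k i, ContDiff ℝ 2 (Y k i)) ∧ (∀ k i, 0 ≤ lam k i) ∧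
      (∀ k i, ∀ᵐ θ : Sph n ∂surf n, sphLapl (Y k i) θ = -(lam k i : ℂ) * Y k i θ) ∧
      ∀ φ : Sph n → ℂ, Continuous φ →
        (∀ k, ∑ i, ‖∫ θ : Sph n, Y k i θ * φ θ ∂surf n‖ₑ ^ 2 ≤ ∫⁻ θ, ‖φ θ‖ₑ ^ 2 ∂surf n) ∧
        Tendsto (fun k => ∑ i, ‖∫ θ : Sph n, Y k i θ * φ θ ∂surf n‖ₑ ^ 2) atTop
          (𝓝 (∫⁻ θ, ‖φ θ‖ₑ ^ 2 ∂surf n)) := by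
  choose d Y lam h0 hev hsum using fun k => exists_eigenvectors_of_representatives
    (restrictL2 n k) (polyLapl n k) restrictL2_symm restrictL2_nonpos
  refine ⟨d, fun k i => star (Y k i : Euc n → ℂ), lam,
    fun k i => contDiff_star (polyFun_contDiff (Y k i) (m := 2)), h0, fun k i => ?_,
    fun φ hφ => ?_⟩
  · have h1 := ContinuousMap.coeFn_toLp (p := 2) (𝕜 := ℂ) (surf n) (restrictSphere n k (polyLapl n k (Y k i)))
    have h2 := ContinuousMap.coeFn_toLp (p := 2) (𝕜 := ℂ) (surf n) (restrictSphere n k (Y k i))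
    have h3 := Lp.coeFn_smul (-(lam k i : ℂ)) (restrictL2 n k (Y k i))
    rw [← hev] at h3
    filter_upwards [h1, h2, h3] with θ h1 h2 h3
    have h4 : sphLapl (Y k i : Euc n → ℂ) θ = -(lam k i : ℂ) * (Y k i : Euc n → ℂ) θ := by
      refine h1.symm.trans (h3.trans ?_)
      rw [Pi.smul_apply, smul_eq_mul]
      exact congrArg _ h2
    rw [sphLapl_star, Pi.star_apply, h4]
    simp
  · let ψ : Lp ℂ 2 (surf n) := ContinuousMap.toLp 2 (surf n) ℂ ⟨φ, hφ⟩
    have hψ : ∫⁻ θ, ‖φ θ‖ₑ ^ 2 ∂surf n = ‖ψ‖ₑ ^ 2 := by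
      rw [Lp.enorm_def, eLpNorm_congr_ae (ContinuousMap.coeFn_toLp (surf n) _)]
      have := eLpNorm_nnreal_pow_eq_lintegral (f := φ) (μ := surf n) (p := 2) two_ne_zero
      simpa using this.symm
    have hin : ∀ k i, ∫ θ : Sph n, star (Y k i : Euc n → ℂ) θ * φ θ ∂surf n =
        ⟪restrictL2 n k (Y k i), ψ⟫_ℂ := fun k i => by
      refine Eq.trans ?_ (ContinuousMap.inner_toLp (surf n) _ _).symm
      exact integral_congr_ae (.of_forall fun θ => mul_comm _ _)
    have hs : ∀ k, ∑ i, ‖∫ θ : Sph n, star (Y k i : Euc n → ℂ) θ * φ θ ∂surf n‖ₑ ^ 2 =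
        ‖(LinearMap.range (restrictL2 n k)).starProjection ψ‖ₑ ^ 2 := fun k => by
      simp_rw [hin, ← ofReal_norm, ← ENNReal.ofReal_pow (norm_nonneg _)]
      rw [← ENNReal.ofReal_sum_of_nonneg fun i _ => by positivity, hsum]
    simp_rw [hs, hψ]
    refine ⟨fun k => ?_, ?_⟩
    · gcongr
      rw [enorm_le_iff_norm_le]
      exact Submodule.norm_starProjection_apply_le _ _
    · have := Submodule.starProjection_tendsto_self (fun k => LinearMap.range (restrictL2 n k))
        (monotone_range_restrictL2 n) ψ (topologicalClosure_iSup_range_restrictL2 n)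
      exact ((ENNReal.continuous_pow 2).tendsto _).comp ((continuous_enorm.tendsto _).comp this)

/-- The Schrödinger operator `-h²Δ + V(|x|) - E - iε` with a radial potential. -/
noncomputable def schr {n : ℕ} (V : ℝ → ℝ) (h E ε : ℝ) (u : Euc n → ℂ) (x : Euc n) : ℂ :=
  -(h : ℂ) ^ 2 * lapl u x + (V ‖x‖ : ℂ) * u x - ((E : ℂ) + ε * Complex.I) * u x

lemma norm_smul_sphere {n : ℕ} {r : ℝ} (hr : 0 < r) (θ : Sph n) : ‖r • (θ : Euc n)‖ = r := by
  rw [norm_smul, norm_eq_of_mem_sphere, mul_one, Real.norm_of_nonneg hr.le]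

lemma coeff_schr {n : ℕ} {V : ℝ → ℝ} (h E ε : ℝ) {Y u : Euc n → ℂ} (hY : Continuous Y)
    (hu : ContDiff ℝ 2 u) {r : ℝ} (hr : 0 < r) :
    coeff Y (schr V h E ε u) r = -(h : ℂ) ^ 2 * coeff Y (lapl u) r + (V r : ℂ) * coeff Y u r
      - ((E : ℂ) + ε * Complex.I) * coeff Y u r := by
  have i1 : Integrable (fun θ : Sph n => Y θ * lapl u (r • (θ : Euc n))) (surf n) :=
    integrable_sphere (f := fun x => Y x * lapl u (r • x))
      (hY.mul ((continuous_lapl hu).comp (continuous_const_smul r)))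
  have i2 : Integrable (fun θ : Sph n => Y θ * u (r • (θ : Euc n))) (surf n) :=
    integrable_sphere (f := fun x => Y x * u (r • x))
      (hY.mul (hu.continuous.comp (continuous_const_smul r)))
  simp only [coeff]
  rw [← integral_const_mul, ← integral_const_mul, ← integral_const_mul,
    ← integral_add (i1.const_mul _) (i2.const_mul _), ← integral_sub _ (i2.const_mul _)]
  · refine integral_congr_ae (.of_forall fun θ => ?_)
    simp only [schr, norm_smul_sphere hr]
    ring
  · exact (i1.const_mul _).add (i2.const_mul _)

lemma lintegral_Ioi_le_of_eq_zero {f : ℝ → ENNReal} {T : ℝ} (hT : 0 ≤ T)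
    (hf : ∀ r > T, f r = 0) : ∫⁻ r in Ioi 0, f r ≤ ∫⁻ r in Ioc 0 T, f r := by
  rw [← Ioc_union_Ioi_eq_Ioi hT]
  refine (lintegral_union_le _ _ _).trans ?_
  rw [setLIntegral_congr_fun (g := 0) measurableSet_Ioi fun r hr => hf r hr]
  simp

lemma rpow_half_sq_mul {n : ℕ} (hn : 2 ≤ n) {r : ℝ} (hr : 0 < r) (c : ℂ) :
    r * ‖((r ^ (((n : ℝ) - 2) / 2) : ℝ) : ℂ) * c‖ ^ 2 = r ^ (n - 1) * ‖c‖ ^ 2 := by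
  rw [norm_mul, Complex.norm_real, Real.norm_of_nonneg (by positivity), mul_pow, ← mul_assoc]
  congr 1
  rw [← Real.rpow_natCast, ← Real.rpow_natCast, ← Real.rpow_mul hr.le]
  nth_rewrite 1 [← Real.rpow_one r]
  rw [← Real.rpow_add hr]
  congr 1
  push_cast [Nat.cast_sub (by omega : 1 ≤ n)]
  ring

lemma lintegral_eq_ofReal_integral {f : ℝ → ℝ} {T : ℝ} (hT : 0 ≤ T)
    (hf : IntervalIntegrable f volume 0 T) (h0 : ∀ r > 0, 0 ≤ f r) {F : ℝ → ENNReal}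
    (hF : ∀ r > 0, F r = ENNReal.ofReal (f r)) :
    ∫⁻ r in Ioc 0 T, F r = ENNReal.ofReal (∫ r in (0 : ℝ)..T, f r) := by
  rw [intervalIntegral.integral_of_le hT, ofReal_integral_eq_lintegral_ofReal
    ((intervalIntegrable_iff_integrableOn_Ioc_of_le hT).1 hf)
    ((ae_restrict_iff' measurableSet_Ioc).2 (.of_forall fun r hr => h0 r hr.1))]
  exact setLIntegral_congr_fun measurableSet_Ioc fun r hr => hF r hr.1

theorem exists_mode_bound {n : ℕ} (hn : 2 ≤ n) {Emin Emax s Cv R : ℝ} (hEm : 0 < Emin)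
    (hEE : Emin ≤ Emax) (hs1 : 1 / 2 < s) (hs2 : s ≤ 1) (hCv : 0 ≤ Cv) (hR : 1 ≤ R) :
    ∃ C > 0, ∃ h₀ > 0, ∀ {V : ℝ → ℝ}, Measurable V → (∀ r > 0, |V r| ≤ Cv) →
      (∀ r > R, V r = 0) → ∀ {h E ε lam : ℝ} {u Y : Euc n → ℂ}, 0 < h → h ≤ h₀ → Emin ≤ E →
      E ≤ Emax → 0 < ε → 0 ≤ lam → ContDiff ℝ 2 u → HasCompactSupport u → ContDiff ℝ 2 Y →
      (∀ᵐ θ : Sph n ∂surf n, sphLapl Y θ = -(lam : ℂ) * Y θ) →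
      ∫⁻ r in Ioi (0 : ℝ), ENNReal.ofReal (r ^ (n - 1)) * (ENNReal.ofReal ((1 + r ^ 2) ^ (-s)) *
        ‖coeff Y u r‖ₑ ^ 2) ≤ ENNReal.ofReal (Real.exp (C / h)) *
      ∫⁻ r in Ioi (0 : ℝ), ENNReal.ofReal (r ^ (n - 1)) * (ENNReal.ofReal ((1 + r ^ 2) ^ s) *
        ‖coeff Y (schr V h E ε u) r‖ₑ ^ 2) := by
  obtain ⟨C, hC, h₀, hh₀, a, ha, key⟩ := RadialODE.exists_weighted_mass_le hEm hEE hs1 hs2 hCv hR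
  refine ⟨C, hC, h₀, hh₀, fun {V} hV hVb hVz {h E ε lam u Y} hh hhh hE1 hE2 hε hlam hu hus hY hYe => ?_⟩
  obtain ⟨B, hB⟩ := hus.isCompact.isBounded.exists_norm_le
  obtain ⟨T, hT1, hTa, hTB⟩ : ∃ T : ℝ, 1 ≤ T ∧ a ≤ T ∧ B + 1 ≤ T :=
    ⟨max 1 (max a (B + 1)), by simp, by simp, by simp⟩
  have hT0 : 0 ≤ T := by linarith
  have hTs : ∀ x : Euc n, T ≤ ‖x‖ → x ∉ tsupport u := fun x hx hx' => by
    have := hB x hx'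
    linarith
  obtain ⟨v1, v2, hv, hv1, hv2, hw, hode, z0, z1, z2⟩ := coeff_system hY hYe hu hTs
  obtain ⟨K, H⟩ := RadialODE.of_coefficient (E := E) (ε := ε) hn hlam hh hT1 hV hVb hVz hv hv1
    hv2 hw hode z0 z1 z2
  have hs : 0 < s := by linarith
  have main := key H hh hhh (by positivity) hE1 hE2 hε hTa
  have e1 := lintegral_eq_ofReal_integral hT0 (H.intble_weighted_mass hT0 hs)
    (fun r hr => by positivity) (F := fun r => ENNReal.ofReal (r ^ (n - 1)) *
      (ENNReal.ofReal ((1 + r ^ 2) ^ (-s)) * ‖coeff Y u r‖ₑ ^ 2)) fun r hr => by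
        rw [rpow_half_sq_mul hn hr, ← ofReal_norm, ← ENNReal.ofReal_pow (norm_nonneg _),
          ← ENNReal.ofReal_mul (by positivity), ← ENNReal.ofReal_mul (by positivity),
          Real.rpow_neg (by positivity)]
        congr 1
        ring
  have e2 := lintegral_eq_ofReal_integral hT0 (H.intble_source hT0 hs)
    (fun r hr => by positivity) (F := fun r => ENNReal.ofReal (r ^ (n - 1)) *
      (ENNReal.ofReal ((1 + r ^ 2) ^ s) * ‖coeff Y (schr V h E ε u) r‖ₑ ^ 2)) fun r hr => by
        rw [mul_right_comm, rpow_half_sq_mul hn hr, ← coeff_schr h E ε hY.continuous hu hr,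
          ← ofReal_norm, ← ENNReal.ofReal_pow (norm_nonneg _),
          ← ENNReal.ofReal_mul (by positivity), ← ENNReal.ofReal_mul (by positivity)]
        congr 1
        ring
  refine (lintegral_Ioi_le_of_eq_zero hT0 fun r hr => ?_).trans ?_
  · simp [z0 r (le_of_lt hr)]
  rw [e1]
  refine (ENNReal.ofReal_le_ofReal main).trans ?_
  rw [ENNReal.ofReal_mul (by positivity), ← e2]
  gcongr
  exact Ioc_subset_Ioi_self

lemma measurable_coeff_schr {n : ℕ} {V : ℝ → ℝ} (hV : Measurable V) (h E ε : ℝ) {Y u : Euc n → ℂ}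
    (hY : Continuous Y) (hu : ContDiff ℝ 2 u) :
    AEMeasurable (coeff Y (schr V h E ε u)) (volume.restrict (Ioi 0)) := by
  have h1 : Continuous (coeff Y u) := coeff_continuous_of hY
    (Φ := fun x _ => u x) (hu.continuous.comp continuous_fst)
  have h2 : Continuous (coeff Y (lapl u)) := coeff_continuous_of hY
    (Φ := fun x _ => lapl u x) ((continuous_lapl hu).comp continuous_fst)
  refine AEMeasurable.congr (f := fun r => -(h : ℂ) ^ 2 * coeff Y (lapl u) r +
    (V r : ℂ) * coeff Y u r - ((E : ℂ) + ε * Complex.I) * coeff Y u r) ?_ ?_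
  · have := h1.measurable
    have := h2.measurable
    fun_prop
  · exact (ae_restrict_iff' measurableSet_Ioi).2
      (.of_forall fun r hr => (coeff_schr h E ε hY hu hr).symm)

lemma continuous_schr_sphere {n : ℕ} (V : ℝ → ℝ) (h E ε : ℝ) {u : Euc n → ℂ} (hu : ContDiff ℝ 2 u)
    {r : ℝ} (hr : 0 < r) : Continuous fun θ : Sph n => schr V h E ε u (r • (θ : Euc n)) := by
  simp only [schr, norm_smul_sphere hr]
  have h1 := hu.continuous
  have h2 := continuous_lapl hu
  fun_prop

open Filter Topology in
theorem exists_polar_bound {n : ℕ} (hn : 2 ≤ n) {Emin Emax s Cv R : ℝ} (hEm : 0 < Emin)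
    (hEE : Emin ≤ Emax) (hs1 : 1 / 2 < s) (hs2 : s ≤ 1) (hCv : 0 ≤ Cv) (hR : 1 ≤ R) :
    ∃ C > 0, ∃ h₀ > 0, ∀ {V : ℝ → ℝ}, Measurable V → (∀ r > 0, |V r| ≤ Cv) →
      (∀ r > R, V r = 0) → ∀ {h E ε : ℝ} {u : Euc n → ℂ}, 0 < h → h ≤ h₀ → Emin ≤ E →
      E ≤ Emax → 0 < ε → ContDiff ℝ 2 u → HasCompactSupport u →
      ∫⁻ r in Ioi (0 : ℝ), ENNReal.ofReal (r ^ (n - 1)) * (ENNReal.ofReal ((1 + r ^ 2) ^ (-s)) *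
        ∫⁻ θ : Sph n, ‖u (r • (θ : Euc n))‖ₑ ^ 2 ∂surf n) ≤ ENNReal.ofReal (Real.exp (C / h)) *
      ∫⁻ r in Ioi (0 : ℝ), ENNReal.ofReal (r ^ (n - 1)) * (ENNReal.ofReal ((1 + r ^ 2) ^ s) *
        ∫⁻ θ : Sph n, ‖schr V h E ε u (r • (θ : Euc n))‖ₑ ^ 2 ∂surf n) := by
  obtain ⟨C, hC, h₀, hh₀, key⟩ := exists_mode_bound hn hEm hEE hs1 hs2 hCv hR
  refine ⟨C, hC, h₀, hh₀, fun {V} hV hVb hVz {h E ε u} hh hhh hE1 hE2 hε hu hus => ?_⟩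
  obtain ⟨d, Y, lam, hY, hlam, hYe, hP⟩ := exists_spherical_harmonics n
  set W : ℝ → ENNReal := fun r => ENNReal.ofReal (r ^ (n - 1)) with hW
  set A : ℝ → ENNReal := fun r => ENNReal.ofReal ((1 + r ^ 2) ^ (-s)) with hA
  set B : ℝ → ENNReal := fun r => ENNReal.ofReal ((1 + r ^ 2) ^ s) with hB
  have mW : Measurable W := by fun_prop
  have mA : Measurable A := by fun_prop
  have mB : Measurable B := by fun_prop
  have hcu : ∀ k i, Continuous (coeff (Y k i) u) := fun k i =>
    coeff_continuous_of (hY k i).continuous (Φ := fun x _ => u x)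
      (hu.continuous.comp continuous_fst)
  have mu : ∀ k i, Measurable fun r => W r * (A r * ‖coeff (Y k i) u r‖ₑ ^ 2) := fun k i =>
    mW.mul (mA.mul ((hcu k i).measurable.enorm.pow_const 2))
  have mf : ∀ k i, AEMeasurable (fun r => W r * (B r * ‖coeff (Y k i) (schr V h E ε u) r‖ₑ ^ 2))
      (volume.restrict (Ioi 0)) := fun k i =>
    mW.aemeasurable.mul (mB.aemeasurable.mul
      ((measurable_coeff_schr hV h E ε (hY k i).continuous hu).enorm.pow_const 2))
  have hlim : ∀ r : ℝ, Tendsto (fun k => ∑ i, W r * (A r * ‖coeff (Y k i) u r‖ₑ ^ 2)) atTop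
      (𝓝 (W r * (A r * ∫⁻ θ : Sph n, ‖u (r • (θ : Euc n))‖ₑ ^ 2 ∂surf n))) := fun r => by
    simp_rw [← Finset.mul_sum]
    refine ENNReal.Tendsto.const_mul (ENNReal.Tendsto.const_mul ?_ (.inr ENNReal.ofReal_ne_top))
      (.inr ENNReal.ofReal_ne_top)
    have hc : Continuous fun θ : Sph n => u (r • (θ : Euc n)) := by
      have := hu.continuous
      fun_prop
    exact (hP _ hc).2
  have hbd : ∀ k, ∫⁻ r in Ioi (0 : ℝ), ∑ i, W r * (A r * ‖coeff (Y k i) u r‖ₑ ^ 2) ≤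
      ENNReal.ofReal (Real.exp (C / h)) * ∫⁻ r in Ioi (0 : ℝ), W r * (B r *
        ∫⁻ θ : Sph n, ‖schr V h E ε u (r • (θ : Euc n))‖ₑ ^ 2 ∂surf n) := fun k => by
    rw [lintegral_finsetSum _ fun i _ => mu k i]
    refine (Finset.sum_le_sum fun i _ => key hV hVb hVz hh hhh hE1 hE2 hε (hlam k i) hu hus
      (hY k i) (hYe k i)).trans ?_
    rw [← Finset.mul_sum, ← lintegral_finsetSum' _ fun i _ => mf k i]
    refine mul_le_mul' le_rfl (setLIntegral_mono' (measurableSet_Ioi (a := (0 : ℝ))) fun r hr => ?_)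
    rw [← Finset.mul_sum, ← Finset.mul_sum]
    gcongr
    exact (hP _ (continuous_schr_sphere V h E ε hu hr)).1 k
  calc _ = ∫⁻ r in Ioi (0 : ℝ), liminf
        (fun k => ∑ i, W r * (A r * ‖coeff (Y k i) u r‖ₑ ^ 2)) atTop :=
        lintegral_congr fun r => ((hlim r).liminf_eq).symm
    _ ≤ liminf (fun k => ∫⁻ r in Ioi (0 : ℝ), ∑ i, W r * (A r * ‖coeff (Y k i) u r‖ₑ ^ 2)) atTop :=
        lintegral_liminf_le fun k => Finset.measurable_fun_sum _ fun i _ => mu k i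
    _ ≤ _ := liminf_le_of_le (by isBoundedDefault) fun b hb => by
        obtain ⟨k, hk⟩ := hb.exists
        exact hk.trans (hbd k)

lemma lintegral_jbr_mul_sq {n : ℕ} (hn : n ≠ 0) (s : ℝ) {f : Euc n → ℂ} (hf : Measurable f) :
    ∫⁻ x, ‖(jbr s ‖x‖ : ℂ) * f x‖ₑ ^ 2 = ∫⁻ r in Ioi (0 : ℝ), ENNReal.ofReal (r ^ (n - 1)) *
      (ENNReal.ofReal ((1 + r ^ 2) ^ s) * ∫⁻ θ : Sph n, ‖f (r • (θ : Euc n))‖ₑ ^ 2 ∂surf n) := by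
  have hj : Measurable fun x : Euc n => (jbr s ‖x‖ : ℂ) := by
    unfold jbr
    fun_prop
  rw [lintegral_polar hn (by fun_prop)]
  refine setLIntegral_congr_fun measurableSet_Ioi fun r hr => ?_
  congr 1
  have hfr : Measurable fun θ : Sph n => f (r • (θ : Euc n)) := hf.comp (by fun_prop)
  rw [← lintegral_const_mul _ (by fun_prop)]
  refine lintegral_congr fun θ => ?_
  have h0 : 0 ≤ jbr s r := by unfold jbr; positivity
  rw [norm_smul_sphere hr, enorm_mul, mul_pow, ← ofReal_norm, Complex.norm_real,
    Real.norm_of_nonneg h0, ← ENNReal.ofReal_pow h0]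
  congr 2
  rw [jbr, ← Real.rpow_natCast, ← Real.rpow_mul (by positivity)]
  congr 1
  push_cast
  ring

lemma measurable_schr {n : ℕ} {V : ℝ → ℝ} (hV : Measurable V) (h E ε : ℝ) {u : Euc n → ℂ}
    (hu : ContDiff ℝ 2 u) : Measurable (schr V h E ε u) := by
  have h1 := hu.continuous.measurable
  have h2 := (continuous_lapl hu).measurable
  unfold schr
  fun_prop

lemma eLpNorm_two_le_of_sq {n : ℕ} {f g : Euc n → ℂ} {c : ℝ}
    (h : ∫⁻ x, ‖f x‖ₑ ^ 2 ≤ ENNReal.ofReal (Real.exp c) * ∫⁻ x, ‖g x‖ₑ ^ 2) :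
    eLpNorm f 2 volume ≤ ENNReal.ofReal (Real.exp (c / 2)) * eLpNorm g 2 volume := by
  have e : ∀ f : Euc n → ℂ, ∫⁻ x, ‖f x‖ₑ ^ 2 = eLpNorm f 2 volume ^ 2 := fun f => by
    have := eLpNorm_nnreal_pow_eq_lintegral (f := f) (μ := (volume : Measure (Euc n))) (p := 2)
      two_ne_zero
    simpa using this.symm
  rw [e, e, show c = c / 2 + c / 2 by ring, Real.exp_add, ← pow_two,
    ENNReal.ofReal_pow (Real.exp_pos _).le, ← mul_pow] at h
  exact (ENNReal.pow_le_pow_left_iff two_ne_zero).1 h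

/-- A priori-estimate form of the weighted resolvent bound
`‖⟨x⟩^{-s} (-h²Δ + V(|x|) - E - iε)⁻¹ ⟨x⟩^{-s}‖ ≤ e^{C/h}` for radial
`L^∞`, compactly supported potentials `V`, in dimension `n ≥ 2`. -/
theorem weighted_resolvent_exp_bound
    (n : ℕ) (hn : 2 ≤ n) (Emin Emax : ℝ) (hEmin : 0 < Emin) (hE : Emin ≤ Emax)
    (s : ℝ) (hs1 : 1 / 2 < s) (hs2 : s ≤ 1)
    (V : ℝ → ℝ) (hVmeas : Measurable V)
    (hVbdd : ∃ Cv : ℝ, ∀ᵐ r ∂(volume.restrict (Ioi (0 : ℝ))), |V r| ≤ Cv)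
    (hVsupp : HasCompactSupport V) :
    ∃ C > (0 : ℝ), ∃ h₀ > (0 : ℝ), ∀ ε > (0 : ℝ), ∀ h ∈ Ioc (0 : ℝ) h₀,
      ∀ E ∈ Icc Emin Emax,
      ∀ u : EuclideanSpace ℝ (Fin n) → ℂ, ContDiff ℝ (⊤ : ℕ∞) u → HasCompactSupport u →
        eLpNorm (fun x => (jbr (-s) ‖x‖ : ℂ) * u x) 2 volume ≤
          ENNReal.ofReal (Real.exp (C / h)) *
            eLpNorm (fun x => (jbr s ‖x‖ : ℂ) *
              (-(h : ℂ) ^ 2 * lapl u x + (V ‖x‖ : ℂ) * u x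
                - ((E : ℂ) + ε * Complex.I) * u x)) 2 volume := by
  obtain ⟨C₁, hC₁⟩ := hVbdd
  obtain ⟨R₁, hR₁⟩ := hVsupp.isCompact.isBounded.exists_norm_le
  obtain ⟨Cv, hCv0, hCv⟩ : ∃ Cv : ℝ, 0 ≤ Cv ∧ C₁ ≤ Cv := ⟨max 0 C₁, by simp, by simp⟩
  obtain ⟨R, hR0, hR⟩ : ∃ R : ℝ, 1 ≤ R ∧ R₁ ≤ R := ⟨max 1 R₁, by simp, by simp⟩
  obtain ⟨V', hV'm, hV'b, hV'z, hV'e⟩ : ∃ V' : ℝ → ℝ, Measurable V' ∧ (∀ r > 0, |V' r| ≤ Cv) ∧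
      (∀ r > R, V' r = 0) ∧ ∀ r, |V r| ≤ Cv → V' r = V r := by
    refine ⟨fun r => max (-Cv) (min Cv (V r)), by fun_prop, fun r _ => ?_, fun r hr => ?_,
      fun r hr => ?_⟩
    · rw [abs_le]
      exact ⟨le_max_left _ _, max_le (by linarith) (min_le_left _ _)⟩
    · have : V r = 0 := image_eq_zero_of_notMem_tsupport fun h => by
        have := (le_abs_self r).trans (hR₁ r h)
        linarith
      simp [this, hCv0]
    · rw [abs_le] at hr
      change max (-Cv) (min Cv (V r)) = V r
      rw [min_eq_right hr.2, max_eq_right hr.1]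
  obtain ⟨C, hC, h₀, hh₀, key⟩ := exists_polar_bound hn hEmin hE hs1 hs2 hCv0 hR0
  refine ⟨C / 2, by positivity, h₀, hh₀, fun ε hε h hh E hEE u hu hus => ?_⟩
  have hu2 : ContDiff ℝ 2 u := hu.of_le (WithTop.coe_le_coe.2 (le_top : (2 : ℕ∞) ≤ ⊤))
  have hn0 : n ≠ 0 := by omega
  rw [div_right_comm]
  apply eLpNorm_two_le_of_sq
  rw [lintegral_jbr_mul_sq hn0 (-s) hu.continuous.measurable]
  refine (key hV'm hV'b hV'z hh.1 hh.2 hEE.1 hEE.2 hε hu2 hus).trans (le_of_eq ?_)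
  refine congrArg _ (Eq.trans ?_
    (lintegral_jbr_mul_sq hn0 s (measurable_schr hVmeas h E ε hu2)).symm)
  refine lintegral_congr_ae ?_
  filter_upwards [hC₁, ae_restrict_mem measurableSet_Ioi] with r hr hr0
  simp only [schr, norm_smul_sphere (mem_Ioi.1 hr0), hV'e r (hr.trans hCv)]
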